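/- There is a universal constant C such that for every n ≥ 1, every d ≥ 1, every degree-d polynomial threshold function f : {-1,1}^n → {-1,1}, and every δ with 0 < δ < 1, the Boolean noise sensitivity satisfies NS_δ(f) ≤ C^d · δ^{1/(4d+6)}. -/

import Mathlib

open Finset MeasureTheory ProbabilityTheory
open scoped Classical

noncomputable section

/-- The ±1 real value of a Boolean bit (`true ↦ 1`, `false ↦ -1`). -/
def pmOne (b : Bool) : ℝ := if b then 1 else -1

/-- Noise sensitivity at rate `δ` of a Boolean function on the hypercube `{-1,1}^n`:
`Pr[f(X) ≠ f(Z)]` where `X` is uniform and `Z` flips each coordinate of `X`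
independently with probability `δ`. -/
def noiseSens {n : ℕ} (δ : ℝ) (f : (Fin n → Bool) → Bool) : ℝ :=
  (1 / 2 ^ n : ℝ) * ∑ x : Fin n → Bool, ∑ s : Fin n → Bool,
    (∏ i, if s i then δ else 1 - δ) * (if f x ≠ f (fun i => xor (s i) (x i)) then 1 else 0)

/-- Influence of the `i`-th variable: `Pr[f(X) ≠ f(X^{(i)})]`. -/
def influence {n : ℕ} (f : (Fin n → Bool) → Bool) (i : Fin n) : ℝ :=
  (1 / 2 ^ n : ℝ) * ∑ x : Fin n → Bool,
    if f x ≠ f (Function.update x i (!x i)) then 1 else 0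

/-- Average sensitivity (total influence). -/
def avgSens {n : ℕ} (f : (Fin n → Bool) → Bool) : ℝ := ∑ i, influence f i

/-- `f` is a degree-`d` polynomial threshold function: `f = sign(P)` for some real
polynomial of total degree at most `d`, with the convention `sign 0 = 1`. -/
def IsPTF {n : ℕ} (d : ℕ) (f : (Fin n → Bool) → Bool) : Prop :=
  ∃ P : MvPolynomial (Fin n) ℝ, P.totalDegree ≤ d ∧
    ∀ x, (f x = true ↔ 0 ≤ MvPolynomial.eval (fun i => pmOne (x i)) P)

/-- Evaluation of the multilinear polynomial with coefficients `a` at the point `x`. -/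
def mlEval {n : ℕ} (a : Finset (Fin n) → ℝ) (x : Fin n → ℝ) : ℝ :=
  ∑ I : Finset (Fin n), a I * ∏ i ∈ I, x i

/-- The multilinear polynomial with coefficients `a` has degree at most `d`. -/
def DegLE {n : ℕ} (a : Finset (Fin n) → ℝ) (d : ℕ) : Prop :=
  ∀ I, a I ≠ 0 → I.card ≤ d

/-- Squared weight `w_i²` of coordinate `i`: `Σ_{I ∋ i} a_I²`. -/
def wsq {n : ℕ} (a : Finset (Fin n) → ℝ) (i : Fin n) : ℝ :=
  ∑ I ∈ univ.filter (fun I : Finset (Fin n) => i ∈ I), a I ^ 2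

/-- `ε`-regularity: `Σ_i w_i⁴ ≤ ε² (Σ_i w_i²)²`. -/
def Regular {n : ℕ} (a : Finset (Fin n) → ℝ) (ε : ℝ) : Prop :=
  ∑ i, wsq a i ^ 2 ≤ ε ^ 2 * (∑ i, wsq a i) ^ 2

/-- `σ_{k+1}²(P) = Σ_{j ≥ k (0-based)} w_j²` (tail weight, `k` restricted variables). -/
def sigmaSq {n : ℕ} (a : Finset (Fin n) → ℝ) (k : ℕ) : ℝ :=
  ∑ j ∈ univ.filter (fun j : Fin n => k ≤ (j : ℕ)), wsq a j

/-- The variables are ordered by decreasing weight. -/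
def OrderedWeights {n : ℕ} (a : Finset (Fin n) → ℝ) : Prop :=
  ∀ i j : Fin n, i ≤ j → wsq a j ≤ wsq a i

/-- The `ε`-critical index `K(P,ε)`: least `k` such that `w_j² ≤ ε² σ_{k+1}²` for all
`j` beyond the first `k` variables. -/
def critIndex {n : ℕ} (a : Finset (Fin n) → ℝ) (ε : ℝ) : ℕ :=
  sInf {k : ℕ | ∀ j : Fin n, k ≤ (j : ℕ) → wsq a j ≤ ε ^ 2 * sigmaSq a k}

/-- Coefficients (in the variables `Y_j`, `j ≥ K`) of the restriction of the multilinear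
polynomial `a` obtained by fixing the first `K` variables to `x`. -/
def restCoeff {n : ℕ} (a : Finset (Fin n) → ℝ) (K : ℕ) (x : Fin n → ℝ)
    (J : Finset (Fin n)) : ℝ :=
  if ∀ j ∈ J, K ≤ (j : ℕ) then
    ∑ I ∈ univ.filter (fun I : Finset (Fin n) => I.filter (fun i => K ≤ i.val) = J),
      a I * ∏ i ∈ I.filter (fun i => i.val < K), x i
  else 0

/-- Standard Gaussian measure on `ℝ^n`. -/
def gaussn (n : ℕ) : Measure (Fin n → ℝ) := Measure.pi fun _ => gaussianReal 0 1

/-- Gaussian noise sensitivity: `Pr[f(X) ≠ f((1-δ)X + √(2δ-δ²)Y)]` for independent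
standard Gaussian vectors `X, Y`. -/
def gns (n : ℕ) (δ : ℝ) (f : (Fin n → ℝ) → ℝ) : ℝ :=
  (((gaussn n).prod (gaussn n))
    {p | f p.1 ≠ f (fun i => (1 - δ) * p.1 i + Real.sqrt (2 * δ - δ ^ 2) * p.2 i)}).toReal

/-- Normalized probabilists' Hermite polynomial `H_k(x)`. -/
def normHermite (k : ℕ) (x : ℝ) : ℝ :=
  Polynomial.aeval x (Polynomial.hermite k) / Real.sqrt (Nat.factorial k)

/-- Symmetric probability measures on the line with unit variance and sub-Gaussian
moment generating function. -/
class SymSubG (μ : Measure ℝ) : Prop extends IsProbabilityMeasure μ where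
  symm : μ.map Neg.neg = μ
  sq : ∫ t, t ^ 2 ∂μ = 1
  sg : HasSubgaussianMGF id 1 μ

section OneVar

variable {μ : Measure ℝ} [SymSubG μ]

lemma SymSubG.integrable_abs_pow (k : ℕ) : Integrable (fun t : ℝ => |t| ^ k) μ := by
  have h := (SymSubG.sg (μ := μ)).memLp (p := (k : NNReal))
  have := h.integrable_norm_pow'
  simpa using this

lemma SymSubG.integrable_pow (k : ℕ) : Integrable (fun t : ℝ => t ^ k) μ := by
  refine (SymSubG.integrable_abs_pow (μ := μ) k).mono' (by fun_prop) ?_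
  filter_upwards with t
  simp

lemma SymSubG.integral_neg_comp (f : ℝ → ℝ) : ∫ t, f (-t) ∂μ = ∫ t, f t ∂μ := by
  conv_rhs => rw [← SymSubG.symm (μ := μ)]
  exact ((MeasurableEquiv.neg ℝ).measurableEmbedding.integral_map f).symm

lemma SymSubG.integral_id : ∫ t, t ∂μ = 0 := by
  have := SymSubG.integral_neg_comp (μ := μ) (fun t => t)
  rw [integral_neg] at this
  linarith

lemma SymSubG.integral_cube : ∫ t, t ^ 3 ∂μ = 0 := by
  have := SymSubG.integral_neg_comp (μ := μ) (fun t => t ^ 3)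
  have h2 : ∀ t : ℝ, (-t) ^ 3 = -(t ^ 3) := fun t => by ring
  simp only [h2] at this
  rw [integral_neg] at this
  linarith

lemma even_odd_pow_le (a y c : ℝ) (ha : 0 ≤ a) (hy : 0 ≤ y) (hc : 0 < c) (hac : a ≤ c) (k : ℕ) :
    ((a + y) ^ k + (a - y) ^ k) / 2 ≤ c ^ k * Real.cosh (k * (y / c)) ∧
    ((a + y) ^ k - (a - y) ^ k) / 2 ≤ c ^ k * Real.sinh (k * (y / c)) := by
  induction k with
  | zero => simp
  | succ k ih =>
    obtain ⟨h1, h2⟩ := ih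
    have hu : 0 ≤ y / c := by positivity
    set u := y / c with hu_def
    have hyu : y = c * u := by rw [hu_def]; field_simp
    have hsh : u ≤ Real.sinh u := Real.self_le_sinh_iff.2 hu
    have hch : 1 ≤ Real.cosh u := Real.one_le_cosh u
    have hS : 0 ≤ Real.sinh (k * u) := Real.sinh_nonneg_iff.2 (by positivity)
    have hC : 0 ≤ Real.cosh (k * u) := (Real.cosh_pos _).le
    have hck : 0 ≤ c ^ k := by positivity
    have hk : ((k + 1 : ℕ) : ℝ) * u = k * u + u := by push_cast; ring
    rw [hk, Real.cosh_add, Real.sinh_add]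
    set F := ((a + y) ^ k + (a - y) ^ k) / 2 with hF
    set G := ((a + y) ^ k - (a - y) ^ k) / 2 with hG
    have e1 : ((a + y) ^ (k+1) + (a - y) ^ (k+1)) / 2 = a * F + y * G := by rw [hF, hG]; ring
    have e2 : ((a + y) ^ (k+1) - (a - y) ^ (k+1)) / 2 = a * G + y * F := by rw [hF, hG]; ring
    rw [e1, e2]
    have b1 : a * F ≤ c * (c ^ k * Real.cosh (k * u)) := by
      calc a * F ≤ a * (c ^ k * Real.cosh (k * u)) := by gcongr
        _ ≤ _ := by gcongr
    have b2 : a * G ≤ c * (c ^ k * Real.sinh (k * u)) := by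
      calc a * G ≤ a * (c ^ k * Real.sinh (k * u)) := by gcongr
        _ ≤ _ := by gcongr
    have b3 : y * F ≤ c * u * (c ^ k * Real.cosh (k * u)) := by
      rw [hyu] at *; gcongr
    have b4 : y * G ≤ c * u * (c ^ k * Real.sinh (k * u)) := by
      rw [hyu] at *; gcongr
    have p1 : Real.cosh (k * u) ≤ Real.cosh (k * u) * Real.cosh u := le_mul_of_one_le_right hC hch
    have p2 : Real.sinh (k * u) ≤ Real.sinh (k * u) * Real.cosh u := le_mul_of_one_le_right hS hch
    have p3 : u * Real.cosh (k * u) ≤ Real.cosh (k * u) * Real.sinh u := by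
      rw [mul_comm]; gcongr
    have p4 : u * Real.sinh (k * u) ≤ Real.sinh (k * u) * Real.sinh u := by
      rw [mul_comm]; gcongr
    have hck1 : 0 ≤ c ^ (k + 1) := by positivity
    constructor
    · calc a * F + y * G ≤ c ^ (k+1) * (Real.cosh (k * u) + u * Real.sinh (k * u)) := by
            rw [pow_succ]; linarith
        _ ≤ _ := by gcongr
    · calc a * G + y * F ≤ c ^ (k+1) * (Real.sinh (k * u) + u * Real.cosh (k * u)) := by
            rw [pow_succ]; linarith
        _ ≤ _ := by gcongr

lemma even_pow_symm_le (a y c : ℝ) (hc : 0 < c) (hac : |a| ≤ c) (m : ℕ) :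
    ((a + y) ^ (2 * m) + (a - y) ^ (2 * m)) / 2 ≤ c ^ (2 * m) * Real.cosh (2 * m * (y / c)) := by
  have h := (even_odd_pow_le |a| |y| c (abs_nonneg _) (abs_nonneg _) hc hac (2 * m)).1
  have e : Real.cosh (((2 * m : ℕ) : ℝ) * (|y| / c)) = Real.cosh (2 * m * (y / c)) := by
    rw [← Real.cosh_abs (2 * m * (y / c))]
    congr 1
    rw [abs_mul, abs_div, abs_of_pos hc]
    push_cast
    rw [abs_of_nonneg (by positivity : (0 : ℝ) ≤ 2 * m)]
  rw [e] at h
  refine le_trans (le_of_eq ?_) h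
  simp only [pow_mul]
  have s1 : (|a| + |y|) ^ 2 = a ^ 2 + y ^ 2 + 2 * (|a| * |y|) := by
    have := sq_abs a; have := sq_abs y; nlinarith
  have s2 : (|a| - |y|) ^ 2 = a ^ 2 + y ^ 2 - 2 * (|a| * |y|) := by
    have := sq_abs a; have := sq_abs y; nlinarith
  rw [s1, s2, ← abs_mul]
  rcases abs_cases (a * y) with ⟨h1, -⟩ | ⟨h1, -⟩ <;> rw [h1] <;> ring

lemma exp_two_mul_le {v : ℝ} (h0 : 0 ≤ v) (h1 : v ≤ 1) : Real.exp (2 * v) ≤ 1 + 7 * v := by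
  have h := convexOn_exp.2 (Set.mem_univ (0 : ℝ)) (Set.mem_univ (2 : ℝ))
    (by linarith : 0 ≤ 1 - v) h0 (by ring)
  simp only [smul_eq_mul, mul_zero, zero_add, Real.exp_zero, mul_one] at h
  have he : Real.exp 2 ≤ 8 := by
    have : Real.exp 2 = Real.exp 1 ^ 2 := by rw [← Real.exp_nat_mul]; norm_num
    rw [this]
    have := Real.exp_one_lt_d9
    have h0 := Real.exp_pos 1
    nlinarith
  rw [mul_comm 2 v]
  nlinarith

lemma SymSubG.integrable_poly (a b : ℝ) (k : ℕ) : Integrable (fun t : ℝ => (a + b * t) ^ k) μ := by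
  simp only [add_pow]
  refine integrable_finsetSum _ fun i _ => ?_
  have := (SymSubG.integrable_pow (μ := μ) (k - i)).const_mul (a ^ i * b ^ (k - i) * (k.choose i))
  refine this.congr ?_
  filter_upwards with t
  ring

/-- One-variable moment bound. -/
lemma SymSubG.integral_affine_pow_le (a b : ℝ) (m : ℕ) (hm : 1 ≤ m) :
    ∫ t, (a + b * t) ^ (2 * m) ∂μ ≤ (a ^ 2 + 8 * m * b ^ 2) ^ m := by
  have hm' : (1 : ℝ) ≤ m := by exact_mod_cast hm
  by_cases h0 : a = 0 ∧ b = 0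
  · obtain ⟨rfl, rfl⟩ := h0
    have : m ≠ 0 := by omega
    simp [zero_pow this, zero_pow (mul_ne_zero two_ne_zero this)]
  set w := max (a ^ 2) (m * b ^ 2) with hw
  have hwpos : 0 < w := by
    rcases not_and_or.1 h0 with h | h
    · exact lt_max_of_lt_left (by positivity)
    · exact lt_max_of_lt_right (by positivity)
  set c := Real.sqrt w with hc
  have hcpos : 0 < c := Real.sqrt_pos.2 hwpos
  have hc2 : c ^ 2 = w := Real.sq_sqrt hwpos.le
  have hac : |a| ≤ c := by
    rw [← Real.sqrt_sq_eq_abs]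
    exact Real.sqrt_le_sqrt (le_max_left _ _)
  have hsym : ∫ t, (a + b * t) ^ (2 * m) ∂μ
      = ∫ t, ((a + b * t) ^ (2 * m) + (a - b * t) ^ (2 * m)) / 2 ∂μ := by
    have h1 := SymSubG.integral_neg_comp (μ := μ) (fun t => (a + b * t) ^ (2 * m))
    have h2 : ∀ t : ℝ, a + b * -t = a - b * t := fun t => by ring
    simp only [h2] at h1
    have hi : Integrable (fun t : ℝ => (a - b * t) ^ (2 * m)) μ := by
      have := SymSubG.integrable_poly (μ := μ) a (-b) (2 * m)
      refine this.congr ?_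
      filter_upwards with t
      ring
    rw [integral_div, integral_add (SymSubG.integrable_poly a b _) hi, h1]
    ring
  set s : ℝ := 2 * m * (b / c) with hs
  have hie : ∀ s : ℝ, Integrable (fun t : ℝ => Real.exp (s * t)) μ := fun s =>
    (SymSubG.sg (μ := μ)).integrable_exp_mul s
  have hcosh : ∀ s t : ℝ, Real.cosh (s * t) = (Real.exp (s * t) + Real.exp (-s * t)) / 2 := by
    intro s t; rw [Real.cosh_eq, neg_mul]
  have hicosh : Integrable (fun t : ℝ => Real.cosh (s * t)) μ := by
    simp only [hcosh]
    exact ((hie s).add (hie (-s))).div_const 2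
  have hEcosh : ∫ t, Real.cosh (s * t) ∂μ ≤ Real.exp (s ^ 2 / 2) := by
    simp only [hcosh]
    rw [integral_div, integral_add (hie s) (hie (-s))]
    have h1 := (SymSubG.sg (μ := μ)).mgf_le s
    have h2 := (SymSubG.sg (μ := μ)).mgf_le (-s)
    simp only [mgf, id, NNReal.coe_one, one_mul, even_two, Even.neg_pow] at h1 h2
    linarith
  calc ∫ t, (a + b * t) ^ (2 * m) ∂μ
      = ∫ t, ((a + b * t) ^ (2 * m) + (a - b * t) ^ (2 * m)) / 2 ∂μ := hsym
    _ ≤ ∫ t, c ^ (2 * m) * Real.cosh (s * t) ∂μ := by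
        refine integral_mono_of_nonneg ?_ (hicosh.const_mul _) ?_
        · filter_upwards with t
          have h1 : 0 ≤ (a + b * t) ^ (2 * m) := (even_two_mul m).pow_nonneg _
          have h2 : 0 ≤ (a - b * t) ^ (2 * m) := (even_two_mul m).pow_nonneg _
          simp only [Pi.zero_apply]; linarith
        · filter_upwards with t
          have := even_pow_symm_le a (b * t) c hcpos hac m
          have e : s * t = 2 * m * (b * t / c) := by rw [hs]; ring
          rw [e]; exact this
    _ ≤ c ^ (2 * m) * Real.exp (s ^ 2 / 2) := by
        rw [integral_const_mul]; gcongr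
    _ = (w * Real.exp (2 * (m * b ^ 2 / w))) ^ m := by
        rw [mul_pow w, pow_mul, hc2, ← Real.exp_nat_mul]
        congr 2
        rw [hs, mul_pow, div_pow, hc2]
        ring
    _ ≤ _ := by
        have hv0 : 0 ≤ m * b ^ 2 / w := by positivity
        have hv1 : m * b ^ 2 / w ≤ 1 := (div_le_one hwpos).2 (le_max_right _ _)
        have hE := exp_two_mul_le hv0 hv1
        have hle : w ≤ a ^ 2 + m * b ^ 2 := max_le (by nlinarith [sq_nonneg b]) (by nlinarith [sq_nonneg a])
        gcongr
        calc w * Real.exp (2 * (m * b ^ 2 / w)) ≤ w * (1 + 7 * (m * b ^ 2 / w)) := by gcongr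
          _ = w + 7 * (m * b ^ 2) := by field_simp
          _ ≤ _ := by linarith

end OneVar

instance : SymSubG (gaussianReal 0 1) where
  symm := by
    have := gaussianReal_map_neg (μ := 0) (v := 1)
    simpa using this
  sq := by
    have h := variance_id_gaussianReal (μ := 0) (v := 1)
    rw [variance_eq_integral (by fun_prop)] at h
    simpa using h
  sg := by
    refine ⟨fun t => integrable_exp_mul_gaussianReal t, fun t => ?_⟩
    rw [mgf_id_gaussianReal]
    simp

/-- The Rademacher distribution on the line. -/
def rad : Measure ℝ := (2⁻¹ : ENNReal) • Measure.dirac 1 + (2⁻¹ : ENNReal) • Measure.dirac (-1)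

lemma integrable_rad (f : ℝ → ℝ) : Integrable f rad := by
  unfold rad
  refine Integrable.add_measure ?_ ?_ <;>
  exact Integrable.smul_measure (integrable_dirac (by simp)) (by simp)

lemma integral_rad (f : ℝ → ℝ) : ∫ t, f t ∂rad = (f 1 + f (-1)) / 2 := by
  unfold rad
  rw [integral_add_measure, integral_smul_measure, integral_smul_measure, integral_dirac,
    integral_dirac]
  · simp; ring
  · exact Integrable.smul_measure (integrable_dirac (by simp)) (by simp)
  · exact Integrable.smul_measure (integrable_dirac (by simp)) (by simp)

instance : SymSubG rad where
  measure_univ := by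
    simp [rad, ENNReal.inv_two_add_inv_two]
  symm := by
    unfold rad
    rw [Measure.map_add _ _ measurable_neg, Measure.map_smul, Measure.map_smul,
      Measure.map_dirac' measurable_neg, Measure.map_dirac' measurable_neg]
    rw [neg_neg, add_comm]
  sq := by rw [integral_rad]; norm_num
  sg := by
    refine ⟨fun t => integrable_rad _, fun t => ?_⟩
    simp only [mgf, id]
    rw [integral_rad]
    have := Real.cosh_le_exp_half_sq t
    rw [Real.cosh_eq] at this
    simpa using this

section Tame

variable {n : ℕ}

/-- Measurable functions with at most polynomial growth. -/
def Tame (F : (Fin n → ℝ) → ℝ) : Prop :=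
  Measurable F ∧ ∃ C : ℝ, ∃ k : ℕ, ∀ x, |F x| ≤ C * ∏ i, (1 + |x i|) ^ k

lemma one_le_prod_of_one_le {ι : Type*} (s : Finset ι) (f : ι → ℝ) (h : ∀ i, 1 ≤ f i) :
    1 ≤ ∏ i ∈ s, f i := by
  calc (1 : ℝ) = ∏ i ∈ s, 1 := by simp
    _ ≤ _ := Finset.prod_le_prod (fun _ _ => zero_le_one) fun i _ => h i

lemma one_le_prod_growth (x : Fin n → ℝ) (k : ℕ) : 1 ≤ ∏ i, (1 + |x i|) ^ k := by
  refine one_le_prod_of_one_le _ _ fun i => ?_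
  exact one_le_pow₀ (by have := abs_nonneg (x i); linarith)

lemma Tame.exists_nonneg {F : (Fin n → ℝ) → ℝ} (h : Tame F) (K : ℕ) :
    ∃ C : ℝ, 0 ≤ C ∧ ∃ k : ℕ, K ≤ k ∧ ∀ x, |F x| ≤ C * ∏ i, (1 + |x i|) ^ k := by
  obtain ⟨-, C, k, h⟩ := h
  refine ⟨|C|, abs_nonneg _, max K k, le_max_left _ _, fun x => (h x).trans ?_⟩
  have h1 := one_le_prod_growth x k
  gcongr with i
  · exact le_abs_self C
  · have := abs_nonneg (x i); linarith
  · exact le_max_right _ _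

lemma tame_const (c : ℝ) : Tame (fun _ : Fin n → ℝ => c) :=
  ⟨measurable_const, |c|, 0, fun x => by simp⟩

lemma tame_coord (i : Fin n) : Tame (fun x : Fin n → ℝ => x i) := by
  refine ⟨by fun_prop, 1, 1, fun x => ?_⟩
  rw [one_mul]
  rw [← Finset.mul_prod_erase univ _ (mem_univ i), pow_one]
  have h1 := one_le_prod_of_one_le (univ.erase i) (fun j => (1 + |x j|) ^ 1) fun j => by
    have := abs_nonneg (x j); linarith
  have h2 := abs_nonneg (x i)
  nlinarith

lemma Tame.add {F G : (Fin n → ℝ) → ℝ} (hF : Tame F) (hG : Tame G) : Tame (fun x => F x + G x) := by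
  obtain ⟨C, hC, k, -, h⟩ := hF.exists_nonneg 0
  obtain ⟨C', hC', k', hk, h'⟩ := hG.exists_nonneg k
  refine ⟨hF.1.add hG.1, C + C', k', fun x => (abs_add_le _ _).trans ?_⟩
  rw [add_mul]
  refine add_le_add ((h x).trans ?_) (h' x)
  gcongr with i
  have := abs_nonneg (x i); linarith

lemma Tame.mul {F G : (Fin n → ℝ) → ℝ} (hF : Tame F) (hG : Tame G) : Tame (fun x => F x * G x) := by
  obtain ⟨C, hC, k, -, h⟩ := hF.exists_nonneg 0
  obtain ⟨C', hC', k', -, h'⟩ := hG.exists_nonneg 0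
  refine ⟨hF.1.mul hG.1, C * C', k + k', fun x => ?_⟩
  rw [abs_mul]
  have : ∏ i, (1 + |x i|) ^ (k + k') = (∏ i, (1 + |x i|) ^ k) * ∏ i, (1 + |x i|) ^ k' := by
    rw [← prod_mul_distrib]; simp only [pow_add]
  rw [this]
  calc |F x| * |G x| ≤ (C * ∏ i, (1 + |x i|) ^ k) * (C' * ∏ i, (1 + |x i|) ^ k') := by
        gcongr
        · exact h x
        · exact h' x
    _ = _ := by ring

lemma Tame.const_mul {F : (Fin n → ℝ) → ℝ} (hF : Tame F) (c : ℝ) : Tame (fun x => c * F x) :=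
  (tame_const c).mul hF

lemma Tame.sub {F G : (Fin n → ℝ) → ℝ} (hF : Tame F) (hG : Tame G) : Tame (fun x => F x - G x) := by
  have := hF.add (hG.const_mul (-1))
  simpa [sub_eq_add_neg] using this

lemma Tame.pow {F : (Fin n → ℝ) → ℝ} (hF : Tame F) (k : ℕ) : Tame (fun x => F x ^ k) := by
  induction k with
  | zero => simpa using tame_const 1
  | succ k ih => simpa [pow_succ] using ih.mul hF

lemma Tame.sum {ι : Type*} (s : Finset ι) {F : ι → (Fin n → ℝ) → ℝ} (h : ∀ i ∈ s, Tame (F i)) :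
    Tame (fun x => ∑ i ∈ s, F i x) := by
  induction s using Finset.induction_on with
  | empty => simpa using tame_const 0
  | insert a s ha ih =>
    simp only [Finset.sum_insert ha]
    exact (h a (mem_insert_self _ _)).add (ih fun i hi => h i (mem_insert_of_mem hi))

lemma Tame.prod {ι : Type*} (s : Finset ι) {F : ι → (Fin n → ℝ) → ℝ} (h : ∀ i ∈ s, Tame (F i)) :
    Tame (fun x => ∏ i ∈ s, F i x) := by
  induction s using Finset.induction_on with
  | empty => simpa using tame_const 1
  | insert a s ha ih =>
    simp only [Finset.prod_insert ha]
    exact (h a (mem_insert_self _ _)).mul (ih fun i hi => h i (mem_insert_of_mem hi))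

lemma tame_mlEval (c : Finset (Fin n) → ℝ) : Tame (mlEval c) := by
  unfold mlEval
  exact Tame.sum _ fun I _ => (Tame.prod I fun i _ => tame_coord i).const_mul _

lemma Tame.integrable {F : (Fin n → ℝ) → ℝ} (hF : Tame F) (μ : Fin n → Measure ℝ)
    [∀ i, SymSubG (μ i)] : Integrable F (Measure.pi μ) := by
  obtain ⟨hm, C, k, h⟩ := hF
  have hi : Integrable (fun x : Fin n → ℝ => ∏ i, (1 + |x i|) ^ k) (Measure.pi μ) := by
    refine Integrable.fintype_prod (f := fun _ t => (1 + |t|) ^ k) fun i => ?_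
    simp only [add_pow]
    refine integrable_finsetSum _ fun j _ => ?_
    simpa using (SymSubG.integrable_abs_pow (μ := μ i) (k - j)).mul_const _
  exact (hi.const_mul C).mono' hm.aestronglyMeasurable (by filter_upwards with x using h x)

end Tame

section Resample

variable {n : ℕ}

lemma map_update_pi (μ : Fin n → Measure ℝ) [∀ i, IsProbabilityMeasure (μ i)] (i : Fin n)
    (ν : Measure ℝ) [IsProbabilityMeasure ν] :
    ((Measure.pi μ).prod ν).map (fun p => Function.update p.1 i p.2)
      = Measure.pi (Function.update μ i ν) := by
  have : ∀ j, IsProbabilityMeasure (Function.update μ i ν j) := by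
    intro j
    by_cases h : j = i
    · subst h; simpa
    · simpa [Function.update_of_ne h] using inferInstanceAs (IsProbabilityMeasure (μ j))
  symm
  refine Measure.pi_eq fun s hs => ?_
  have hmeas : Measurable (fun p : (Fin n → ℝ) × ℝ => Function.update p.1 i p.2) := by
    refine measurable_pi_iff.2 fun j => ?_
    by_cases h : j = i
    · subst h; simpa using measurable_snd
    · simp only [Function.update_of_ne h]; fun_prop
  rw [Measure.map_apply hmeas (MeasurableSet.univ_pi hs)]
  have hpre : (fun p : (Fin n → ℝ) × ℝ => Function.update p.1 i p.2) ⁻¹' (Set.univ.pi s)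
      = (Set.univ.pi (Function.update s i Set.univ)) ×ˢ (s i) := by
    ext ⟨x, t⟩
    simp only [Set.mem_preimage, Set.mem_pi, Set.mem_univ, true_imp_iff, Set.mem_prod]
    constructor
    · intro h
      refine ⟨fun j => ?_, by simpa using h i⟩
      by_cases hj : j = i
      · subst hj; simp
      · simpa [Function.update_of_ne hj] using h j
    · rintro ⟨h1, h2⟩ j
      by_cases hj : j = i
      · subst hj; simpa using h2
      · simpa [Function.update_of_ne hj] using h1 j
  rw [hpre, Measure.prod_prod, Measure.pi_pi, ← Finset.mul_prod_erase univ _ (mem_univ i),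
    ← Finset.mul_prod_erase univ (fun j => (Function.update μ i ν j) (s j)) (mem_univ i)]
  simp only [Function.update_self, measure_univ, one_mul]
  rw [mul_comm]
  congr 1
  refine Finset.prod_congr rfl fun j hj => ?_
  rw [Function.update_of_ne (Finset.ne_of_mem_erase hj), Function.update_of_ne (Finset.ne_of_mem_erase hj)]

lemma integral_pi_update (μ : Fin n → Measure ℝ) [∀ i, IsProbabilityMeasure (μ i)] (i : Fin n)
    (ν : Measure ℝ) [IsProbabilityMeasure ν] {F : (Fin n → ℝ) → ℝ}
    (hF : Integrable F (Measure.pi (Function.update μ i ν))) :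
    Integrable (fun p : (Fin n → ℝ) × ℝ => F (Function.update p.1 i p.2)) ((Measure.pi μ).prod ν) ∧
    ∫ x, F x ∂(Measure.pi (Function.update μ i ν))
      = ∫ x, ∫ t, F (Function.update x i t) ∂ν ∂(Measure.pi μ) := by
  have hmeas : Measurable (fun p : (Fin n → ℝ) × ℝ => Function.update p.1 i p.2) := by
    refine measurable_pi_iff.2 fun j => ?_
    by_cases h : j = i
    · subst h; simpa using measurable_snd
    · simp only [Function.update_of_ne h]; fun_prop
  rw [← map_update_pi] at hF ⊢
  have h2 := (integrable_map_measure hF.1 hmeas.aemeasurable).1 hF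
  refine ⟨h2, ?_⟩
  rw [integral_map hmeas.aemeasurable hF.1]
  exact integral_prod _ h2

lemma integral_pi_resample (μ : Fin n → Measure ℝ) [∀ i, IsProbabilityMeasure (μ i)] (i : Fin n)
    {F : (Fin n → ℝ) → ℝ} (hF : Integrable F (Measure.pi μ)) :
    Integrable (fun x => ∫ t, F (Function.update x i t) ∂(μ i)) (Measure.pi μ) ∧
    ∫ x, F x ∂(Measure.pi μ) = ∫ x, ∫ t, F (Function.update x i t) ∂(μ i) ∂(Measure.pi μ) := by
  have h := integral_pi_update μ i (μ i) (F := F) (by simpa using hF)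
  refine ⟨h.1.integral_prod_left, ?_⟩
  simpa using h.2

end Resample

section Coeff

variable {n : ℕ}

/-- Coefficients of the partial derivative in direction `a`. -/
def pderivCoeff (a : Fin n) (c : Finset (Fin n) → ℝ) (I : Finset (Fin n)) : ℝ :=
  if a ∈ I then 0 else c (insert a I)

/-- Coefficients of the part not involving the variable `a`. -/
def freeCoeff (a : Fin n) (c : Finset (Fin n) → ℝ) (I : Finset (Fin n)) : ℝ :=
  if a ∈ I then 0 else c I

lemma sum_finset_split (a : Fin n) (f : Finset (Fin n) → ℝ) :
    ∑ I, f I = ∑ I, if a ∈ I then 0 else (f I + f (insert a I)) := by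
  rw [← Finset.sum_filter_add_sum_filter_not univ (fun I : Finset (Fin n) => a ∈ I) f]
  have h1 : ∑ I, (if a ∈ I then 0 else (f I + f (insert a I)))
      = ∑ I ∈ univ.filter (fun I : Finset (Fin n) => ¬ a ∈ I), (f I + f (insert a I)) := by
    rw [Finset.sum_filter]
    refine Finset.sum_congr rfl fun I _ => ?_
    by_cases h : a ∈ I <;> simp [h]
  rw [h1, Finset.sum_add_distrib, add_comm]
  congr 1
  refine Finset.sum_nbij' (fun I => I.erase a) (fun I => insert a I) ?_ ?_ ?_ ?_ ?_
  · intro I hI; simp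
  · intro I hI; simp
  · intro I hI
    simp only [mem_filter, mem_univ, true_and] at hI
    exact Finset.insert_erase hI
  · intro I hI
    simp only [mem_filter, mem_univ, true_and] at hI
    exact Finset.erase_insert hI
  · intro I hI
    simp only [mem_filter, mem_univ, true_and] at hI
    rw [Finset.insert_erase hI]

lemma mlEval_split (a : Fin n) (c : Finset (Fin n) → ℝ) (x : Fin n → ℝ) :
    mlEval c x = mlEval (freeCoeff a c) x + x a * mlEval (pderivCoeff a c) x := by
  unfold mlEval
  rw [sum_finset_split a, Finset.mul_sum, ← Finset.sum_add_distrib]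
  refine Finset.sum_congr rfl fun I _ => ?_
  by_cases h : a ∈ I
  · simp [freeCoeff, pderivCoeff, h]
  · simp only [freeCoeff, pderivCoeff, h, if_false]
    rw [Finset.prod_insert h]; ring

lemma mlEval_update_of_free {a : Fin n} {c : Finset (Fin n) → ℝ} (h : ∀ I, a ∈ I → c I = 0)
    (x : Fin n → ℝ) (t : ℝ) : mlEval c (Function.update x a t) = mlEval c x := by
  unfold mlEval
  refine Finset.sum_congr rfl fun I _ => ?_
  by_cases hI : a ∈ I
  · simp [h I hI]
  · congr 1
    refine Finset.prod_congr rfl fun i hi => ?_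
    rw [Function.update_of_ne]
    rintro rfl
    exact hI hi

lemma mlEval_update (a : Fin n) (c : Finset (Fin n) → ℝ) (x : Fin n → ℝ) (t : ℝ) :
    mlEval c (Function.update x a t)
      = mlEval (freeCoeff a c) x + t * mlEval (pderivCoeff a c) x := by
  rw [mlEval_split a, mlEval_update_of_free, mlEval_update_of_free, Function.update_self]
  · intro I h; simp [pderivCoeff, h]
  · intro I h; simp [freeCoeff, h]

lemma sum_weight_split (a : Fin n) (c : Finset (Fin n) → ℝ) (A : ℝ) :
    ∑ I, A ^ I.card * c I ^ 2 = (∑ I, A ^ I.card * freeCoeff a c I ^ 2)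
      + A * ∑ I, A ^ I.card * pderivCoeff a c I ^ 2 := by
  rw [sum_finset_split a, Finset.mul_sum, ← Finset.sum_add_distrib]
  refine Finset.sum_congr rfl fun I _ => ?_
  by_cases h : a ∈ I
  · simp [freeCoeff, pderivCoeff, h]
  · simp only [freeCoeff, pderivCoeff, h, if_false, Finset.card_insert_of_notMem h]
    ring

lemma mlEval_of_support_empty {c : Finset (Fin n) → ℝ} (h : ∀ I, c I ≠ 0 → I ⊆ ∅) (x : Fin n → ℝ) :
    mlEval c x = c ∅ := by
  unfold mlEval
  rw [Finset.sum_eq_single ∅]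
  · simp
  · intro I _ hI
    have : c I = 0 := by
      by_contra h'
      exact hI (Finset.subset_empty.1 (h I h'))
    simp [this]
  · simp

lemma support_free {a : Fin n} {S : Finset (Fin n)} {c : Finset (Fin n) → ℝ}
    (h : ∀ I, c I ≠ 0 → I ⊆ insert a S) : ∀ I, freeCoeff a c I ≠ 0 → I ⊆ S := by
  intro I hI
  unfold freeCoeff at hI
  split_ifs at hI with ha
  · simp at hI
  · exact (Finset.subset_insert_iff_of_notMem ha).1 (h I hI)

lemma support_pderiv {a : Fin n} {S : Finset (Fin n)} {c : Finset (Fin n) → ℝ}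
    (h : ∀ I, c I ≠ 0 → I ⊆ insert a S) : ∀ I, pderivCoeff a c I ≠ 0 → I ⊆ S := by
  intro I hI
  unfold pderivCoeff at hI
  split_ifs at hI with ha
  · simp at hI
  · exact (Finset.subset_insert_iff_of_notMem ha).1 ((Finset.subset_insert a I).trans (h _ hI))

end Coeff

section Hypercontractivity

/-- Minkowski-type inequality for even moments. -/
lemma integral_sq_add_sq_pow_le {Ω : Type*} [MeasurableSpace Ω] {P : Measure Ω}
    {A B : Ω → ℝ} {m : ℕ} {α γ κ : ℝ} (hκ : 0 < κ) (hα : 0 ≤ α) (hγ : 0 ≤ γ)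
    (iA : Integrable (fun ω => A ω ^ (2 * m)) P) (iB : Integrable (fun ω => B ω ^ (2 * m)) P)
    (hA : ∫ ω, A ω ^ (2 * m) ∂P ≤ α ^ m) (hB : ∫ ω, B ω ^ (2 * m) ∂P ≤ γ ^ m) :
    ∫ ω, (A ω ^ 2 + κ * B ω ^ 2) ^ m ∂P ≤ (α + κ * γ) ^ m := by
  have key : ∀ e : ℝ, 0 < e →
      ∫ ω, (A ω ^ 2 + κ * B ω ^ 2) ^ m ∂P ≤ ((α + e) + κ * (γ + e)) ^ m := by
    intro e he
    set α' := α + e with hα'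
    set γ' := γ + e with hγ'
    have a0 : 0 < α' := by positivity
    have g0 : 0 < γ' := by positivity
    set T := α' + κ * γ' with hT
    have T0 : 0 < T := by positivity
    have hpt : ∀ ω, (A ω ^ 2 + κ * B ω ^ 2) ^ m ≤
        T ^ m * ((α' / T) * (A ω ^ (2 * m) / α' ^ m) + (κ * γ' / T) * (B ω ^ (2 * m) / γ' ^ m)) := by
      intro ω
      have hc := (convexOn_pow (𝕜 := ℝ) m).2
        (Set.mem_Ici.2 (by positivity : 0 ≤ A ω ^ 2 / α'))
        (Set.mem_Ici.2 (by positivity : 0 ≤ B ω ^ 2 / γ'))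
        (by positivity : 0 ≤ α' / T) (by positivity : 0 ≤ κ * γ' / T)
        (by rw [← add_div, ← hT, div_self T0.ne'])
      simp only [smul_eq_mul] at hc
      have e1 : A ω ^ 2 + κ * B ω ^ 2
          = T * (α' / T * (A ω ^ 2 / α') + κ * γ' / T * (B ω ^ 2 / γ')) := by
        field_simp
      rw [e1, mul_pow]
      gcongr
      rw [pow_mul, pow_mul, ← div_pow, ← div_pow]
      exact hc
    have hInt : Integrable (fun ω => T ^ m * ((α' / T) * (A ω ^ (2 * m) / α' ^ m)
        + (κ * γ' / T) * (B ω ^ (2 * m) / γ' ^ m))) P :=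
      (((iA.div_const _).const_mul _).add ((iB.div_const _).const_mul _)).const_mul _
    calc ∫ ω, (A ω ^ 2 + κ * B ω ^ 2) ^ m ∂P ≤ _ :=
          integral_mono_of_nonneg (by filter_upwards with ω; simp only [Pi.zero_apply]; positivity) hInt
            (by filter_upwards with ω using hpt ω)
      _ = T ^ m * ((α' / T) * ((∫ ω, A ω ^ (2 * m) ∂P) / α' ^ m)
          + (κ * γ' / T) * ((∫ ω, B ω ^ (2 * m) ∂P) / γ' ^ m)) := by
          rw [integral_const_mul, integral_add ((iA.div_const _).const_mul _)
            ((iB.div_const _).const_mul _), integral_const_mul, integral_const_mul,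
            integral_div, integral_div]
      _ ≤ T ^ m * ((α' / T) * 1 + (κ * γ' / T) * 1) := by
          have h1 : (∫ ω, A ω ^ (2 * m) ∂P) / α' ^ m ≤ 1 := by
            rw [div_le_one (by positivity)]
            exact hA.trans (by gcongr; linarith)
          have h2 : (∫ ω, B ω ^ (2 * m) ∂P) / γ' ^ m ≤ 1 := by
            rw [div_le_one (by positivity)]
            exact hB.trans (by gcongr; linarith)
          gcongr
      _ = T ^ m := by
          rw [mul_one, mul_one, ← add_div, ← hT, div_self T0.ne', mul_one]
  have hcont : Filter.Tendsto (fun e : ℝ => ((α + e) + κ * (γ + e)) ^ m) (nhdsWithin 0 (Set.Ioi 0))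
      (nhds (((α + 0) + κ * (γ + 0)) ^ m)) := by
    apply Filter.Tendsto.mono_left _ nhdsWithin_le_nhds
    exact Continuous.tendsto (by fun_prop) 0
  rw [add_zero, add_zero] at hcont
  refine ge_of_tendsto hcont ?_
  filter_upwards [self_mem_nhdsWithin] with e he using key e he

variable {n : ℕ} (μ : Fin n → Measure ℝ) [∀ i, SymSubG (μ i)]

/-- Hypercontractive moment bound for multilinear polynomials. -/
lemma integral_mlEval_pow_le {m : ℕ} (hm : 1 ≤ m) (c : Finset (Fin n) → ℝ) :
    ∫ x, mlEval c x ^ (2 * m) ∂(Measure.pi μ) ≤ (∑ I, (8 * m : ℝ) ^ I.card * c I ^ 2) ^ m := by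
  have key : ∀ S : Finset (Fin n), ∀ c : Finset (Fin n) → ℝ, (∀ I, c I ≠ 0 → I ⊆ S) →
      ∫ x, mlEval c x ^ (2 * m) ∂(Measure.pi μ) ≤ (∑ I, (8 * m : ℝ) ^ I.card * c I ^ 2) ^ m := by
    intro S
    induction S using Finset.induction_on with
    | empty =>
      intro c h
      simp only [mlEval_of_support_empty h]
      simp only [integral_const, probReal_univ, one_smul, pow_mul]
      gcongr
      have := Finset.single_le_sum (f := fun I : Finset (Fin n) => (8 * m : ℝ) ^ I.card * c I ^ 2)
        (fun I _ => by positivity) (mem_univ ∅)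
      simpa using this
    | insert a S ha ih =>
      intro c h
      have hA := ih _ (support_free h)
      have hB := ih _ (support_pderiv h)
      rw [sum_weight_split a]
      have hm' : (0 : ℝ) < 8 * m := by
        have : (1 : ℝ) ≤ m := by exact_mod_cast hm
        linarith
      refine le_trans ?_ (integral_sq_add_sq_pow_le hm' (by positivity) (by positivity)
        (((tame_mlEval _).pow _).integrable μ) (((tame_mlEval _).pow _).integrable μ) hA hB)
      rw [(integral_pi_resample μ a (((tame_mlEval c).pow (2 * m)).integrable μ)).2]
      refine integral_mono (integral_pi_resample μ a (((tame_mlEval c).pow (2 * m)).integrable μ)).1 ?_ ?_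
      · exact (((((tame_mlEval _).pow 2)).add (((tame_mlEval _).pow 2).const_mul _)).pow m).integrable μ
      · intro x
        simp only [mlEval_update]
        have := SymSubG.integral_affine_pow_le (μ := μ a) (mlEval (freeCoeff a c) x)
          (mlEval (pderivCoeff a c) x) m hm
        simpa only [mul_comm] using this
  exact key univ c fun I _ => subset_univ I

/-- Orthonormality of the characters. -/
lemma integral_mlEval_sq (c : Finset (Fin n) → ℝ) :
    ∫ x, mlEval c x ^ 2 ∂(Measure.pi μ) = ∑ I, c I ^ 2 := by
  have key : ∀ S : Finset (Fin n), ∀ c : Finset (Fin n) → ℝ, (∀ I, c I ≠ 0 → I ⊆ S) →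
      ∫ x, mlEval c x ^ 2 ∂(Measure.pi μ) = ∑ I, c I ^ 2 := by
    intro S
    induction S using Finset.induction_on with
    | empty =>
      intro c h
      simp only [mlEval_of_support_empty h]
      simp only [integral_const, probReal_univ, one_smul]
      rw [Finset.sum_eq_single ∅]
      · intro I _ hI
        have : c I = 0 := by
          by_contra h'
          exact hI (Finset.subset_empty.1 (h I h'))
        simp [this]
      · simp
    | insert a S ha ih =>
      intro c h
      have hA := ih _ (support_free h)
      have hB := ih _ (support_pderiv h)
      have hs := sum_weight_split a c 1
      simp only [one_pow, one_mul] at hs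
      rw [hs, ← hA, ← hB, (integral_pi_resample μ a (((tame_mlEval c).pow 2).integrable μ)).2,
        ← integral_add (((tame_mlEval _).pow 2).integrable μ) (((tame_mlEval _).pow 2).integrable μ)]
      refine integral_congr_ae ?_
      filter_upwards with x
      simp only [mlEval_update]
      set A := mlEval (freeCoeff a c) x
      set B := mlEval (pderivCoeff a c) x
      have i1 := SymSubG.integrable_pow (μ := μ a) 1
      have i2 := SymSubG.integrable_pow (μ := μ a) 2
      simp only [pow_one] at i1
      have e : ∀ t : ℝ, (A + t * B) ^ 2 = A ^ 2 + (2 * A * B) * t + B ^ 2 * t ^ 2 := fun t => by ring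
      simp only [e]
      have i3 : Integrable (fun t : ℝ => A ^ 2 + 2 * A * B * t) (μ a) :=
        (integrable_const _).add (i1.const_mul _)
      rw [integral_add i3 (i2.const_mul _),
        integral_add (integrable_const _) (i1.const_mul _), integral_const_mul, integral_const_mul,
        SymSubG.integral_id, SymSubG.sq]
      simp
  exact key univ c fun I _ => subset_univ I

lemma sum_weight_le_of_degLE {c : Finset (Fin n) → ℝ} {d : ℕ} (h : DegLE c d) {A : ℝ} (hA : 1 ≤ A) :
    ∑ I, A ^ I.card * c I ^ 2 ≤ A ^ d * ∑ I, c I ^ 2 := by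
  rw [Finset.mul_sum]
  refine Finset.sum_le_sum fun I _ => ?_
  by_cases hI : c I = 0
  · simp [hI]
  · gcongr
    exact h I hI

lemma integral_mlEval_four_le {c : Finset (Fin n) → ℝ} {d : ℕ} (h : DegLE c d) :
    ∫ x, mlEval c x ^ 4 ∂(Measure.pi μ) ≤ 256 ^ d * (∑ I, c I ^ 2) ^ 2 := by
  have h1 := integral_mlEval_pow_le μ (m := 2) (by norm_num) c
  norm_num at h1
  refine h1.trans ?_
  have h2 := sum_weight_le_of_degLE h (A := 16) (by norm_num)
  calc (∑ I, (16 : ℝ) ^ I.card * c I ^ 2) ^ 2 ≤ (16 ^ d * ∑ I, c I ^ 2) ^ 2 := by gcongr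
    _ = _ := by rw [mul_pow, ← pow_mul, mul_comm d 2, pow_mul]; norm_num

end Hypercontractivity

section PaleyZygmund

lemma paley_zygmund {Ω : Type*} [MeasurableSpace Ω] {P : Measure Ω} [IsProbabilityMeasure P]
    {Z : Ω → ℝ} {B : ℝ} (hm : Measurable Z) (h0 : ∀ ω, 0 ≤ Z ω) (i1 : Integrable Z P)
    (i2 : Integrable (fun ω => Z ω ^ 2) P) (hB : 1 ≤ B)
    (h : ∫ ω, Z ω ^ 2 ∂P ≤ B * (∫ ω, Z ω ∂P) ^ 2) :
    1 / (4 * B) ≤ P.real {ω | (∫ ω, Z ω ∂P) / 2 ≤ Z ω} := by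
  set e := ∫ ω, Z ω ∂P with he
  have e0 : 0 ≤ e := integral_nonneg h0
  have hB0 : 0 < B := by linarith
  rcases e0.eq_or_lt with h' | h'
  · have : {ω | e / 2 ≤ Z ω} = Set.univ := by
      ext ω; simp [← h', h0 ω]
    rw [this, probReal_univ, div_le_one (by positivity)]
    linarith
  set A := {ω | e / 2 ≤ Z ω} with hA
  have mA : MeasurableSet A := measurableSet_le measurable_const hm
  set s := 1 / (2 * B * e) with hs
  have s0 : 0 < s := by positivity
  have iA : Integrable (A.indicator (1 : Ω → ℝ)) P := (integrable_const 1).indicator mA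
  have hle : e ≤ ∫ ω, (e / 2 + (s * Z ω ^ 2 / 2 + A.indicator 1 ω / (2 * s))) ∂P := by
    refine integral_mono i1 ((integrable_const _).add (((i2.const_mul s).div_const 2).add
      (iA.div_const _))) fun ω => ?_
    by_cases hω : ω ∈ A
    · simp only [Set.indicator_of_mem hω, Pi.one_apply]
      have : Z ω ≤ s * Z ω ^ 2 / 2 + 1 / (2 * s) := by
        have h1 : s * Z ω ^ 2 / 2 + 1 / (2 * s) - Z ω = (s * Z ω - 1) ^ 2 / (2 * s) := by
          field_simp; ring
        have h2 : 0 ≤ (s * Z ω - 1) ^ 2 / (2 * s) := by positivity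
        linarith
      linarith
    · simp only [Set.indicator_of_notMem hω]
      have : Z ω < e / 2 := not_le.1 hω
      have h2 : 0 ≤ s * Z ω ^ 2 / 2 := by positivity
      simp only [zero_div, add_zero]; linarith
  have j1 : Integrable (fun ω => s * Z ω ^ 2 / 2) P := (i2.const_mul s).div_const 2
  have j2 : Integrable (fun ω => A.indicator (1 : Ω → ℝ) ω / (2 * s)) P := iA.div_const _
  have j3 : Integrable (fun ω => s * Z ω ^ 2 / 2 + A.indicator (1 : Ω → ℝ) ω / (2 * s)) P := j1.add j2
  rw [integral_add (integrable_const _) j3, integral_add j1 j2, integral_div, integral_div, integral_div,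
    integral_const_mul, integral_indicator_one mA] at hle
  simp only [integral_const, probReal_univ, one_smul] at hle
  have h3 : s * ∫ ω, Z ω ^ 2 ∂P ≤ e / 2 := by
    calc s * ∫ ω, Z ω ^ 2 ∂P ≤ s * (B * e ^ 2) := by gcongr
      _ = e / 2 := by rw [hs]; field_simp
  have h4 : P.real A / (2 * s) = B * e * P.real A := by rw [hs]; field_simp
  rw [h4] at hle
  rw [div_le_iff₀ (by positivity)]
  have : e * 1 ≤ e * (P.real A * (4 * B)) := by nlinarith
  exact le_of_mul_le_mul_left this h'

lemma integral_sum_sq_sq_le {Ω ι : Type*} [MeasurableSpace Ω] {P : Measure Ω}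
    (T : Finset ι) {f : ι → Ω → ℝ} {a : ι → ℝ} {B : ℝ} (hB : 0 ≤ B) (ha : ∀ s, 0 ≤ a s)
    (i4 : ∀ s, Integrable (fun ω => f s ω ^ 4) P)
    (h : ∀ s, ∫ ω, f s ω ^ 4 ∂P ≤ B * a s ^ 2) :
    ∫ ω, (∑ s ∈ T, f s ω ^ 2) ^ 2 ∂P ≤ B * (∑ s ∈ T, a s) ^ 2 := by
  have key : ∀ e : ℝ, 0 < e →
      ∫ ω, (∑ s ∈ T, f s ω ^ 2) ^ 2 ∂P ≤ B * (∑ s ∈ T, (a s + e)) ^ 2 := by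
    intro e he
    have hpos : ∀ s, 0 < a s + e := fun s => by have := ha s; linarith
    have hi : Integrable (fun ω => ∑ s ∈ T, f s ω ^ 4 / (a s + e)) P :=
      integrable_finsetSum _ fun s _ => (i4 s).div_const _
    calc ∫ ω, (∑ s ∈ T, f s ω ^ 2) ^ 2 ∂P
        ≤ ∫ ω, (∑ s ∈ T, (a s + e)) * ∑ s ∈ T, f s ω ^ 4 / (a s + e) ∂P := by
          refine integral_mono_of_nonneg (by filter_upwards with ω; simp only [Pi.zero_apply]; positivity)
            (hi.const_mul _) ?_
          filter_upwards with ω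
          refine Finset.sum_sq_le_sum_mul_sum_of_sq_le_mul T (fun s _ => (hpos s).le)
            (fun s _ => by have := hpos s; positivity) fun s _ => ?_
          have := (hpos s).ne'
          refine le_of_eq ?_
          field_simp
      _ = (∑ s ∈ T, (a s + e)) * ∑ s ∈ T, (∫ ω, f s ω ^ 4 ∂P) / (a s + e) := by
          rw [integral_const_mul, integral_finsetSum _ fun s _ => (i4 s).div_const _]
          simp only [integral_div]
      _ ≤ (∑ s ∈ T, (a s + e)) * ∑ s ∈ T, B * (a s + e) := by
          have : ∀ s, (∫ ω, f s ω ^ 4 ∂P) / (a s + e) ≤ B * (a s + e) := by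
            intro s
            rw [div_le_iff₀ (hpos s)]
            refine (h s).trans ?_
            rw [mul_assoc, ← pow_two]
            have := ha s
            gcongr
            linarith
          have h0 : 0 ≤ ∑ s ∈ T, (a s + e) := Finset.sum_nonneg fun s _ => (hpos s).le
          gcongr with s
          exact this s
      _ = _ := by rw [← Finset.mul_sum]; ring
  have hcont : Filter.Tendsto (fun e : ℝ => B * (∑ s ∈ T, (a s + e)) ^ 2) (nhdsWithin 0 (Set.Ioi 0))
      (nhds (B * (∑ s ∈ T, (a s + 0)) ^ 2)) := by
    apply Filter.Tendsto.mono_left _ nhdsWithin_le_nhds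
    exact Continuous.tendsto (by fun_prop) 0
  simp only [add_zero] at hcont
  refine ge_of_tendsto hcont ?_
  filter_upwards [self_mem_nhdsWithin] with e he using key e he

variable {n : ℕ} (μ : Fin n → Measure ℝ) [∀ i, SymSubG (μ i)]

lemma integral_sum_mlEval_sq {ι : Type*} (T : Finset ι) (c : ι → Finset (Fin n) → ℝ) :
    ∫ x, ∑ s ∈ T, mlEval (c s) x ^ 2 ∂(Measure.pi μ) = ∑ s ∈ T, ∑ I, c s I ^ 2 := by
  rw [integral_finsetSum _ fun s _ => ((tame_mlEval (c s)).pow 2).integrable μ]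
  simp only [integral_mlEval_sq]

lemma integral_sum_mlEval_sq_sq_le {ι : Type*} (T : Finset ι) (c : ι → Finset (Fin n) → ℝ) {d : ℕ}
    (h : ∀ s, DegLE (c s) d) :
    ∫ x, (∑ s ∈ T, mlEval (c s) x ^ 2) ^ 2 ∂(Measure.pi μ)
      ≤ 256 ^ d * (∑ s ∈ T, ∑ I, c s I ^ 2) ^ 2 :=
  integral_sum_sq_sq_le T (by positivity) (fun s => by positivity)
    (fun s => ((tame_mlEval (c s)).pow 4).integrable μ) fun s => integral_mlEval_four_le μ (h s)

/-- A sum of squares of low degree polynomials is at least half its mean with noticeable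
probability. -/
lemma prob_sum_mlEval_sq_ge {ι : Type*} (T : Finset ι) (c : ι → Finset (Fin n) → ℝ) {d : ℕ}
    (h : ∀ s, DegLE (c s) d) :
    1 / (4 * 256 ^ d) ≤ (Measure.pi μ).real
      {x | (∑ s ∈ T, ∑ I, c s I ^ 2) / 2 ≤ ∑ s ∈ T, mlEval (c s) x ^ 2} := by
  have ht : Tame (fun x => ∑ s ∈ T, mlEval (c s) x ^ 2) :=
    Tame.sum T fun s _ => (tame_mlEval (c s)).pow 2
  have := paley_zygmund (P := Measure.pi μ) (B := 256 ^ d) ht.1 (fun x => by positivity)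
    (ht.integrable μ) ((ht.pow 2).integrable μ) (one_le_pow₀ (by norm_num))
    (by rw [integral_sum_mlEval_sq]; exact integral_sum_mlEval_sq_sq_le μ T c h)
  rwa [integral_sum_mlEval_sq] at this

end PaleyZygmund

section Cube

variable {n : ℕ}

/-- The point of `ℝⁿ` corresponding to a Boolean vector. -/
def pmVec (x : Fin n → Bool) (i : Fin n) : ℝ := pmOne (x i)

/-- Average over the Boolean cube. -/
def cubeAvg (F : (Fin n → Bool) → ℝ) : ℝ := (1 / 2 ^ n : ℝ) * ∑ x, F x

lemma integral_pi_rad (F : (Fin n → ℝ) → ℝ) (hF : Measurable F) :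
    ∫ x, F x ∂(Measure.pi fun _ : Fin n => rad) = cubeAvg fun x => F (pmVec x) := by
  set ν : Measure Bool := (2⁻¹ : ENNReal) • Measure.dirac true + (2⁻¹ : ENNReal) • Measure.dirac false
    with hν
  have : IsProbabilityMeasure ν := ⟨by simp [hν, ENNReal.inv_two_add_inv_two]⟩
  have hmp : Measurable pmOne := measurable_of_finite _
  have hr : rad = ν.map pmOne := by
    rw [hν, Measure.map_add _ _ hmp, Measure.map_smul, Measure.map_smul,
      Measure.map_dirac' hmp, Measure.map_dirac' hmp]
    simp [rad, pmOne]
  have hpi : (Measure.pi fun _ : Fin n => rad) = (Measure.pi fun _ : Fin n => ν).map pmVec := by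
    have hsf : IsProbabilityMeasure (ν.map pmOne) := Measure.isProbabilityMeasure_map hmp.aemeasurable
    rw [hr]
    exact (Measure.pi_map_pi (μ := fun _ : Fin n => ν) (f := fun _ => pmOne)
      (fun _ => hmp.aemeasurable)).symm
  rw [hpi, integral_map (measurable_of_finite _).aemeasurable hF.aestronglyMeasurable,
    integral_fintype (.of_finite), cubeAvg, Finset.mul_sum]
  refine Finset.sum_congr rfl fun x _ => ?_
  rw [smul_eq_mul]
  congr 1
  rw [Measure.real, Measure.pi_singleton]
  have : ∀ b : Bool, ν {b} = 2⁻¹ := by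
    intro b; cases b <;> simp [hν]
  simp [this]

lemma cubeAvg_mono {F G : (Fin n → Bool) → ℝ} (h : ∀ x, F x ≤ G x) : cubeAvg F ≤ cubeAvg G := by
  unfold cubeAvg
  gcongr with x
  exact h x

lemma cubeAvg_const (a : ℝ) : cubeAvg (fun _ : Fin n → Bool => a) = a := by
  simp [cubeAvg]

lemma cubeAvg_add (F G : (Fin n → Bool) → ℝ) :
    cubeAvg (fun x => F x + G x) = cubeAvg F + cubeAvg G := by
  unfold cubeAvg; rw [Finset.sum_add_distrib]; ring

lemma cubeAvg_const_mul (a : ℝ) (F : (Fin n → Bool) → ℝ) :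
    cubeAvg (fun x => a * F x) = a * cubeAvg F := by
  unfold cubeAvg; rw [← Finset.mul_sum]; ring

lemma cubeAvg_sum {ι : Type*} (T : Finset ι) (F : ι → (Fin n → Bool) → ℝ) :
    cubeAvg (fun x => ∑ s ∈ T, F s x) = ∑ s ∈ T, cubeAvg (F s) := by
  unfold cubeAvg; rw [Finset.sum_comm, Finset.mul_sum]

/-- Fraction of the cube on which a predicate holds. -/
def cubeProb (p : (Fin n → Bool) → Prop) : ℝ := cubeAvg fun x => if p x then 1 else 0

lemma measure_pi_rad (p : (Fin n → ℝ) → Prop) (hp : MeasurableSet {x | p x}) :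
    (Measure.pi fun _ : Fin n => rad).real {x | p x} = cubeProb fun x => p (pmVec x) := by
  rw [← integral_indicator_one hp, integral_pi_rad _ (measurable_one.indicator hp)]
  rfl

lemma cubeProb_mono {p q : (Fin n → Bool) → Prop} (h : ∀ x, p x → q x) : cubeProb p ≤ cubeProb q := by
  refine cubeAvg_mono fun x => ?_
  by_cases hp : p x
  · simp [hp, h x hp]
  · simp only [hp, if_false]; split_ifs <;> norm_num

lemma cubeProb_or_le (p q : (Fin n → Bool) → Prop) :
    cubeProb (fun x => p x ∨ q x) ≤ cubeProb p + cubeProb q := by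
  unfold cubeProb
  rw [← cubeAvg_add]
  refine cubeAvg_mono fun x => ?_
  by_cases hp : p x <;> by_cases hq : q x <;> simp [hp, hq]

lemma cubeProb_compl (p : (Fin n → Bool) → Prop) : cubeProb (fun x => ¬ p x) = 1 - cubeProb p := by
  have h := cubeAvg_const (n := n) 1
  unfold cubeProb
  rw [eq_sub_iff_add_eq, ← cubeAvg_add]
  refine Eq.trans ?_ h
  congr 1; funext x
  by_cases hp : p x <;> simp [hp]

lemma cubeProb_markov {F : (Fin n → Bool) → ℝ} (h : ∀ x, 0 ≤ F x) {t : ℝ} :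
    t * cubeProb (fun x => t ≤ F x) ≤ cubeAvg F := by
  unfold cubeProb
  rw [← cubeAvg_const_mul]
  refine cubeAvg_mono fun x => ?_
  by_cases ht : t ≤ F x
  · simp [ht]
  · simpa [ht] using h x

end Cube

section Rotation

variable {n : ℕ}

lemma gaussn_eq_map : gaussn n = (stdGaussian (EuclideanSpace ℝ (Fin n))).map
    (EuclideanSpace.equiv (Fin n) ℝ : EuclideanSpace ℝ (Fin n) →L[ℝ] (Fin n → ℝ)) := by
  rw [← map_pi_eq_stdGaussian, Measure.map_map (by fun_prop) (by fun_prop)]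
  have : (⇑(EuclideanSpace.equiv (Fin n) ℝ : EuclideanSpace ℝ (Fin n) →L[ℝ] (Fin n → ℝ)) ∘
    WithLp.toLp 2) = id := by
    ext x i; simp
  rw [this, Measure.map_id]
  rfl

instance : IsGaussian (gaussn n) := by
  rw [gaussn_eq_map]; infer_instance

lemma gaussn_rotation (θ : ℝ) :
    ((gaussn n).prod (gaussn n)).map (ContinuousLinearMap.rotation θ)
      = (gaussn n).prod (gaussn n) := by
  refine IsGaussian.map_rotation_eq_self ?_ θ
  rw [gaussn_eq_map, integral_map (by fun_prop) (by fun_prop)]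
  simp only [id]
  rw [ContinuousLinearMap.integral_comp_comm, integral_id_stdGaussian, map_zero]
  exact IsGaussian.integrable_id

end Rotation

section RootCounting

open Polynomial in
/-- If the logarithmic derivative of a complex polynomial is large at a point then there is a
root close to that point. -/
lemma exists_root_near {Q : ℂ[X]} {k : ℕ} (hk : Q.natDegree ≤ k) {z : ℂ} {η : ℝ} (hη : 0 < η)
    (h : ‖Q.eval z‖ < η * ‖Q.derivative.eval z‖) : ∃ w ∈ Q.roots.toFinset, ‖z - w‖ < k * η := by
  have hQ0 : Q ≠ 0 := by
    rintro rfl; simp at h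
  have hkpos : 0 < k := by
    refine lt_of_lt_of_le (Nat.pos_of_ne_zero fun h0 => ?_) hk
    rw [Polynomial.natDegree_eq_zero] at h0
    obtain ⟨x, rfl⟩ := h0
    simp at h
    linarith [norm_nonneg x]
  have hkr : (0 : ℝ) < k := by exact_mod_cast hkpos
  by_cases hz : Q.eval z = 0
  · exact ⟨z, by simp [hQ0, hz], by simpa using by positivity⟩
  by_contra! hcon
  have hs := (IsAlgClosed.splits Q).eval_derivative_div_eval_of_ne_zero hz
  have h1 : 1 / η < ‖Q.derivative.eval z / Q.eval z‖ := by
    rw [norm_div, div_lt_div_iff₀ hη (norm_pos_iff.2 hz)]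
    linarith
  rw [hs] at h1
  have h2 : ‖(Q.roots.map fun w => 1 / (z - w)).sum‖ ≤ (Q.roots.map fun w => 1 / (k * η)).sum := by
    refine (norm_multiset_sum_le _).trans ?_
    rw [Multiset.map_map]
    refine Multiset.sum_map_le_sum_map _ _ fun w hw => ?_
    simp only [Function.comp, norm_div, norm_one]
    exact one_div_le_one_div_of_le (by positivity) (hcon w (by simpa using hw))
  rw [Multiset.map_const', Multiset.sum_replicate, nsmul_eq_mul] at h2
  have h3 : (Multiset.card Q.roots : ℝ) ≤ k := by
    exact_mod_cast (Polynomial.card_roots' Q).trans hk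
  have h4 : (Multiset.card Q.roots : ℝ) * (1 / (k * η)) ≤ 1 / η := by
    calc (Multiset.card Q.roots : ℝ) * (1 / (k * η)) ≤ k * (1 / (k * η)) := by gcongr
      _ = 1 / η := by field_simp
  linarith

lemma abs_sub_le_two_mul_abs_sin_sub {a b : ℝ} (ha : a ∈ Set.Icc (0 : ℝ) 1) (hb : b ∈ Set.Icc (0 : ℝ) 1) :
    |a - b| ≤ 2 * |Real.sin a - Real.sin b| := by
  wlog hab : b ≤ a generalizing a b
  · rw [abs_sub_comm, abs_sub_comm (Real.sin a)]
    exact this hb ha (le_of_not_ge hab)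
  have key : ∀ x ∈ Set.Icc (0 : ℝ) 1, 1 / 2 ≤ Real.cos x := by
    intro x hx
    have := Real.one_sub_sq_div_two_le_cos (x := x)
    nlinarith [hx.1, hx.2]
  have := (convex_Icc (0 : ℝ) 1).mul_sub_le_image_sub_of_le_deriv (f := Real.sin) (C := 1 / 2)
    Real.continuous_sin.continuousOn Real.differentiable_sin.differentiableOn
    (fun x hx => by rw [Real.deriv_sin]; exact key x (interior_subset hx)) b hb a ha hab
  rw [abs_of_nonneg (by linarith)]
  have h2 := le_abs_self (Real.sin a - Real.sin b)
  linarith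

lemma card_le_of_diam (S : Finset ℕ) {L : ℝ} (hL : 0 ≤ L) (h : ∀ i ∈ S, ∀ j ∈ S, |(i : ℝ) - j| ≤ L) :
    (S.card : ℝ) ≤ L + 1 := by
  rcases S.eq_empty_or_nonempty with rfl | hne
  · simp; linarith
  have hsub : S ⊆ Finset.Icc (S.min' hne) (S.max' hne) := fun i hi =>
    Finset.mem_Icc.2 ⟨S.min'_le i hi, S.le_max' i hi⟩
  have h1 := Finset.card_le_card hsub
  rw [Nat.card_Icc] at h1
  have h2 := h _ (S.max'_mem hne) _ (S.min'_mem hne)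
  have h3 : S.min' hne ≤ S.max' hne := S.min'_le _ (S.max'_mem hne)
  have h4 : (S.card : ℝ) ≤ (S.max' hne : ℝ) + 1 - S.min' hne := by
    have : S.card + S.min' hne ≤ S.max' hne + 1 := by omega
    have : (S.card : ℝ) + S.min' hne ≤ S.max' hne + 1 := by exact_mod_cast this
    linarith
  have := le_abs_self ((S.max' hne : ℝ) - S.min' hne)
  linarith

/-- Few points of a fine grid on an arc of the unit circle are close to a given point. -/
lemma card_grid_near (N : ℕ) (hN : 0 < N) (w : ℂ) {r : ℝ} (hr : 0 ≤ r) :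
    (((Finset.range N).filter fun j : ℕ =>
      ‖Complex.exp (((j / N : ℝ) : ℂ) * Complex.I) - w‖ < r).card : ℝ) ≤ 4 * r * N + 1 := by
  have hNr : (0 : ℝ) < N := by exact_mod_cast hN
  refine card_le_of_diam _ (by positivity) fun i hi j hj => ?_
  rw [Finset.mem_filter, Finset.mem_range] at hi hj
  have hmem : ∀ i : ℕ, i < N → (i / N : ℝ) ∈ Set.Icc (0 : ℝ) 1 := fun i hi =>
    ⟨by positivity, by rw [div_le_one hNr]; exact_mod_cast hi.le⟩
  have h1 := abs_sub_le_two_mul_abs_sin_sub (hmem i hi.1) (hmem j hj.1)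
  have him : ∀ t : ℝ, (Complex.exp ((t : ℂ) * Complex.I)).im = Real.sin t := fun t => by
    rw [Complex.exp_ofReal_mul_I_im]
  have h2 : |Real.sin (i / N) - Real.sin (j / N)| ≤ 2 * r := by
    rw [← him, ← him, ← Complex.sub_im]
    refine (Complex.abs_im_le_norm _).trans ?_
    have := norm_sub_le (Complex.exp (((i / N : ℝ) : ℂ) * Complex.I) - w)
      (Complex.exp (((j / N : ℝ) : ℂ) * Complex.I) - w)
    rw [sub_sub_sub_cancel_right] at this
    linarith [hi.2, hj.2]
  rw [← sub_div, abs_div, abs_of_pos hNr, div_le_iff₀ hNr] at h1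
  nlinarith

open Polynomial in
lemma card_grid_log_deriv {Q : ℂ[X]} {k : ℕ} (hk : Q.natDegree ≤ k) {η : ℝ} (hη : 0 < η)
    (N : ℕ) (hN : 0 < N) :
    (((Finset.range N).filter fun j : ℕ =>
      ‖Q.eval (Complex.exp (((j / N : ℝ) : ℂ) * Complex.I))‖ <
        η * ‖Q.derivative.eval (Complex.exp (((j / N : ℝ) : ℂ) * Complex.I))‖).card : ℝ)
      ≤ k * (4 * (k * η) * N + 1) := by
  set S := (Finset.range N).filter fun j : ℕ =>
      ‖Q.eval (Complex.exp (((j / N : ℝ) : ℂ) * Complex.I))‖ <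
        η * ‖Q.derivative.eval (Complex.exp (((j / N : ℝ) : ℂ) * Complex.I))‖ with hS
  have hG := fun w => card_grid_near N hN w (r := k * η) (by positivity)
  set G : ℂ → Finset ℕ := fun w => (Finset.range N).filter fun j : ℕ =>
        ‖Complex.exp (((j / N : ℝ) : ℂ) * Complex.I) - w‖ < k * η with hGdef
  have hsub : S ⊆ Q.roots.toFinset.biUnion G := by
    intro j hj
    rw [Finset.mem_filter] at hj
    obtain ⟨w, hw, hw2⟩ := exists_root_near hk hη hj.2
    exact Finset.mem_biUnion.2 ⟨w, hw, Finset.mem_filter.2 ⟨hj.1, hw2⟩⟩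
  have h1 : S.card ≤ ∑ w ∈ Q.roots.toFinset, (G w).card :=
    (Finset.card_le_card hsub).trans Finset.card_biUnion_le
  have h2 : (Q.roots.toFinset.card : ℝ) ≤ k := by
    exact_mod_cast (Multiset.toFinset_card_le _).trans ((Polynomial.card_roots' Q).trans hk)
  have h3 : (S.card : ℝ) ≤ ∑ w ∈ Q.roots.toFinset, ((G w).card : ℝ) := by
    have : (S.card : ℝ) ≤ ((∑ w ∈ Q.roots.toFinset, (G w).card : ℕ) : ℝ) := Nat.cast_le.2 h1
    rwa [Nat.cast_sum] at this
  refine h3.trans ((Finset.sum_le_sum fun w _ => hG w).trans ?_)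
  rw [Finset.sum_const, nsmul_eq_mul]
  gcongr

end RootCounting

section DirectionalDerivative

variable {n : ℕ}

/-- Coefficients of the derivative in the direction `y`. -/
def dirD (c : Finset (Fin n) → ℝ) (y : Fin n → ℝ) (I : Finset (Fin n)) : ℝ :=
  ∑ i, y i * pderivCoeff i c I

lemma mlEval_dirD (c : Finset (Fin n) → ℝ) (x y : Fin n → ℝ) :
    mlEval (dirD c y) x = ∑ i, y i * mlEval (pderivCoeff i c) x := by
  unfold mlEval dirD
  simp only [Finset.sum_mul, Finset.mul_sum]
  rw [Finset.sum_comm]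
  refine Finset.sum_congr rfl fun i _ => Finset.sum_congr rfl fun I _ => by ring

@[fun_prop]
lemma measurable_mlEval (c : Finset (Fin n) → ℝ) : Measurable (mlEval c) := (tame_mlEval c).1

lemma measurable_mlEval_dirD (c : Finset (Fin n) → ℝ) :
    Measurable (fun p : (Fin n → ℝ) × (Fin n → ℝ) => mlEval (dirD c p.2) p.1) := by
  simp only [mlEval_dirD]
  fun_prop

lemma degLE_pderivCoeff {c : Finset (Fin n) → ℝ} {d : ℕ} (h : DegLE c d) (i : Fin n) :
    DegLE (pderivCoeff i c) (d - 1) := by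
  intro I hI
  unfold pderivCoeff at hI
  split_ifs at hI with hi
  · exact absurd rfl hI
  · have := h _ hI
    rw [Finset.card_insert_of_notMem hi] at this
    omega

lemma degLE_dirD {c : Finset (Fin n) → ℝ} {d : ℕ} (h : DegLE c d) (y : Fin n → ℝ) :
    DegLE (dirD c y) (d - 1) := by
  intro I hI
  obtain ⟨i, -, hi⟩ := Finset.exists_ne_zero_of_sum_ne_zero hI
  exact degLE_pderivCoeff h i I (right_ne_zero_of_mul hi)

lemma hasDerivAt_mlEval (c : Finset (Fin n) → ℝ) {x : ℝ → Fin n → ℝ} {x' : Fin n → ℝ} {t : ℝ}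
    (h : ∀ i, HasDerivAt (fun s => x s i) (x' i) t) :
    HasDerivAt (fun s => mlEval c (x s)) (mlEval (dirD c x') (x t)) t := by
  have h1 : HasDerivAt (fun s => mlEval c (x s))
      (∑ I : Finset (Fin n), c I * ∑ i ∈ I, (∏ j ∈ I.erase i, x t j) • x' i) t := by
    unfold mlEval
    refine HasDerivAt.fun_sum fun I _ => HasDerivAt.const_mul _ ?_
    exact HasDerivAt.fun_finsetProd fun i _ => h i
  convert h1 using 1
  rw [mlEval_dirD]
  have h2 : ∀ I : Finset (Fin n), c I * ∑ i ∈ I, (∏ j ∈ I.erase i, x t j) • x' i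
      = ∑ i, if i ∈ I then x' i * (c I * ∏ j ∈ I.erase i, x t j) else 0 := by
    intro I
    rw [Finset.sum_ite_mem, Finset.univ_inter, Finset.mul_sum]
    refine Finset.sum_congr rfl fun i _ => ?_
    rw [smul_eq_mul]; ring
  simp only [h2]
  rw [Finset.sum_comm]
  refine Finset.sum_congr rfl fun i _ => ?_
  rw [sum_finset_split i]
  unfold mlEval
  rw [Finset.mul_sum]
  refine Finset.sum_congr rfl fun I _ => ?_
  by_cases hi : i ∈ I
  · simp [pderivCoeff, hi]
  · simp [pderivCoeff, hi, Finset.erase_insert hi]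

end DirectionalDerivative

section Circle

open Polynomial

variable {n : ℕ}

/-- The complex polynomial describing a multilinear polynomial along a great circle. -/
def circPoly (c : Finset (Fin n) → ℝ) (d : ℕ) (x y : Fin n → ℝ) : ℂ[X] :=
  ∑ I : Finset (Fin n), C (c I : ℂ) * (∏ i ∈ I, (C ((x i - y i * Complex.I) / 2) * X ^ 2
    + C ((x i + y i * Complex.I) / 2))) * X ^ (d - I.card)

lemma natDegree_circPoly {c : Finset (Fin n) → ℝ} {d : ℕ} (h : DegLE c d) (x y : Fin n → ℝ) :
    (circPoly c d x y).natDegree ≤ 2 * d := by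
  refine Polynomial.natDegree_sum_le_of_forall_le _ _ fun I _ => ?_
  by_cases hI : c I = 0
  · simp [hI]
  have hd := h I hI
  have h1 : (∏ i ∈ I, (C ((x i - y i * Complex.I) / 2) * X ^ 2
    + C ((x i + y i * Complex.I) / 2))).natDegree ≤ ∑ i ∈ I, 2 := by
    refine (Polynomial.natDegree_prod_le _ _).trans (Finset.sum_le_sum fun i _ => ?_)
    compute_degree
  rw [Finset.sum_const, smul_eq_mul] at h1
  refine Polynomial.natDegree_mul_le.trans ?_
  rw [Polynomial.natDegree_X_pow]
  have h2 := Polynomial.natDegree_C_mul_le (c I : ℂ) (∏ i ∈ I, (C ((x i - y i * Complex.I) / 2) * X ^ 2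
    + C ((x i + y i * Complex.I) / 2)))
  omega

lemma eval_circPoly {c : Finset (Fin n) → ℝ} {d : ℕ} (h : DegLE c d) (x y : Fin n → ℝ) (θ : ℝ) :
    (circPoly c d x y).eval (Complex.exp (θ * Complex.I))
      = Complex.exp (θ * Complex.I) ^ d *
        ((mlEval c fun i => Real.cos θ * x i + Real.sin θ * y i : ℝ) : ℂ) := by
  unfold circPoly mlEval
  rw [Polynomial.eval_finsetSum, Complex.ofReal_sum, Finset.mul_sum]
  refine Finset.sum_congr rfl fun I _ => ?_
  by_cases hI : c I = 0
  · simp [hI]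
  have hd := h I hI
  set z := Complex.exp (θ * Complex.I) with hz
  have hzc : z = Complex.cos θ + Complex.sin θ * Complex.I := Complex.exp_mul_I _
  have h1 : ∀ i, (x i - y i * Complex.I) / 2 * z ^ 2 + (x i + y i * Complex.I) / 2
      = z * ((Real.cos θ * x i + Real.sin θ * y i : ℝ) : ℂ) := by
    intro i
    push_cast
    have h2 := Complex.sin_sq_add_cos_sq (θ : ℂ)
    have h3 := Complex.I_sq
    rw [hzc]
    set C := Complex.cos θ
    set S := Complex.sin θ
    linear_combination (-(x i + y i * Complex.I) / 2) * h2 + ((x i : ℂ) * S ^ 2 / 2 - y i * C * S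
      - y i * S ^ 2 * Complex.I / 2) * h3
  simp only [Polynomial.eval_mul, Polynomial.eval_C, Polynomial.eval_prod, Polynomial.eval_add,
    Polynomial.eval_pow, Polynomial.eval_X, h1, Finset.prod_mul_distrib, Finset.prod_const]
  have h4 : z ^ d = z ^ I.card * z ^ (d - I.card) := by
    rw [← pow_add]; congr 1; omega
  rw [h4]
  push_cast
  ring

lemma norm_deriv_on_circle_le {c : Finset (Fin n) → ℝ} {d : ℕ} (h : DegLE c d) (x y : Fin n → ℝ)
    (θ : ℝ) :
    |mlEval (dirD c fun i => -Real.sin θ * x i + Real.cos θ * y i)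
      (fun i => Real.cos θ * x i + Real.sin θ * y i)|
    ≤ ‖(circPoly c d x y).derivative.eval (Complex.exp (θ * Complex.I))‖
      + d * |mlEval c fun i => Real.cos θ * x i + Real.sin θ * y i| := by
  set q' := mlEval (dirD c fun i => -Real.sin θ * x i + Real.cos θ * y i)
      (fun i => Real.cos θ * x i + Real.sin θ * y i) with hq'
  set Q := circPoly c d x y with hQ
  have hq : HasDerivAt (fun s : ℝ => mlEval c fun i => Real.cos s * x i + Real.sin s * y i) q' θ :=
    hasDerivAt_mlEval c (x := fun s i => Real.cos s * x i + Real.sin s * y i) fun i =>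
      ((Real.hasDerivAt_cos θ).mul_const _).add ((Real.hasDerivAt_sin θ).mul_const _)
  set z := Complex.exp (θ * Complex.I) with hz
  have hzn : ‖z‖ = 1 := Complex.norm_exp_ofReal_mul_I θ
  have he : HasDerivAt (fun s : ℝ => Complex.exp (s * Complex.I)) (z * Complex.I) θ := by
    have h0 : HasDerivAt (fun s : ℝ => (s : ℂ) * Complex.I) (1 * Complex.I) θ :=
      (Complex.ofRealCLM.hasDerivAt).mul_const _
    simpa using h0.cexp
  have h1 : HasDerivAt (fun s : ℝ => Q.eval (Complex.exp (s * Complex.I)))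
      (Q.derivative.eval z * (z * Complex.I)) θ :=
    HasDerivAt.comp (h₂ := fun w : ℂ => Q.eval w) θ (Q.hasDerivAt z) he
  have h2 := (he.fun_pow d).fun_mul hq.ofReal_comp
  have h3 : (fun s : ℝ => Q.eval (Complex.exp (s * Complex.I))) = fun s : ℝ =>
      Complex.exp (s * Complex.I) ^ d *
        ((mlEval c fun i => Real.cos s * x i + Real.sin s * y i : ℝ) : ℂ) := by
    funext s; exact eval_circPoly h x y s
  rw [h3] at h1
  have h4 := h1.unique h2
  rw [← hz] at h4
  set q := mlEval c fun i => Real.cos θ * x i + Real.sin θ * y i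
  have h5 : z ^ d * (q' : ℂ) = Q.derivative.eval z * (z * Complex.I)
      - d * (z ^ (d - 1) * (z * Complex.I)) * q := by
    rw [h4]; ring
  have h6 := congrArg norm h5
  rw [norm_mul, norm_pow, hzn, one_pow, one_mul, Complex.norm_real, Real.norm_eq_abs] at h6
  rw [h6]
  refine (norm_sub_le _ _).trans ?_
  simp [hzn]

/-- A great circle rarely meets the region where a polynomial is small compared with its
derivative. -/
lemma card_grid_small {c : Finset (Fin n) → ℝ} {d : ℕ} (h : DegLE c d) (x y : Fin n → ℝ) {ε : ℝ}
    (hε : 0 < ε) (hεd : ε * d ≤ 1 / 2) (N : ℕ) (hN : 0 < N) :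
    (((Finset.range N).filter fun j : ℕ =>
      |mlEval c fun i => Real.cos (j / N) * x i + Real.sin (j / N) * y i| <
      ε * |mlEval (dirD c fun i => -Real.sin (j / N) * x i + Real.cos (j / N) * y i)
        (fun i => Real.cos (j / N) * x i + Real.sin (j / N) * y i)|).card : ℝ)
      ≤ (2 * d : ℕ) * (4 * ((2 * d : ℕ) * (2 * ε)) * N + 1) := by
  refine le_trans ?_ (card_grid_log_deriv (natDegree_circPoly h x y) (η := 2 * ε) (by positivity) N hN)
  rw [Nat.cast_le]
  refine Finset.card_le_card fun j hj => ?_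
  rw [Finset.mem_filter] at hj ⊢
  refine ⟨hj.1, ?_⟩
  have h1 := norm_deriv_on_circle_le h x y (j / N)
  have h2 := eval_circPoly h x y (j / N)
  have h3 := hj.2
  set q := mlEval c fun i => Real.cos (j / N) * x i + Real.sin (j / N) * y i
  set q' := mlEval (dirD c fun i => -Real.sin (j / N) * x i + Real.cos (j / N) * y i)
        (fun i => Real.cos (j / N) * x i + Real.sin (j / N) * y i)
  rw [h2, norm_mul, norm_pow, Complex.norm_exp_ofReal_mul_I, one_pow, one_mul, Complex.norm_real,
    Real.norm_eq_abs]
  set D := ‖(circPoly c d x y).derivative.eval (Complex.exp (((j / N : ℝ) : ℂ) * Complex.I))‖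
  have h5 : |q| < ε * D + (ε * d) * |q| := by
    calc |q| < ε * |q'| := h3
      _ ≤ ε * (D + d * |q|) := by gcongr
      _ = _ := by ring
  have h6 : (ε * d) * |q| ≤ 1 / 2 * |q| := by gcongr
  linarith

lemma gaussn_small_vs_deriv {c : Finset (Fin n) → ℝ} {d : ℕ} (hd : 1 ≤ d) (h : DegLE c d) {ε : ℝ}
    (hε : 0 < ε) :
    ((gaussn n).prod (gaussn n)).real
      {p | |mlEval c p.1| < ε * |mlEval (dirD c p.2) p.1|} ≤ 34 * d ^ 2 * ε := by
  set E := {p : (Fin n → ℝ) × (Fin n → ℝ) | |mlEval c p.1| < ε * |mlEval (dirD c p.2) p.1|} with hE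
  set M := (gaussn n).prod (gaussn n) with hM
  have hdr : (1 : ℝ) ≤ d := by exact_mod_cast hd
  rcases le_or_gt (ε * d) (1 / 2) with hεd | hεd
  swap
  · have h1 : M.real E ≤ 1 := measureReal_le_one
    nlinarith
  have mE : MeasurableSet E := by
    refine measurableSet_lt ?_ ?_
    · exact ((measurable_mlEval c).comp measurable_fst).abs
    · exact (measurable_mlEval_dirD c).abs.const_mul ε
  obtain ⟨N, hN⟩ := exists_nat_gt (1 / ε)
  have hNr : (0 : ℝ) < N := lt_trans (by positivity) hN
  have hN0 : 0 < N := by exact_mod_cast hNr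
  have hrot : ∀ j : ℕ, M.real E
      = ∫ p, E.indicator 1 (ContinuousLinearMap.rotation (j / N : ℝ) p) ∂M := by
    intro j
    have hmr : Measurable (ContinuousLinearMap.rotation (j / N : ℝ) : (Fin n → ℝ) × (Fin n → ℝ) →L[ℝ] _) := by
      fun_prop
    conv_lhs => rw [hM, ← gaussn_rotation (j / N : ℝ), ← hM]
    rw [← integral_indicator_one mE, integral_map hmr.aemeasurable]
    exact ((measurable_one.indicator mE).aestronglyMeasurable)
  have hInt : ∀ j : ℕ, Integrable (fun p => E.indicator (1 : (Fin n → ℝ) × (Fin n → ℝ) → ℝ)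
      (ContinuousLinearMap.rotation (j / N : ℝ) p)) M := by
    intro j
    have hmr : Measurable (ContinuousLinearMap.rotation (j / N : ℝ) : (Fin n → ℝ) × (Fin n → ℝ) →L[ℝ] _) := by
      fun_prop
    refine Integrable.of_bound ((measurable_one.indicator mE).comp hmr).aestronglyMeasurable 1 ?_
    filter_upwards with p
    simp only [Set.indicator_apply]
    split_ifs <;> simp
  set K : ℝ := (2 * d : ℕ) * (4 * ((2 * d : ℕ) * (2 * ε)) * N + 1) with hK
  have hsum : N * M.real E ≤ K := by
    calc N * M.real E = ∑ j ∈ Finset.range N, M.real E := by simp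
      _ = ∑ j ∈ Finset.range N, ∫ p, E.indicator 1 (ContinuousLinearMap.rotation (j / N : ℝ) p) ∂M :=
          Finset.sum_congr rfl fun j _ => hrot j
      _ = ∫ p, ∑ j ∈ Finset.range N, E.indicator 1 (ContinuousLinearMap.rotation (j / N : ℝ) p) ∂M :=
          (integral_finsetSum _ fun j _ => hInt j).symm
      _ ≤ ∫ p, K ∂M := by
          refine integral_mono (integrable_finsetSum _ fun j _ => hInt j) (integrable_const _) fun p => ?_
          refine le_trans (le_of_eq ?_) (card_grid_small h p.1 p.2 hε hεd N hN0)
          rw [Finset.card_filter, Nat.cast_sum]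
          refine Finset.sum_congr rfl fun j _ => ?_
          rw [Set.indicator_apply]
          simp only [hE, Set.mem_ofPred_eq, ContinuousLinearMap.rotation_apply]
          push_cast
          rfl
      _ = K := by simp
  have h1 : (1 : ℝ) ≤ ε * N := by
    rw [div_lt_iff₀ hε] at hN; linarith
  have h2 : K ≤ N * (34 * d ^ 2 * ε) := by
    rw [hK]; push_cast
    have : 2 * (d : ℝ) ≤ 2 * d ^ 2 * (ε * N) := by nlinarith
    nlinarith
  exact le_of_mul_le_mul_left (hsum.trans h2) hNr

end Circle

section LevelWeights

variable {n : ℕ}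

/-- Coefficients of the linear form with coefficient vector `a`. -/
def linCoeff (a : Fin n → ℝ) (J : Finset (Fin n)) : ℝ := ∑ i, if J = {i} then a i else 0

lemma mlEval_linCoeff (a y : Fin n → ℝ) : mlEval (linCoeff a) y = ∑ i, a i * y i := by
  unfold mlEval linCoeff
  simp only [Finset.sum_mul, ite_mul, zero_mul]
  rw [Finset.sum_comm]
  simp

lemma sum_sq_linCoeff (a : Fin n → ℝ) : ∑ J, linCoeff a J ^ 2 = ∑ i, a i ^ 2 := by
  have h : ∀ J, linCoeff a J ^ 2 = ∑ i, if J = {i} then a i ^ 2 else 0 := by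
    intro J
    unfold linCoeff
    by_cases hJ : ∃ j, J = {j}
    · obtain ⟨j, rfl⟩ := hJ
      simp [Finset.singleton_inj]
    · push Not at hJ
      simp [hJ]
  simp only [h]
  rw [Finset.sum_comm]
  simp

lemma degLE_linCoeff (a : Fin n → ℝ) : DegLE (linCoeff a) 1 := by
  intro J hJ
  obtain ⟨i, -, hi⟩ := Finset.exists_ne_zero_of_sum_ne_zero hJ
  have : J = {i} := by
    by_contra h
    simp [h] at hi
  simp [this]

lemma dirD_eq_mlEval (c : Finset (Fin n) → ℝ) (y : Fin n → ℝ) (I : Finset (Fin n)) :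
    dirD c y I = mlEval (linCoeff fun i => pderivCoeff i c I) y := by
  rw [mlEval_linCoeff]
  exact Finset.sum_congr rfl fun i _ => mul_comm _ _

@[fun_prop]
lemma measurable_dirD (c : Finset (Fin n) → ℝ) (I : Finset (Fin n)) :
    Measurable fun y => dirD c y I := by
  simp only [dirD_eq_mlEval]
  fun_prop

lemma tame_dirD (c : Finset (Fin n) → ℝ) (I : Finset (Fin n)) : Tame fun y => dirD c y I := by
  simp only [dirD_eq_mlEval]
  exact tame_mlEval _

lemma sum_sq_pderivCoeff (c : Finset (Fin n) → ℝ) (g : ℕ → ℝ) :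
    ∑ I, g I.card * ∑ i, pderivCoeff i c I ^ 2 = ∑ J, J.card * g (J.card - 1) * c J ^ 2 := by
  have h : ∀ i : Fin n, ∑ I, g I.card * pderivCoeff i c I ^ 2
      = ∑ J, if i ∈ J then g (J.card - 1) * c J ^ 2 else 0 := by
    intro i
    rw [sum_finset_split i (fun J => if i ∈ J then g (J.card - 1) * c J ^ 2 else 0)]
    refine Finset.sum_congr rfl fun I _ => ?_
    by_cases hi : i ∈ I
    · simp [pderivCoeff, hi]
    · simp [pderivCoeff, hi]
  simp only [Finset.mul_sum]
  rw [Finset.sum_comm]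
  simp only [h]
  rw [Finset.sum_comm]
  refine Finset.sum_congr rfl fun J _ => ?_
  simp [mul_assoc]

lemma integral_sum_dirD_sq (c : Finset (Fin n) → ℝ) (g : ℕ → ℝ) :
    ∫ y, ∑ I, g I.card * dirD c y I ^ 2 ∂(gaussn n) = ∑ J, J.card * g (J.card - 1) * c J ^ 2 := by
  rw [← sum_sq_pderivCoeff]
  have hi : ∀ I, Integrable (fun y => dirD c y I ^ 2) (gaussn n) := fun I =>
    ((tame_dirD c I).pow 2).integrable _
  rw [integral_finsetSum _ fun I _ => (hi I).const_mul _]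
  refine Finset.sum_congr rfl fun I _ => ?_
  rw [integral_const_mul]
  congr 1
  simp only [dirD_eq_mlEval]
  rw [gaussn, integral_mlEval_sq, sum_sq_linCoeff]

/-- The weight of a multilinear polynomial at level `k`. -/
def levelWeight (k : ℕ) (c : Finset (Fin n) → ℝ) : ℝ :=
  ∑ I, if I.card = k then c I ^ 2 else 0

/-- The weight above level `k`, with a geometric factor `A` per additional level. -/
def tailWeight (k : ℕ) (A : ℝ) (c : Finset (Fin n) → ℝ) : ℝ :=
  ∑ I, if k < I.card then A ^ (I.card - k) * c I ^ 2 else 0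

lemma levelWeight_nonneg (k : ℕ) (c : Finset (Fin n) → ℝ) : 0 ≤ levelWeight k c :=
  Finset.sum_nonneg fun I _ => by split_ifs <;> positivity

lemma tailWeight_nonneg (k : ℕ) {A : ℝ} (hA : 0 ≤ A) (c : Finset (Fin n) → ℝ) :
    0 ≤ tailWeight k A c :=
  Finset.sum_nonneg fun I _ => by split_ifs <;> positivity

lemma prob_levelWeight_dirD_ge (k : ℕ) (c : Finset (Fin n) → ℝ) :
    1 / 1024 ≤ (gaussn n).real
      {y | ((k : ℝ) + 1) * levelWeight (k + 1) c / 2 ≤ levelWeight k (dirD c y)} := by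
  have h := prob_sum_mlEval_sq_ge (fun _ : Fin n => gaussianReal 0 1)
    (univ.filter fun I : Finset (Fin n) => I.card = k)
    (fun I => linCoeff fun i => pderivCoeff i c I) (d := 1) fun I => degLE_linCoeff _
  refine le_trans (by norm_num) (h.trans (le_of_eq ?_))
  have h1 : ∑ I : Finset (Fin n) with I.card = k, ∑ J, linCoeff (fun i => pderivCoeff i c I) J ^ 2
      = ((k : ℝ) + 1) * levelWeight (k + 1) c := by
    have h2 := sum_sq_pderivCoeff c fun l => if l = k then 1 else 0
    simp only [sum_sq_linCoeff, Finset.sum_filter]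
    simp only [ite_mul, one_mul, zero_mul] at h2
    rw [h2]
    unfold levelWeight
    rw [Finset.mul_sum]
    refine Finset.sum_congr rfl fun J _ => ?_
    rcases Nat.eq_zero_or_pos J.card with h0 | h0
    · simp [h0]
    · by_cases h3 : J.card = k + 1
      · simp [h3]
      · have : ¬ J.card - 1 = k := by omega
        simp [h3, this]
  rw [h1]
  congr 1
  ext y
  simp only [Set.mem_ofPred_eq, levelWeight, ← dirD_eq_mlEval, Finset.sum_filter]

lemma integral_tailWeight_dirD_le (k : ℕ) {A : ℝ} (hA : 0 ≤ A) (c : Finset (Fin n) → ℝ) :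
    ∫ y, tailWeight k A (dirD c y) ∂(gaussn n) ≤ (k + 1) * tailWeight (k + 1) (2 * A) c := by
  have h := integral_sum_dirD_sq c fun l => if k < l then A ^ (l - k) else 0
  unfold tailWeight
  simp only [ite_mul, zero_mul] at h ⊢
  rw [h, Finset.mul_sum]
  refine Finset.sum_le_sum fun J _ => ?_
  by_cases h3 : k + 1 < J.card
  · have h4 : k < J.card - 1 := by omega
    obtain ⟨l, hl⟩ : ∃ l, J.card = k + 1 + l := ⟨J.card - (k + 1), by omega⟩
    rw [if_pos h4, if_pos h3, hl]
    have h5 : k + 1 + l - 1 - k = l := by omega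
    have h6 : k + 1 + l - (k + 1) = l := by omega
    rw [h5, h6, mul_pow]
    have h7 : ((k + 1 + l : ℕ) : ℝ) ≤ (k + 1) * 2 ^ l := by
      have : k + 1 + l ≤ (k + 1) * 2 ^ l := by
        have := Nat.lt_two_pow_self (n := l)
        nlinarith
      exact_mod_cast this
    have h8 : 0 ≤ A ^ l * c J ^ 2 := by positivity
    nlinarith
  · have h4 : ¬ k < J.card - 1 := by omega
    simp [h3, h4]

lemma measurable_levelWeight_dirD (k : ℕ) (c : Finset (Fin n) → ℝ) :
    Measurable fun y => levelWeight k (dirD c y) := by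
  unfold levelWeight
  refine Finset.measurable_sum _ fun I _ => ?_
  split_ifs <;> fun_prop

lemma tame_tailWeight_dirD (k : ℕ) (A : ℝ) (c : Finset (Fin n) → ℝ) :
    Tame fun y => tailWeight k A (dirD c y) := by
  unfold tailWeight
  refine Tame.sum _ fun I _ => ?_
  split_ifs
  · exact ((tame_dirD c I).pow 2).const_mul _
  · exact tame_const 0

end LevelWeights

section Anticoncentration

variable {n : ℕ}

lemma markov_real {Ω : Type*} [MeasurableSpace Ω] {P : Measure Ω} [IsProbabilityMeasure P]
    {Z : Ω → ℝ} (h0 : ∀ ω, 0 ≤ Z ω) (hi : Integrable Z P) (t : ℝ) :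
    t * P.real {ω | t ≤ Z ω} ≤ ∫ ω, Z ω ∂P :=
  mul_meas_ge_le_integral_of_nonneg (Filter.Eventually.of_forall h0) hi t

/-- Coefficients with the constant term removed. -/
def dropConst (c : Finset (Fin n) → ℝ) (I : Finset (Fin n)) : ℝ := if I = ∅ then 0 else c I

lemma mlEval_eq_const_add (c : Finset (Fin n) → ℝ) (x : Fin n → ℝ) :
    mlEval c x = c ∅ + mlEval (dropConst c) x := by
  unfold mlEval dropConst
  rw [← Finset.add_sum_erase univ _ (mem_univ ∅), ← Finset.add_sum_erase univ (fun I => _ * _) (mem_univ ∅)]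
  simp only [Finset.prod_empty, mul_one, if_true, zero_add]
  congr 1
  refine Finset.sum_congr rfl fun I hI => ?_
  rw [if_neg (Finset.ne_of_mem_erase hI)]

lemma tailWeight_zero (A : ℝ) (c : Finset (Fin n) → ℝ) :
    tailWeight 0 A c = ∑ I, A ^ I.card * dropConst c I ^ 2 := by
  unfold tailWeight dropConst
  refine Finset.sum_congr rfl fun I _ => ?_
  by_cases h : I = ∅
  · simp [h]
  · simp [h, Finset.card_pos, Finset.nonempty_iff_ne_empty]

lemma levelWeight_zero (c : Finset (Fin n) → ℝ) : levelWeight 0 c = c ∅ ^ 2 := by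
  simp [levelWeight]

lemma gaussn_small_of_const {c : Finset (Fin n) → ℝ} {m : ℕ} (hm : 1 ≤ m) {θ : ℝ}
    (hc : 0 < levelWeight 0 c) (h : tailWeight 0 (8 * m) c ≤ θ * levelWeight 0 c) :
    (gaussn n).real {x | |mlEval c x| ≤ √(levelWeight 0 c) / 2} ≤ (4 * θ) ^ m := by
  rw [levelWeight_zero] at *
  set w := c ∅ ^ 2 with hw
  have h1 := markov_real (P := gaussn n) (Z := fun x => mlEval (dropConst c) x ^ (2 * m))
    (fun x => by rw [pow_mul]; positivity) (((tame_mlEval _).pow _).integrable _) ((w / 4) ^ m)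
  have h2 := integral_mlEval_pow_le (fun _ : Fin n => gaussianReal 0 1) hm (dropConst c)
  rw [← tailWeight_zero] at h2
  have h3 : (gaussn n).real {x | |mlEval c x| ≤ √w / 2}
      ≤ (gaussn n).real {x | (w / 4) ^ m ≤ mlEval (dropConst c) x ^ (2 * m)} := by
    refine measureReal_mono fun x hx => ?_
    simp only [Set.mem_ofPred_eq] at hx ⊢
    rw [mlEval_eq_const_add, hw, Real.sqrt_sq_eq_abs] at hx
    rw [pow_mul]
    refine pow_le_pow_left₀ (by positivity) ?_ _
    have h4 : |c ∅| / 2 ≤ |mlEval (dropConst c) x| := by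
      have := abs_sub_abs_le_abs_sub (c ∅) (-mlEval (dropConst c) x)
      rw [abs_neg, sub_neg_eq_add] at this
      linarith
    have h5 := pow_le_pow_left₀ (by positivity) h4 2
    rw [div_pow, sq_abs, sq_abs] at h5
    linarith
  have hw4 : 0 < (w / 4) ^ m := by positivity
  refine h3.trans ?_
  have h6 : (w / 4) ^ m * (gaussn n).real {x | (w / 4) ^ m ≤ mlEval (dropConst c) x ^ (2 * m)}
      ≤ (w / 4) ^ m * (4 * θ) ^ m := by
    refine h1.trans (h2.trans ?_)
    rw [← mul_pow]
    refine pow_le_pow_left₀ (tailWeight_nonneg _ (by positivity) _) ?_ _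
    linarith
  exact le_of_mul_le_mul_left h6 hw4

lemma prob_good_direction {c : Finset (Fin n) → ℝ} {k : ℕ} {A η : ℝ} (hA : 0 ≤ A) (hη : 0 < η)
    (hc : 0 < levelWeight (k + 1) c)
    (h : tailWeight (k + 1) (2 * A) c ≤ η * levelWeight (k + 1) c) :
    1 / 2048 ≤ (gaussn n).real {y | levelWeight (k + 1) c / 2 ≤ levelWeight k (dirD c y) ∧
      tailWeight k A (dirD c y) ≤ 4096 * η * levelWeight k (dirD c y)} := by
  set w := levelWeight (k + 1) c with hw
  have h1 := prob_levelWeight_dirD_ge k c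
  rw [← hw] at h1
  have h2 := markov_real (P := gaussn n) (Z := fun y => tailWeight k A (dirD c y))
    (fun y => tailWeight_nonneg k hA _) ((tame_tailWeight_dirD k A c).integrable _)
    (2048 * ((k + 1) * (η * w)))
  have h3 := integral_tailWeight_dirD_le k hA c
  set e : ℝ := (k + 1) * (η * w) with he
  have he0 : 0 < e := by positivity
  have h4 : (gaussn n).real {y | 2048 * e ≤ tailWeight k A (dirD c y)} ≤ 1 / 2048 := by
    have : (k + 1 : ℝ) * tailWeight (k + 1) (2 * A) c ≤ e := by rw [he]; gcongr
    rw [le_div_iff₀ (by norm_num)]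
    nlinarith
  have h5 := measureReal_union_le (μ := gaussn n) {y | levelWeight (k + 1) c / 2 ≤ levelWeight k (dirD c y) ∧
      tailWeight k A (dirD c y) ≤ 4096 * η * levelWeight k (dirD c y)}
      {y | 2048 * e ≤ tailWeight k A (dirD c y)}
  have h6 : (gaussn n).real {y | ((k : ℝ) + 1) * w / 2 ≤ levelWeight k (dirD c y)} ≤
    (gaussn n).real ({y | levelWeight (k + 1) c / 2 ≤ levelWeight k (dirD c y) ∧
      tailWeight k A (dirD c y) ≤ 4096 * η * levelWeight k (dirD c y)} ∪
      {y | 2048 * e ≤ tailWeight k A (dirD c y)}) := by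
    refine measureReal_mono fun y hy => ?_
    simp only [Set.mem_union, Set.mem_ofPred_eq] at hy ⊢
    by_cases hb : 2048 * e ≤ tailWeight k A (dirD c y)
    · exact Or.inr hb
    · left
      push Not at hb
      have hk : (0 : ℝ) ≤ k := Nat.cast_nonneg k
      refine ⟨by nlinarith, hb.le.trans ?_⟩
      have : 2048 * e = 4096 * η * ((k + 1) * w / 2) := by rw [he]; ring
      rw [this]
      gcongr
  linarith

lemma gaussn_small_le_of_levelWeight {d m : ℕ} (hd : 1 ≤ d) (hm : 1 ≤ m) {θ ε : ℝ} (hθ : 0 < θ)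
    (hε : 0 < ε) (k : ℕ) : ∀ c : Finset (Fin n) → ℝ, DegLE c d → 0 < levelWeight k c →
    tailWeight k (8 * m * 2 ^ k) c ≤ θ / 4096 ^ k * levelWeight k c →
    (gaussn n).real {x | |mlEval c x| ≤ (ε / 2) ^ k * (√(levelWeight k c) / 2)}
      ≤ (4 * θ) ^ m + k * (69632 * d ^ 2 * ε) := by
  induction k with
  | zero =>
    intro c _ h1 h2
    simp only [pow_zero, div_one, mul_one, one_mul, Nat.cast_zero, zero_mul, add_zero] at h2 ⊢
    exact gaussn_small_of_const hm h1 h2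
  | succ k ih =>
    intro c hdeg h1 h2
    set w := levelWeight (k + 1) c with hw
    set K : ℝ := (4 * θ) ^ m + k * (69632 * d ^ 2 * ε) with hK
    have hgood := prob_good_direction (c := c) (k := k) (A := 8 * m * 2 ^ k)
      (η := θ / 4096 ^ (k + 1)) (by positivity) (by positivity) h1
      (by convert h2 using 2; ring)
    set G := {y | levelWeight (k + 1) c / 2 ≤ levelWeight k (dirD c y) ∧
      tailWeight k (8 * m * 2 ^ k) (dirD c y) ≤
        4096 * (θ / 4096 ^ (k + 1)) * levelWeight k (dirD c y)} with hG
    have mG : MeasurableSet G := by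
      refine MeasurableSet.inter (measurableSet_le measurable_const (measurable_levelWeight_dirD k c))
        (measurableSet_le (tame_tailWeight_dirD k _ c).1 ?_)
      exact (measurable_levelWeight_dirD k c).const_mul _
    set S := {x | |mlEval c x| ≤ (ε / 2) ^ (k + 1) * (√w / 2)} with hS
    set E := {p : (Fin n → ℝ) × (Fin n → ℝ) | |mlEval c p.1| < ε * |mlEval (dirD c p.2) p.1|} with hE
    have mE : MeasurableSet E := by
      refine measurableSet_lt ?_ ?_
      · exact ((measurable_mlEval c).comp measurable_fst).abs
      · exact (measurable_mlEval_dirD c).abs.const_mul ε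
    have hkane := gaussn_small_vs_deriv hd hdeg hε
    rw [← hE] at hkane
    have hfub : ((gaussn n).prod (gaussn n)).real E
        = ∫ y, (gaussn n).real {x | (x, y) ∈ E} ∂(gaussn n) := by
      rw [measureReal_def, Measure.prod_apply_symm mE, integral_eq_lintegral_of_nonneg_ae]
      · congr 1
        refine lintegral_congr fun y => ?_
        rw [measureReal_def, ENNReal.ofReal_toReal (measure_ne_top _ _)]
        rfl
      · exact Filter.Eventually.of_forall fun y => measureReal_nonneg
      · exact (measurable_measure_prodMk_right mE).ennreal_toReal.aestronglyMeasurable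
    have hpt : ∀ y, G.indicator (fun _ => (gaussn n).real S - K) y ≤ (gaussn n).real {x | (x, y) ∈ E} := by
      intro y
      by_cases hy : y ∈ G
      swap
      · rw [Set.indicator_of_notMem hy]; exact measureReal_nonneg
      rw [Set.indicator_of_mem hy]
      have hw0 : w / 2 ≤ levelWeight k (dirD c y) := hy.1
      have hih := ih (dirD c y) (fun I hI => (degLE_dirD hdeg y I hI).trans (Nat.sub_le _ _))
        (by linarith) (hy.2.trans (le_of_eq (by rw [pow_succ]; field_simp)))
      set S' := {x | |mlEval (dirD c y) x| ≤ (ε / 2) ^ k * (√(levelWeight k (dirD c y)) / 2)} with hS'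
      have hsub : S ⊆ {x | (x, y) ∈ E} ∪ S' := by
        intro x hx
        by_contra hcon
        simp only [Set.mem_union, not_or, hE, hS', Set.mem_ofPred_eq, not_lt, not_le] at hcon
        have hx' : |mlEval c x| ≤ (ε / 2) ^ (k + 1) * (√w / 2) := hx
        have h5 : √w / 2 ≤ √(levelWeight k (dirD c y)) := by
          refine Real.le_sqrt_of_sq_le ?_
          rw [div_pow, Real.sq_sqrt h1.le]; linarith
        have h6 : (ε / 2) ^ (k + 1) * (√w / 2) ≤
            ε * ((ε / 2) ^ k * (√(levelWeight k (dirD c y)) / 2)) := by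
          have : ε * ((ε / 2) ^ k * (√(levelWeight k (dirD c y)) / 2))
            = (ε / 2) ^ (k + 1) * √(levelWeight k (dirD c y)) := by rw [pow_succ]; ring
          rw [this]; gcongr
        have h7 := mul_lt_mul_of_pos_left hcon.2 hε
        linarith [hcon.1]
      have h8 := (measureReal_mono (μ := gaussn n) hsub).trans (measureReal_union_le _ _)
      linarith
    have hInt : ∫ y, G.indicator (fun _ => (gaussn n).real S - K) y ∂(gaussn n)
        ≤ ∫ y, (gaussn n).real {x | (x, y) ∈ E} ∂(gaussn n) := by
      refine integral_mono ((integrable_const _).indicator mG) ?_ hpt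
      refine Integrable.of_bound
        (measurable_measure_prodMk_right mE).ennreal_toReal.aestronglyMeasurable 1 ?_
      refine Filter.Eventually.of_forall fun y => ?_
      rw [Real.norm_of_nonneg measureReal_nonneg]
      exact measureReal_le_one
    rw [integral_indicator_const _ mG, smul_eq_mul, ← hfub] at hInt
    have h9 : (gaussn n).real G * ((gaussn n).real S - K) ≤ 34 * d ^ 2 * ε := hInt.trans hkane
    have h10 : (gaussn n).real S - K ≤ 69632 * d ^ 2 * ε := by
      rcases le_or_gt ((gaussn n).real S - K) 0 with h0 | h0
      · exact h0.trans (by positivity)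
      · nlinarith
    push_cast
    linarith

end Anticoncentration

section SmallBall

variable {n : ℕ}

lemma sum_dropConst_sq_eq {c : Finset (Fin n) → ℝ} {d : ℕ} (h : DegLE c d) :
    ∑ I, dropConst c I ^ 2 = ∑ j ∈ Icc 1 d, levelWeight j c := by
  unfold levelWeight
  rw [Finset.sum_comm]
  refine Finset.sum_congr rfl fun I _ => ?_
  rw [Finset.sum_ite_eq]
  by_cases hI : c I = 0
  · simp [dropConst, hI]
  · have := h I hI
    by_cases h0 : I = ∅
    · simp [dropConst, h0]
    · have h1 : 1 ≤ I.card := Finset.card_pos.2 (Finset.nonempty_iff_ne_empty.2 h0)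
      simp [dropConst, h0, this]

lemma tailWeight_eq {c : Finset (Fin n) → ℝ} {d : ℕ} (h : DegLE c d) (k : ℕ) (A : ℝ) :
    tailWeight k A c = ∑ j ∈ Ico (k + 1) (d + 1), A ^ (j - k) * levelWeight j c := by
  unfold levelWeight tailWeight
  simp only [Finset.mul_sum]
  rw [Finset.sum_comm]
  refine Finset.sum_congr rfl fun I _ => ?_
  simp only [mul_ite, mul_zero]
  rw [Finset.sum_ite_eq]
  by_cases hI : c I = 0
  · simp [hI]
  · have := h I hI
    by_cases h0 : k < I.card
    · rw [if_pos h0, if_pos (by rw [Finset.mem_Ico]; omega)]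
    · rw [if_neg h0, if_neg (by rw [Finset.mem_Ico]; omega)]

lemma exists_dominant_level {c : Finset (Fin n) → ℝ} {d : ℕ} (hd : 1 ≤ d) (h : DegLE c d)
    (hV : 0 < ∑ I, dropConst c I ^ 2) {A B r : ℝ} (hA : 0 ≤ A) (hB : 1 ≤ B) (hr : 0 < r)
    (hr2 : r ≤ 1 / 2) (hAB : A * 2 ^ d ≤ r * B) :
    ∃ k, k ≤ d ∧ 0 < levelWeight k c ∧ ∑ I, dropConst c I ^ 2 ≤ d * (B ^ d * levelWeight k c) ∧
      tailWeight k (A * 2 ^ k) c ≤ 2 * r * levelWeight k c := by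
  obtain ⟨k, hk, hmax⟩ := Finset.exists_max_image (Icc 1 d) (fun j => levelWeight j c * B ^ j)
    ⟨1, Finset.mem_Icc.2 ⟨le_rfl, hd⟩⟩
  rw [Finset.mem_Icc] at hk
  have hB0 : 0 < B := by linarith
  have hbound : ∑ I, dropConst c I ^ 2 ≤ d * (B ^ d * levelWeight k c) := by
    rw [sum_dropConst_sq_eq h]
    calc ∑ j ∈ Icc 1 d, levelWeight j c ≤ ∑ j ∈ Icc 1 d, B ^ d * levelWeight k c := by
          refine Finset.sum_le_sum fun j hj => ?_
          have h1 : levelWeight j c * 1 ≤ levelWeight j c * B ^ j :=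
            mul_le_mul_of_nonneg_left (one_le_pow₀ hB) (levelWeight_nonneg _ _)
          have h2 : levelWeight k c * B ^ k ≤ levelWeight k c * B ^ d :=
            mul_le_mul_of_nonneg_left (pow_le_pow_right₀ hB hk.2) (levelWeight_nonneg _ _)
          have := hmax j hj
          linarith
      _ = _ := by simp
  refine ⟨k, hk.2, ?_, hbound, ?_⟩
  · rcases (levelWeight_nonneg k c).eq_or_lt with h0 | h0
    · rw [← h0] at hbound; simp only [mul_zero] at hbound; linarith
    · exact h0
  · rw [tailWeight_eq h]
    have hA2 : A * 2 ^ k ≤ r * B :=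
      (mul_le_mul_of_nonneg_left (pow_le_pow_right₀ (by norm_num) hk.2) hA).trans hAB
    calc ∑ j ∈ Ico (k + 1) (d + 1), (A * 2 ^ k) ^ (j - k) * levelWeight j c
        ≤ ∑ j ∈ Ico (k + 1) (d + 1), (r * (1 / 2) ^ (j - (k + 1))) * levelWeight k c := by
          refine Finset.sum_le_sum fun j hj => ?_
          rw [Finset.mem_Ico] at hj
          obtain ⟨l, rfl⟩ : ∃ l, j = k + 1 + l := ⟨j - (k + 1), by omega⟩
          have e1 : k + 1 + l - k = l + 1 := by omega
          have e2 : k + 1 + l - (k + 1) = l := by omega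
          rw [e1, e2]
          have h1 := hmax (k + 1 + l) (Finset.mem_Icc.2 ⟨by omega, by omega⟩)
          have h2 : B ^ (l + 1) * levelWeight (k + 1 + l) c ≤ levelWeight k c := by
            have h3 : B ^ k * (B ^ (l + 1) * levelWeight (k + 1 + l) c) ≤ B ^ k * levelWeight k c := by
              have : B ^ (k + 1 + l) = B ^ k * B ^ (l + 1) := by ring
              rw [this] at h1; linarith
            exact le_of_mul_le_mul_left h3 (by positivity)
          calc (A * 2 ^ k) ^ (l + 1) * levelWeight (k + 1 + l) c
              ≤ (r * B) ^ (l + 1) * levelWeight (k + 1 + l) c :=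
                mul_le_mul_of_nonneg_right (pow_le_pow_left₀ (by positivity) hA2 _)
                  (levelWeight_nonneg _ _)
            _ = r ^ (l + 1) * (B ^ (l + 1) * levelWeight (k + 1 + l) c) := by rw [mul_pow]; ring
            _ ≤ r ^ (l + 1) * levelWeight k c := by gcongr
            _ ≤ _ := by
                refine mul_le_mul_of_nonneg_right ?_ (levelWeight_nonneg _ _)
                rw [pow_succ, mul_comm]
                gcongr
      _ = r * (∑ i ∈ range (d - k), (1 / 2 : ℝ) ^ i) * levelWeight k c := by
          rw [Finset.sum_Ico_eq_sum_range, ← Finset.sum_mul, ← Finset.mul_sum]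
          congr 2
          have : d + 1 - (k + 1) = d - k := by omega
          rw [this]
          simp
      _ ≤ r * 2 * levelWeight k c := by
          have := sum_geometric_two_le (d - k)
          have := levelWeight_nonneg k c
          gcongr
      _ = _ := by ring

/-- Anticoncentration of Gaussian polynomials around zero. -/
lemma gaussn_small_ball {c : Finset (Fin n) → ℝ} {d : ℕ} (hd : 1 ≤ d) (h : DegLE c d)
    (hV : 0 < ∑ I, dropConst c I ^ 2) {β : ℝ} (hβ : 0 < β) :
    (gaussn n).real {x | mlEval c x ^ 2 ≤ 4 * β ^ (2 * d + 1) * ∑ I, dropConst c I ^ 2}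
      ≤ (2 ^ 34) ^ d * β := by
  set V := ∑ I, dropConst c I ^ 2 with hVdef
  have hdr : (1 : ℝ) ≤ d := by exact_mod_cast hd
  have hd2 : (d : ℝ) ≤ 2 ^ d := by exact_mod_cast Nat.lt_two_pow_self.le
  set ε : ℝ := (2 ^ 14) ^ d * β with hε
  have hε0 : 0 < ε := by positivity
  have hεle : ε ≤ (2 ^ 34) ^ d * β := by rw [hε]; gcongr <;> norm_num
  rcases le_or_gt 1 ε with h1 | h1
  · exact measureReal_le_one.trans (h1.trans hεle)
  obtain ⟨κ, hκ0, hκ1, hκ⟩ : ∃ κ : ℝ, 0 < κ ∧ κ ≤ 1 ∧ κ ^ d = ε := by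
    refine ⟨ε ^ ((1 : ℝ) / d), by positivity, Real.rpow_le_one hε0.le h1.le (by positivity), ?_⟩
    rw [← Real.rpow_natCast, ← Real.rpow_mul hε0.le, one_div_mul_cancel (by positivity),
      Real.rpow_one]
  set B : ℝ := (2 ^ 20) ^ d / κ with hB
  have hB1 : 1 ≤ B := by
    rw [hB, le_div_iff₀ hκ0, one_mul]
    exact hκ1.trans (one_le_pow₀ (by norm_num))
  have h4096 : (1 : ℝ) ≤ 4096 ^ d := one_le_pow₀ (by norm_num)
  obtain ⟨k, hkd, hk0, hVk, htail⟩ := exists_dominant_level hd h hV (A := 8 * d) (B := B)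
    (r := κ / 4 / 4096 ^ d / 2) (by positivity) hB1 (by positivity)
    (by
      rw [div_div, div_le_iff₀ (by positivity)]
      nlinarith)
    (by
      have e : κ / 4 / 4096 ^ d / 2 * B = (2 ^ 20) ^ d / 4096 ^ d / 8 := by
        rw [hB]; field_simp; norm_num
      rw [e, ← div_pow]
      have h64 : (64 : ℝ) ≤ 64 ^ d := le_self_pow₀ (by norm_num) (by omega)
      have : ((2 : ℝ) ^ 20 / 4096) ^ d = 64 ^ d * 2 ^ d * 2 ^ d := by
        rw [← mul_pow, ← mul_pow]; norm_num
      rw [this]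
      have h3 : 8 * (d : ℝ) * 2 ^ d * 8 ≤ 64 ^ d * 2 ^ d * 2 ^ d := by
        calc 8 * (d : ℝ) * 2 ^ d * 8 = 64 * d * 2 ^ d := by ring
          _ ≤ _ := by gcongr
      linarith)
  have hmain := gaussn_small_le_of_levelWeight hd hd (θ := κ / 4) (ε := ε) (by positivity) hε0 k c h hk0
    (htail.trans (by
      refine mul_le_mul_of_nonneg_right ?_ hk0.le
      have : 2 * (κ / 4 / 4096 ^ d / 2) = κ / 4 / 4096 ^ d := by ring
      rw [this]
      gcongr
      norm_num))
  have h5 : 4 * (κ / 4) = κ := by ring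
  rw [h5, hκ] at hmain
  refine (measureReal_mono ?_).trans (hmain.trans ?_)
  · intro x hx
    simp only [Set.mem_ofPred_eq] at hx ⊢
    refine abs_le_of_sq_le_sq ?_ (by positivity)
    refine hx.trans ?_
    rw [mul_pow, div_pow _ (2 : ℝ) 2, Real.sq_sqrt hk0.le, ← pow_mul]
    have hBd : B ^ d = (2 ^ 20) ^ (d * d) / ε := by rw [hB, div_pow, hκ, pow_mul]
    have hVk' : V * ε ≤ 2 ^ d * (2 ^ 20) ^ (d * d) * levelWeight k c := by
      rw [hBd] at hVk
      have : d * ((2 ^ 20) ^ (d * d) / ε * levelWeight k c)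
        = d * (2 ^ 20) ^ (d * d) * levelWeight k c / ε := by ring
      rw [this, le_div_iff₀ hε0] at hVk
      refine hVk.trans ?_
      gcongr
    have h6 : (ε / 2) ^ (2 * d) ≤ (ε / 2) ^ (k * 2) :=
      pow_le_pow_of_le_one (by positivity) (by linarith) (by omega)
    have h7 : 4 * β ^ (2 * d + 1) * (4 * 2 ^ (2 * d) * (2 ^ d * (2 ^ 20) ^ (d * d)))
        ≤ ε ^ (2 * d + 1) := by
      rw [hε, mul_pow]
      have : (4 : ℝ) * (4 * 2 ^ (2 * d) * (2 ^ d * (2 ^ 20) ^ (d * d))) ≤ ((2 ^ 14) ^ d) ^ (2 * d + 1) := by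
        have e1 : (4 : ℝ) * (4 * 2 ^ (2 * d) * (2 ^ d * (2 ^ 20) ^ (d * d)))
          = 2 ^ (4 + 2 * d + d + 20 * (d * d)) := by
          rw [← pow_mul]; simp only [pow_add]; norm_num; ring
        rw [e1, ← pow_mul, ← pow_mul]
        refine pow_le_pow_right₀ (by norm_num) ?_
        nlinarith
      calc 4 * β ^ (2 * d + 1) * (4 * 2 ^ (2 * d) * (2 ^ d * (2 ^ 20) ^ (d * d)))
          = (4 * (4 * 2 ^ (2 * d) * (2 ^ d * (2 ^ 20) ^ (d * d)))) * β ^ (2 * d + 1) := by ring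
        _ ≤ _ := by gcongr
    set P : ℝ := 2 ^ d * (2 ^ 20) ^ (d * d) with hP
    have hP0 : 0 < P := by positivity
    have h8 : 4 * β ^ (2 * d + 1) * V * (4 * 2 ^ (2 * d) * P) ≤
        ((ε / 2) ^ (k * 2) * (levelWeight k c / 2 ^ 2)) * (4 * 2 ^ (2 * d) * P) := by
      calc 4 * β ^ (2 * d + 1) * V * (4 * 2 ^ (2 * d) * P)
          = (4 * β ^ (2 * d + 1) * (4 * 2 ^ (2 * d) * P)) * V := by ring
        _ ≤ ε ^ (2 * d + 1) * V := by gcongr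
        _ = (ε / 2) ^ (2 * d) * 2 ^ (2 * d) * (V * ε) := by rw [div_pow, pow_succ]; field_simp
        _ ≤ (ε / 2) ^ (k * 2) * 2 ^ (2 * d) * (P * levelWeight k c) := by gcongr
        _ = _ := by ring
    exact le_of_mul_le_mul_right h8 (by positivity)
  · have hk' : (k : ℝ) ≤ d := by exact_mod_cast hkd
    calc ε + k * (69632 * d ^ 2 * ε) ≤ ε + d * (69632 * d ^ 2 * ε) := by gcongr
      _ = (1 + 69632 * d ^ 3) * ε := by ring
      _ ≤ ((2 ^ 17) * (2 ^ d) ^ 3) * ε := by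
          have : (d : ℝ) ^ 3 ≤ (2 ^ d) ^ 3 := by gcongr
          have h1 : (1 : ℝ) ≤ (2 ^ d) ^ 3 := one_le_pow₀ (one_le_pow₀ (by norm_num))
          gcongr; linarith
      _ ≤ ((2 ^ 17) ^ d * (2 ^ d) ^ 3) * ε := by
          gcongr
          exact le_self_pow₀ (by norm_num) (by omega)
      _ = ((2 : ℝ) ^ 34) ^ d * β := by
          rw [hε, ← pow_mul, ← pow_mul, ← pow_mul, ← pow_mul, ← mul_assoc, ← pow_add, ← pow_add]
          congr 2; ring

end SmallBall

section Bump

lemma abs_le_pow_succ_of_hasDerivAt {g g' : ℝ → ℝ} {M : ℝ} (hM : 0 ≤ M) {k : ℕ}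
    (h : ∀ t, HasDerivAt g (g' t) t) (h0 : g 0 = 0) (hb : ∀ t, |g' t| ≤ M * |t| ^ k) (v : ℝ) :
    |g v| ≤ M * |v| ^ (k + 1) := by
  have hv : ∀ x ∈ Set.uIcc 0 v, ‖g' x‖ ≤ M * |v| ^ k := by
    intro x hx
    refine (hb x).trans ?_
    have : |x| ≤ |v| := by
      have := Set.abs_sub_left_of_mem_uIcc hx
      simpa using this
    gcongr
  have := (convex_uIcc (0 : ℝ) v).norm_image_sub_le_of_norm_hasDerivWithin_le (f := g) (f' := g')
    (fun x _ => (h x).hasDerivWithinAt) hv Set.left_mem_uIcc Set.right_mem_uIcc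
  rw [h0, sub_zero, sub_zero, Real.norm_eq_abs, Real.norm_eq_abs] at this
  rw [pow_succ, ← mul_assoc]
  exact this

lemma cubic_taylor_bound {f₀ f₁ f₂ f₃ f₄ : ℝ → ℝ} {M : ℝ} (hM : 0 ≤ M)
    (h₀ : ∀ t, HasDerivAt f₀ (f₁ t) t) (h₁ : ∀ t, HasDerivAt f₁ (f₂ t) t)
    (h₂ : ∀ t, HasDerivAt f₂ (f₃ t) t) (h₃ : ∀ t, HasDerivAt f₃ (f₄ t) t) (hb : ∀ t, |f₄ t| ≤ M)
    (u v : ℝ) : |f₀ (u + v) - (f₀ u + f₁ u * v + f₂ u / 2 * v ^ 2 + f₃ u / 6 * v ^ 3)| ≤ M * v ^ 4 := by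
  have s3 := abs_le_pow_succ_of_hasDerivAt (g := fun v => f₃ (u + v) - f₃ u)
    (g' := fun v => f₄ (u + v)) hM (k := 0)
    (fun t => ((h₃ (u + t)).comp_const_add u t).sub_const _) (by simp) (fun t => by simpa using hb _)
  have s2 := abs_le_pow_succ_of_hasDerivAt (g := fun v => f₂ (u + v) - (f₂ u + f₃ u * v))
    (g' := fun v => f₃ (u + v) - f₃ u) hM (k := 1)
    (fun t => ((h₂ (u + t)).comp_const_add u t).sub
      (by simpa using ((hasDerivAt_id t).const_mul (f₃ u)).const_add (f₂ u)))
    (by simp) s3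
  have s1 := abs_le_pow_succ_of_hasDerivAt
    (g := fun v => f₁ (u + v) - (f₁ u + f₂ u * v + f₃ u / 2 * v ^ 2))
    (g' := fun v => f₂ (u + v) - (f₂ u + f₃ u * v)) hM (k := 2)
    (fun t => ((h₁ (u + t)).comp_const_add u t).sub (by
      have := (((hasDerivAt_id t).const_mul (f₂ u)).const_add (f₁ u)).add
        ((hasDerivAt_pow 2 t).const_mul (f₃ u / 2))
      refine this.congr_deriv ?_
      norm_num; ring))
    (by simp) s2
  have s0 := abs_le_pow_succ_of_hasDerivAt
    (g := fun v => f₀ (u + v) - (f₀ u + f₁ u * v + f₂ u / 2 * v ^ 2 + f₃ u / 6 * v ^ 3))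
    (g' := fun v => f₁ (u + v) - (f₁ u + f₂ u * v + f₃ u / 2 * v ^ 2)) hM (k := 3)
    (fun t => ((h₀ (u + t)).comp_const_add u t).sub (by
      have := ((((hasDerivAt_id t).const_mul (f₁ u)).const_add (f₀ u)).add
        ((hasDerivAt_pow 2 t).const_mul (f₂ u / 2))).add ((hasDerivAt_pow 3 t).const_mul (f₃ u / 6))
      refine this.congr_deriv ?_
      norm_num; ring))
    (by simp) s1 v
  simpa [abs_pow, Even.pow_abs (by decide : Even 4)] using s0

lemma exists_smooth_cutoff : ∃ (ψ : ℝ → ℝ) (M : ℝ), 1 ≤ M ∧ Continuous ψ ∧ (∀ t, 0 ≤ ψ t) ∧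
    (∀ t, ψ t ≤ 1) ∧ (∀ t, |t| ≤ 1 → ψ t = 1) ∧ (∀ t, 2 ≤ |t| → ψ t = 0) ∧
    ∀ u, ∃ a b e : ℝ, ∀ v, |ψ (u + v) - (ψ u + a * v + b * v ^ 2 + e * v ^ 3)| ≤ M * v ^ 4 := by
  let φ : ContDiffBump (0 : ℝ) := ⟨1, 2, by norm_num, by norm_num⟩
  have hs : ContDiff ℝ 5 φ := φ.contDiff
  have hc : HasCompactSupport φ := φ.hasCompactSupport
  have hd : ∀ k : ℕ, k < 5 → ∀ t, HasDerivAt (iteratedDeriv k φ) (iteratedDeriv (k + 1) φ t) t := by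
    intro k hk t
    rw [iteratedDeriv_succ]
    exact ((hs.differentiable_iteratedDeriv k (by exact_mod_cast hk)) t).hasDerivAt
  have hc4 : HasCompactSupport (iteratedDeriv 4 φ) := by
    simp only [iteratedDeriv_eq_iterate, Function.iterate_succ, Function.comp, Function.iterate_zero, id]
    exact hc.deriv.deriv.deriv.deriv
  have hcont : Continuous (iteratedDeriv 4 φ) := hs.continuous_iteratedDeriv 4 (by norm_num)
  obtain ⟨M, hM⟩ := hc4.exists_bound_of_continuous hcont
  refine ⟨φ, max M 1, le_max_right _ _, φ.continuous, fun t => φ.nonneg, fun t => φ.le_one,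
    fun t ht => φ.one_of_mem_closedBall (by simpa using ht), fun t ht => φ.zero_of_le_dist (by simpa using ht),
    fun u => ⟨iteratedDeriv 1 φ u, iteratedDeriv 2 φ u / 2, iteratedDeriv 3 φ u / 6, fun v => ?_⟩⟩
  have := cubic_taylor_bound (f₀ := φ) (f₁ := iteratedDeriv 1 φ) (f₂ := iteratedDeriv 2 φ)
    (f₃ := iteratedDeriv 3 φ) (f₄ := iteratedDeriv 4 φ) (M := max M 1) (by positivity)
    (fun t => by simpa [iteratedDeriv_zero] using hd 0 (by norm_num) t) (hd 1 (by norm_num))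
    (hd 2 (by norm_num)) (hd 3 (by norm_num)) (fun t => (hM t).trans (le_max_left _ _)) u v
  exact this

end Bump

section Invariance

variable {n : ℕ}

lemma abs_integral_affine_sub_le {ψ : ℝ → ℝ} {M : ℝ} (hψ : Continuous ψ) (hM : 0 ≤ M)
    (hb : ∀ t, |ψ t| ≤ 1)
    (hT : ∀ u, ∃ a b e : ℝ, ∀ v, |ψ (u + v) - (ψ u + a * v + b * v ^ 2 + e * v ^ 3)| ≤ M * v ^ 4)
    (μ ν : Measure ℝ) [SymSubG μ] [SymSubG ν] (u D : ℝ) :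
    |∫ t, ψ (u + t * D) ∂μ - ∫ t, ψ (u + t * D) ∂ν| ≤ 512 * M * D ^ 4 := by
  obtain ⟨a, b, e, h⟩ := hT u
  have key : ∀ (ρ : Measure ℝ) [SymSubG ρ],
      |∫ t, ψ (u + t * D) ∂ρ - (ψ u + b * D ^ 2)| ≤ 256 * M * D ^ 4 := by
    intro ρ _
    have i0 : Integrable (fun t => ψ (u + t * D)) ρ := by
      refine Integrable.of_bound (by fun_prop) 1 ?_
      exact Filter.Eventually.of_forall fun t => hb _
    have i1 := (SymSubG.integrable_pow (μ := ρ) 1)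
    have i2 := (SymSubG.integrable_pow (μ := ρ) 2)
    have i3 := (SymSubG.integrable_pow (μ := ρ) 3)
    have i4 := (SymSubG.integrable_pow (μ := ρ) 4)
    simp only [pow_one] at i1
    have j1 : Integrable (fun t : ℝ => ψ u + a * D * t) ρ := (integrable_const _).add (i1.const_mul _)
    have j2 : Integrable (fun t : ℝ => ψ u + a * D * t + b * D ^ 2 * t ^ 2) ρ := j1.add (i2.const_mul _)
    have j3 : Integrable (fun t : ℝ => ψ u + a * D * t + b * D ^ 2 * t ^ 2 + e * D ^ 3 * t ^ 3) ρ :=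
      j2.add (i3.const_mul _)
    have hm : ∫ t, (ψ u + a * D * t + b * D ^ 2 * t ^ 2 + e * D ^ 3 * t ^ 3) ∂ρ = ψ u + b * D ^ 2 := by
      rw [integral_add j2 (i3.const_mul _), integral_add j1 (i2.const_mul _),
        integral_add (integrable_const _) (i1.const_mul _), integral_const_mul, integral_const_mul,
        integral_const_mul, SymSubG.integral_id, SymSubG.integral_cube, SymSubG.sq]
      simp
    rw [← hm, ← integral_sub i0 j3]
    have hle := norm_integral_le_of_norm_le (μ := ρ) (i4.const_mul (M * D ^ 4))
      (f := fun t => ψ (u + t * D) - (ψ u + a * D * t + b * D ^ 2 * t ^ 2 + e * D ^ 3 * t ^ 3))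
      (Filter.Eventually.of_forall fun t => by
        have := h (t * D)
        rw [Real.norm_eq_abs]
        convert this using 1
        · congr 1; ring
        · ring)
    rw [integral_const_mul] at hle
    have h4 := SymSubG.integral_affine_pow_le (μ := ρ) 0 1 2 (by norm_num)
    norm_num at h4
    rw [Real.norm_eq_abs] at hle
    have hD : 0 ≤ M * D ^ 4 := by positivity
    nlinarith
  have h1 := key μ
  have h2 := key ν
  rw [abs_le] at *
  constructor <;> linarith [h1.1, h1.2, h2.1, h2.2]

lemma sum_sq_pderivCoeff_eq_wsq (c : Finset (Fin n) → ℝ) (i : Fin n) :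
    ∑ I, pderivCoeff i c I ^ 2 = wsq c i := by
  unfold wsq
  rw [Finset.sum_filter, sum_finset_split i (fun I => if i ∈ I then c I ^ 2 else 0)]
  refine Finset.sum_congr rfl fun I _ => ?_
  by_cases hi : i ∈ I <;> simp [pderivCoeff, hi]

lemma abs_integral_update_sub_le {ψ : ℝ → ℝ} {M : ℝ} (hψ : Continuous ψ) (hM : 0 ≤ M)
    (hb : ∀ t, |ψ t| ≤ 1)
    (hT : ∀ u, ∃ a b e : ℝ, ∀ v, |ψ (u + v) - (ψ u + a * v + b * v ^ 2 + e * v ^ 3)| ≤ M * v ^ 4)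
    (μ : Fin n → Measure ℝ) [∀ i, SymSubG (μ i)] (ν : Measure ℝ) [SymSubG ν] (i : Fin n)
    {c : Finset (Fin n) → ℝ} {d : ℕ} (h : DegLE c d) :
    |∫ x, ψ (mlEval c x) ∂(Measure.pi (Function.update μ i ν)) - ∫ x, ψ (mlEval c x) ∂(Measure.pi μ)|
      ≤ 512 * M * 256 ^ d * wsq c i ^ 2 := by
  have hp : ∀ j, IsProbabilityMeasure (Function.update μ i ν j) := by
    intro j
    by_cases hj : j = i
    · subst hj; simp only [Function.update_self]; infer_instance
    · simp only [Function.update_of_ne hj]; infer_instance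
  have hm : Measurable fun x => ψ (mlEval c x) := hψ.measurable.comp (measurable_mlEval c)
  have hi1 : Integrable (fun x => ψ (mlEval c x)) (Measure.pi (Function.update μ i ν)) :=
    Integrable.of_bound hm.aestronglyMeasurable 1 (Filter.Eventually.of_forall fun t => hb _)
  have hi2 : Integrable (fun x => ψ (mlEval c x)) (Measure.pi μ) :=
    Integrable.of_bound hm.aestronglyMeasurable 1 (Filter.Eventually.of_forall fun t => hb _)
  have e1 := integral_pi_update μ i ν hi1
  have e2 := integral_pi_resample μ i hi2
  rw [e1.2, e2.2, ← integral_sub e1.1.integral_prod_left e2.1]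
  have hle := norm_integral_le_of_norm_le (μ := Measure.pi μ)
    ((((tame_mlEval (pderivCoeff i c)).pow 4).integrable μ).const_mul (512 * M))
    (f := fun x => ∫ t, ψ (mlEval c (Function.update x i t)) ∂ν
      - ∫ t, ψ (mlEval c (Function.update x i t)) ∂(μ i))
    (Filter.Eventually.of_forall fun x => by
      simp only [mlEval_update]
      exact abs_integral_affine_sub_le hψ hM hb hT ν (μ i) _ _)
  refine hle.trans ?_
  rw [integral_const_mul, ← sum_sq_pderivCoeff_eq_wsq, mul_assoc (512 * M)]
  refine mul_le_mul_of_nonneg_left ?_ (by positivity)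
  exact integral_mlEval_four_le μ fun I hI => (degLE_pderivCoeff h i I hI).trans (Nat.sub_le _ _)

/-- Lindeberg replacement: a smooth function of a low degree multilinear polynomial has nearly the
same mean under Rademacher and Gaussian inputs. -/
lemma abs_integral_rad_sub_gaussn_le {ψ : ℝ → ℝ} {M : ℝ} (hψ : Continuous ψ) (hM : 0 ≤ M)
    (hb : ∀ t, |ψ t| ≤ 1)
    (hT : ∀ u, ∃ a b e : ℝ, ∀ v, |ψ (u + v) - (ψ u + a * v + b * v ^ 2 + e * v ^ 3)| ≤ M * v ^ 4)
    {c : Finset (Fin n) → ℝ} {d : ℕ} (h : DegLE c d) :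
    |∫ x, ψ (mlEval c x) ∂(Measure.pi fun _ => rad) - ∫ x, ψ (mlEval c x) ∂(gaussn n)|
      ≤ 512 * M * 256 ^ d * ∑ i, wsq c i ^ 2 := by
  let hyb : Finset (Fin n) → Fin n → Measure ℝ := fun S i => if i ∈ S then rad else gaussianReal 0 1
  have hyb_inst : ∀ S i, SymSubG (hyb S i) := by
    intro S i
    by_cases hi : i ∈ S
    · simp only [hyb, hi, if_true]; infer_instance
    · simp only [hyb, hi, if_false]; infer_instance
  have key : ∀ S : Finset (Fin n),
      |∫ x, ψ (mlEval c x) ∂(Measure.pi (hyb S)) - ∫ x, ψ (mlEval c x) ∂(gaussn n)|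
        ≤ 512 * M * 256 ^ d * ∑ i ∈ S, wsq c i ^ 2 := by
    intro S
    induction S using Finset.induction_on with
    | empty => simp [hyb, gaussn]
    | insert i S hi ih =>
      have hup : hyb (insert i S) = Function.update (hyb S) i rad := by
        funext j
        by_cases hj : j = i
        · subst hj; simp [hyb]
        · simp [hyb, hj]
      have h1 := abs_integral_update_sub_le hψ hM hb hT (hyb S) rad i h
      rw [hup, Finset.sum_insert hi, mul_add]
      exact (abs_sub_le _ _ _).trans (add_le_add h1 ih)
  have := key univ
  simpa [hyb] using this

end Invariance

section Noise

variable {n : ℕ}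

lemma mlEval_const_mul (a : ℝ) (c : Finset (Fin n) → ℝ) (x : Fin n → ℝ) :
    mlEval (fun I => a * c I) x = a * mlEval c x := by
  unfold mlEval
  rw [Finset.mul_sum]
  exact Finset.sum_congr rfl fun I _ => mul_assoc _ _ _

lemma degLE_const_mul (a : ℝ) {c : Finset (Fin n) → ℝ} {d : ℕ} (h : DegLE c d) :
    DegLE (fun I => a * c I) d := fun I hI => h I (right_ne_zero_of_mul hI)

lemma cubeAvg_mlEval_sq (c : Finset (Fin n) → ℝ) :
    cubeAvg (fun x => mlEval c (pmVec x) ^ 2) = ∑ I, c I ^ 2 := by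
  rw [← integral_mlEval_sq (fun _ : Fin n => rad) c]
  exact (integral_pi_rad (fun x => mlEval c x ^ 2) (by fun_prop)).symm

/-- The variance of a multilinear polynomial. -/
def varCoeff (c : Finset (Fin n) → ℝ) : ℝ := ∑ I, dropConst c I ^ 2

lemma varCoeff_nonneg (c : Finset (Fin n) → ℝ) : 0 ≤ varCoeff c :=
  Finset.sum_nonneg fun _ _ => sq_nonneg _

lemma exists_cube_small_ball : ∃ M : ℝ, 1 ≤ M ∧ ∀ (n d : ℕ) (c : Finset (Fin n) → ℝ), 1 ≤ d →
    DegLE c d → 0 < varCoeff c → ∀ β : ℝ, 0 < β →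
      cubeProb (fun x => mlEval c (pmVec x) ^ 2 ≤ β ^ (2 * d + 1) * varCoeff c) ≤
        (2 ^ 34) ^ d * β + M * 256 ^ d * (∑ i, wsq c i ^ 2) / (β ^ (4 * d + 2) * varCoeff c ^ 2) := by
  obtain ⟨ψ, M, hM, hψ, h0, h1, hin, hout, hT⟩ := exists_smooth_cutoff
  refine ⟨512 * M, by linarith, fun n d c hd hdeg hV β hβ => ?_⟩
  set V := varCoeff c with hVdef
  set L : ℝ := β ^ (2 * d + 1) * V with hL
  have hL0 : 0 < L := by positivity
  set l : ℝ := √L with hl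
  have hl0 : 0 < l := Real.sqrt_pos.2 hL0
  have hl2 : l ^ 2 = L := Real.sq_sqrt hL0.le
  set c' : Finset (Fin n) → ℝ := fun I => l⁻¹ * c I with hc'
  have hinv := abs_integral_rad_sub_gaussn_le hψ (by linarith : 0 ≤ M)
    (fun t => by rw [abs_of_nonneg (h0 t)]; exact h1 t) hT (degLE_const_mul l⁻¹ hdeg)
  have hm : Measurable fun x => ψ (mlEval c' x) := hψ.measurable.comp (measurable_mlEval c')
  have hcube : cubeProb (fun x => mlEval c (pmVec x) ^ 2 ≤ L)
      ≤ ∫ x, ψ (mlEval c' x) ∂(Measure.pi fun _ => rad) := by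
    rw [integral_pi_rad _ hm]
    refine cubeAvg_mono fun x => ?_
    split_ifs with hx
    · refine (hin _ ?_).ge
      rw [hc', mlEval_const_mul, abs_mul, abs_of_pos (inv_pos.2 hl0), inv_mul_le_iff₀ hl0, mul_one]
      exact abs_le_of_sq_le_sq (by rwa [hl2]) hl0.le
    · exact h0 _
  have hgauss : ∫ x, ψ (mlEval c' x) ∂(gaussn n) ≤ (2 ^ 34) ^ d * β := by
    refine le_trans ?_ (gaussn_small_ball hd hdeg hV hβ)
    have hS : MeasurableSet {x | mlEval c x ^ 2 ≤ 4 * β ^ (2 * d + 1) * V} :=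
      measurableSet_le (by fun_prop) measurable_const
    change _ ≤ (gaussn n).real {x | mlEval c x ^ 2 ≤ 4 * β ^ (2 * d + 1) * V}
    rw [← integral_indicator_one hS]
    refine integral_mono (Integrable.of_bound hm.aestronglyMeasurable 1
      (Filter.Eventually.of_forall fun t => by rw [Real.norm_of_nonneg (h0 _)]; exact h1 _))
      ((integrable_const (1 : ℝ)).indicator hS) fun x => ?_
    by_cases hx : x ∈ {x | mlEval c x ^ 2 ≤ 4 * β ^ (2 * d + 1) * V}
    · rw [Set.indicator_of_mem hx]; exact h1 _
    · rw [Set.indicator_of_notMem hx]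
      refine (hout _ ?_).le
      rw [hc', mlEval_const_mul, abs_mul, abs_of_pos (inv_pos.2 hl0), le_inv_mul_iff₀ hl0]
      refine abs_le_of_sq_le_sq' (a := l * 2) ?_ (abs_nonneg _) |>.2
      simp only [Set.mem_ofPred_eq, not_le] at hx
      rw [sq_abs, mul_pow, hl2, hL]
      linarith
  have hw : ∀ i, wsq (fun I => l⁻¹ * c I) i = wsq c i / L := by
    intro i
    unfold wsq
    rw [Finset.sum_div]
    refine Finset.sum_congr rfl fun I _ => ?_
    rw [mul_pow, inv_pow, hl2]; ring
  simp only [hw, div_pow] at hinv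
  rw [← Finset.sum_div] at hinv
  have hL2 : L ^ 2 = β ^ (4 * d + 2) * V ^ 2 := by rw [hL]; ring
  rw [hL2] at hinv
  have := (abs_le.1 hinv).2
  have e : 512 * M * 256 ^ d * (∑ i, wsq c i ^ 2) / (β ^ (4 * d + 2) * V ^ 2)
    = 512 * M * 256 ^ d * ((∑ i, wsq c i ^ 2) / (β ^ (4 * d + 2) * V ^ 2)) := by ring
  rw [e]
  simp only [hc'] at hcube hgauss
  linarith

/-- Probability of the flip pattern `s` under independent flips with probability `δ`. -/
def flipWeight (δ : ℝ) (s : Fin n → Bool) : ℝ := ∏ i, if s i then δ else 1 - δ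

/-- Flip the coordinates of `x` selected by `s`. -/
def flipBy (s x : Fin n → Bool) (i : Fin n) : Bool := xor (s i) (x i)

/-- Average over a uniform point and an independent flip pattern. -/
def noiseAvg (δ : ℝ) (G : (Fin n → Bool) → (Fin n → Bool) → ℝ) : ℝ :=
  cubeAvg fun x => ∑ s, flipWeight δ s * G x s

lemma noiseSens_eq (δ : ℝ) (f : (Fin n → Bool) → Bool) :
    noiseSens δ f = noiseAvg δ fun x s => if f x ≠ f (flipBy s x) then 1 else 0 := rfl

lemma flipWeight_nonneg {δ : ℝ} (h0 : 0 ≤ δ) (h1 : δ ≤ 1) (s : Fin n → Bool) :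
    0 ≤ flipWeight δ s :=
  Finset.prod_nonneg fun i _ => by split_ifs <;> linarith

lemma sum_flipWeight_mul_prod (δ : ℝ) (g : Fin n → Bool → ℝ) :
    ∑ s, flipWeight δ s * ∏ i, g i (s i) = ∏ i, (δ * g i true + (1 - δ) * g i false) := by
  unfold flipWeight
  simp only [← Finset.prod_mul_distrib]
  rw [← Fintype.prod_sum (fun i b => (if b then δ else 1 - δ) * g i b)]
  simp

lemma sum_flipWeight (δ : ℝ) : ∑ s : Fin n → Bool, flipWeight δ s = 1 := by
  simpa using sum_flipWeight_mul_prod (n := n) δ fun _ _ => 1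

lemma sum_flipWeight_flip (δ : ℝ) (i : Fin n) :
    ∑ s : Fin n → Bool, flipWeight δ s * (if s i then 1 else 0) = δ := by
  have h := sum_flipWeight_mul_prod (n := n) δ fun j b => if j = i then (if b then 1 else 0) else 1
  have e : ∀ s : Fin n → Bool, ∏ j, (if j = i then (if s j then (1 : ℝ) else 0) else 1)
      = if s i then 1 else 0 := by
    intro s; rw [Finset.prod_ite_eq' univ i (fun j => if s j then (1 : ℝ) else 0)]; simp
  simp only [e] at h
  rw [h, Finset.prod_eq_single i]
  · simp
  · intro j _ hj; simp [hj]
  · simp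

lemma noiseAvg_mono {δ : ℝ} (h0 : 0 ≤ δ) (h1 : δ ≤ 1) {F G : (Fin n → Bool) → (Fin n → Bool) → ℝ}
    (h : ∀ x s, F x s ≤ G x s) : noiseAvg δ F ≤ noiseAvg δ G :=
  cubeAvg_mono fun x => Finset.sum_le_sum fun s _ =>
    mul_le_mul_of_nonneg_left (h x s) (flipWeight_nonneg h0 h1 s)

lemma noiseAvg_add (δ : ℝ) (F G : (Fin n → Bool) → (Fin n → Bool) → ℝ) :
    noiseAvg δ (fun x s => F x s + G x s) = noiseAvg δ F + noiseAvg δ G := by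
  unfold noiseAvg
  rw [← cubeAvg_add]
  congr 1; funext x
  rw [← Finset.sum_add_distrib]
  exact Finset.sum_congr rfl fun s _ => mul_add _ _ _

lemma noiseAvg_const_mul (δ a : ℝ) (F : (Fin n → Bool) → (Fin n → Bool) → ℝ) :
    noiseAvg δ (fun x s => a * F x s) = a * noiseAvg δ F := by
  unfold noiseAvg
  rw [← cubeAvg_const_mul]
  congr 1; funext x
  rw [Finset.mul_sum]
  exact Finset.sum_congr rfl fun s _ => by ring

lemma noiseAvg_left (δ : ℝ) (F : (Fin n → Bool) → ℝ) : noiseAvg δ (fun x _ => F x) = cubeAvg F := by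
  unfold noiseAvg
  congr 1; funext x
  rw [← Finset.sum_mul, sum_flipWeight, one_mul]

lemma noiseAvg_eq_sum (δ : ℝ) (G : (Fin n → Bool) → (Fin n → Bool) → ℝ) :
    noiseAvg δ G = ∑ s, flipWeight δ s * cubeAvg fun x => G x s := by
  unfold noiseAvg
  rw [cubeAvg_sum]
  exact Finset.sum_congr rfl fun s _ => cubeAvg_const_mul _ _

lemma noiseAvg_right (δ : ℝ) (F : (Fin n → Bool) → ℝ) : noiseAvg δ (fun _ s => F s)
    = ∑ s, flipWeight δ s * F s := by
  rw [noiseAvg_eq_sum]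
  simp only [cubeAvg_const]

lemma flipBy_involutive (s : Fin n → Bool) : Function.Involutive (flipBy s) := by
  intro x; funext i; simp [flipBy]

lemma cubeAvg_flipBy (s : Fin n → Bool) (F : (Fin n → Bool) → ℝ) :
    cubeAvg (fun x => F (flipBy s x)) = cubeAvg F := by
  unfold cubeAvg
  congr 1
  exact Equiv.sum_comp (flipBy_involutive s).toPerm F

lemma noiseAvg_flipBy (δ : ℝ) (F : (Fin n → Bool) → ℝ) :
    noiseAvg δ (fun x s => F (flipBy s x)) = cubeAvg F := by
  rw [noiseAvg_eq_sum]
  simp only [cubeAvg_flipBy]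
  rw [← Finset.sum_mul, sum_flipWeight, one_mul]

lemma noiseSens_le_one {δ : ℝ} (h0 : 0 ≤ δ) (h1 : δ ≤ 1) (f : (Fin n → Bool) → Bool) :
    noiseSens δ f ≤ 1 := by
  calc noiseSens δ f = noiseAvg δ fun x s => if f x ≠ f (flipBy s x) then 1 else 0 :=
        noiseSens_eq δ f
    _ ≤ noiseAvg δ fun _ _ => 1 := noiseAvg_mono h0 h1 fun x s => by split_ifs <;> norm_num
    _ = 1 := by rw [noiseAvg_left δ fun _ => 1, cubeAvg_const]

/-- The sign of a multilinear polynomial on the cube. -/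
def signFun (c : Finset (Fin n) → ℝ) (x : Fin n → Bool) : Bool := decide (0 ≤ mlEval c (pmVec x))

lemma signFun_ne_iff {a b : Finset (Fin n) → ℝ} {x z : Fin n → Bool} : signFun a x ≠ signFun b z ↔
    (0 ≤ mlEval a (pmVec x) ∧ mlEval b (pmVec z) < 0) ∨
    (mlEval a (pmVec x) < 0 ∧ 0 ≤ mlEval b (pmVec z)) := by
  unfold signFun
  by_cases h1 : 0 ≤ mlEval a (pmVec x) <;> by_cases h2 : 0 ≤ mlEval b (pmVec z) <;>
    simp [h1, h2] <;> simp at * <;> grind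

lemma mlEval_flipBy (c : Finset (Fin n) → ℝ) (s x : Fin n → Bool) :
    mlEval c (pmVec (flipBy s x)) = mlEval (fun I => c I * ∏ i ∈ I, pmOne (!s i)) (pmVec x) := by
  unfold mlEval
  refine Finset.sum_congr rfl fun I _ => ?_
  rw [mul_assoc, ← Finset.prod_mul_distrib]
  congr 1
  refine Finset.prod_congr rfl fun i _ => ?_
  have h : ∀ a b : Bool, pmOne (xor a b) = pmOne (!a) * pmOne b := by
    intro a b; cases a <;> cases b <;> simp [pmOne]
  exact h _ _

lemma one_sub_prod_flip_sq_le (s : Fin n → Bool) (I : Finset (Fin n)) :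
    (1 - ∏ i ∈ I, pmOne (!s i)) ^ 2 ≤ 4 * ∑ i ∈ I, if s i then (1 : ℝ) else 0 := by
  by_cases h : ∃ i ∈ I, s i = true
  · obtain ⟨i, hi, hs⟩ := h
    have h1 : (1 : ℝ) ≤ ∑ i ∈ I, if s i then (1 : ℝ) else 0 := by
      have := Finset.single_le_sum (f := fun i => if s i then (1 : ℝ) else 0)
        (fun j _ => by split_ifs <;> norm_num) hi
      simpa [hs] using this
    have h2 : |∏ i ∈ I, pmOne (!s i)| ≤ 1 := by
      rw [Finset.abs_prod]
      refine Finset.prod_le_one (fun _ _ => abs_nonneg _) fun j _ => ?_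
      unfold pmOne; split_ifs <;> simp
    have h3 := abs_le.1 h2
    nlinarith
  · push Not at h
    have h1 : ∏ i ∈ I, pmOne (!s i) = 1 := by
      refine Finset.prod_eq_one fun i hi => ?_
      have := h i hi
      simp [pmOne, this]
    have h2 : (0 : ℝ) ≤ ∑ i ∈ I, if s i then (1 : ℝ) else 0 :=
      Finset.sum_nonneg fun j _ => by split_ifs <;> norm_num
    rw [h1]; linarith

lemma noiseAvg_sub_sq_le {δ : ℝ} (h0 : 0 ≤ δ) (h1 : δ ≤ 1) {c : Finset (Fin n) → ℝ} {d : ℕ}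
    (h : DegLE c d) :
    noiseAvg δ (fun x s => (mlEval c (pmVec x) - mlEval c (pmVec (flipBy s x))) ^ 2)
      ≤ 4 * d * δ * varCoeff c := by
  have e : ∀ x s, mlEval c (pmVec x) - mlEval c (pmVec (flipBy s x))
      = mlEval (fun I => c I * (1 - ∏ i ∈ I, pmOne (!s i))) (pmVec x) := by
    intro x s
    rw [mlEval_flipBy]
    unfold mlEval
    rw [← Finset.sum_sub_distrib]
    exact Finset.sum_congr rfl fun I _ => by ring
  simp only [e]
  rw [noiseAvg_eq_sum]
  simp only [cubeAvg_mlEval_sq]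
  calc ∑ s, flipWeight δ s * ∑ I, (c I * (1 - ∏ i ∈ I, pmOne (!s i))) ^ 2
      ≤ ∑ s : Fin n → Bool, flipWeight δ s * ∑ I, c I ^ 2 * (4 * ∑ i ∈ I, if s i then (1 : ℝ) else 0) := by
        refine Finset.sum_le_sum fun s _ => mul_le_mul_of_nonneg_left
          (Finset.sum_le_sum fun I _ => ?_) (flipWeight_nonneg h0 h1 s)
        rw [mul_pow]
        exact mul_le_mul_of_nonneg_left (one_sub_prod_flip_sq_le s I) (sq_nonneg _)
    _ = ∑ I, 4 * c I ^ 2 * ∑ i ∈ I, ∑ s : Fin n → Bool, flipWeight δ s * (if s i then 1 else 0) := by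
        simp only [Finset.mul_sum]
        rw [Finset.sum_comm]
        refine Finset.sum_congr rfl fun I _ => ?_
        rw [Finset.sum_comm]
        exact Finset.sum_congr rfl fun i _ => Finset.sum_congr rfl fun s _ => by ring
    _ = ∑ I, 4 * c I ^ 2 * (I.card * δ) := by
        simp only [sum_flipWeight_flip, Finset.sum_const, nsmul_eq_mul]
    _ ≤ ∑ I, 4 * d * δ * dropConst c I ^ 2 := by
        refine Finset.sum_le_sum fun I _ => ?_
        by_cases hI : I = ∅
        · simp [hI, dropConst]
        by_cases hc : c I = 0
        · simp [hc, dropConst]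
        have hd : (I.card : ℝ) ≤ d := by exact_mod_cast h I hc
        simp only [dropConst, hI, if_false]
        have : 0 ≤ c I ^ 2 * δ := by positivity
        nlinarith
    _ = _ := by rw [← Finset.mul_sum, varCoeff]

lemma noiseSens_signFun_le {δ : ℝ} (h0 : 0 ≤ δ) (h1 : δ ≤ 1) {c : Finset (Fin n) → ℝ} {d : ℕ}
    (h : DegLE c d) {L : ℝ} (hL : 0 < L) :
    noiseSens δ (signFun c) ≤ cubeProb (fun x => mlEval c (pmVec x) ^ 2 ≤ L)
      + L⁻¹ * (4 * d * δ * varCoeff c) := by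
  have h2 := noiseAvg_sub_sq_le h0 h1 h
  rw [cubeProb, ← noiseAvg_left δ]
  refine le_trans ?_ (add_le_add le_rfl (mul_le_mul_of_nonneg_left h2 (by positivity)))
  rw [← noiseAvg_const_mul, ← noiseAvg_add, noiseSens_eq]
  refine noiseAvg_mono h0 h1 fun x s => ?_
  set q := mlEval c (pmVec x) with hq
  set q' := mlEval c (pmVec (flipBy s x)) with hq'
  have hnn : 0 ≤ L⁻¹ * (q - q') ^ 2 := by positivity
  by_cases hne : signFun c x ≠ signFun c (flipBy s x)
  · rw [if_pos hne]
    by_cases hs : q ^ 2 ≤ L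
    · rw [if_pos hs]; linarith
    · rw [if_neg hs, zero_add, ← div_eq_inv_mul, le_div_iff₀ hL, one_mul]
      rw [signFun_ne_iff, ← hq, ← hq'] at hne
      push Not at hs
      rcases hne with ⟨h3, h4⟩ | ⟨h3, h4⟩ <;> nlinarith
  · rw [if_neg hne]
    split_ifs <;> linarith

lemma noiseSens_signFun_le_of_biased {δ : ℝ} (h0 : 0 ≤ δ) (h1 : δ ≤ 1) {c : Finset (Fin n) → ℝ}
    (hc : c ∅ ≠ 0) : noiseSens δ (signFun c) ≤ 2 * varCoeff c / c ∅ ^ 2 := by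
  have hc2 : 0 < c ∅ ^ 2 := by positivity
  have hmark : c ∅ ^ 2 * cubeProb (fun x => c ∅ ^ 2 ≤ mlEval (dropConst c) (pmVec x) ^ 2)
      ≤ varCoeff c := by
    refine (cubeProb_markov fun x => sq_nonneg _).trans (le_of_eq (cubeAvg_mlEval_sq _))
  set p := cubeProb (fun x => c ∅ ^ 2 ≤ mlEval (dropConst c) (pmVec x) ^ 2) with hp
  have h2 : noiseSens δ (signFun c) ≤ p + p := by
    conv_rhs => rw [hp, cubeProb]
    nth_rewrite 1 [← noiseAvg_left δ]
    rw [← noiseAvg_flipBy δ, ← noiseAvg_add, noiseSens_eq]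
    refine noiseAvg_mono h0 h1 fun x s => ?_
    by_cases hne : signFun c x ≠ signFun c (flipBy s x)
    · rw [if_pos hne]
      rw [signFun_ne_iff, mlEval_eq_const_add c, mlEval_eq_const_add c (pmVec (flipBy s x))] at hne
      set r := mlEval (dropConst c) (pmVec x)
      set r' := mlEval (dropConst c) (pmVec (flipBy s x))
      by_cases h3 : c ∅ ^ 2 ≤ r ^ 2
      · rw [if_pos h3]; split_ifs <;> norm_num
      · have h4 : c ∅ ^ 2 ≤ r' ^ 2 := by
          by_contra h4
          push Not at h3 h4
          have h5 := abs_lt.1 (sq_lt_sq.1 h3)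
          have h6 := abs_lt.1 (sq_lt_sq.1 h4)
          rcases abs_cases (c ∅) with ⟨h7, h8⟩ | ⟨h7, h8⟩ <;> rw [h7] at h5 h6 <;>
            rcases hne with ⟨h9, h10⟩ | ⟨h9, h10⟩ <;> linarith [h5.1, h5.2, h6.1, h6.2]
        rw [if_neg h3, if_pos h4]; norm_num
    · rw [if_neg hne]
      split_ifs <;> norm_num
  rw [le_div_iff₀ hc2]
  nlinarith

lemma noiseSens_signFun_eq_zero {δ : ℝ} {c : Finset (Fin n) → ℝ} (h : varCoeff c = 0) :
    noiseSens δ (signFun c) = 0 := by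
  have h1 : ∀ I, dropConst c I = 0 := fun I => by
    have := (Finset.sum_eq_zero_iff_of_nonneg fun I _ => sq_nonneg (dropConst c I)).1 h I (mem_univ I)
    exact pow_eq_zero_iff (two_ne_zero) |>.1 this
  have h2 : ∀ x, mlEval c x = c ∅ := fun x => by
    rw [mlEval_eq_const_add]; simp [mlEval, h1]
  rw [noiseSens_eq]
  simp [signFun, h2, noiseAvg, cubeAvg]

end Noise

section Restriction

variable {n : ℕ}

lemma cubeAvg_sum_mlEval_sq {ι : Type*} (T : Finset ι) (c : ι → Finset (Fin n) → ℝ) :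
    cubeAvg (fun x => ∑ s ∈ T, mlEval (c s) (pmVec x) ^ 2) = ∑ s ∈ T, ∑ I, c s I ^ 2 := by
  rw [cubeAvg_sum]
  exact Finset.sum_congr rfl fun s _ => cubeAvg_mlEval_sq _

lemma cubeAvg_sum_mlEval_sq_sq_le {ι : Type*} (T : Finset ι) (c : ι → Finset (Fin n) → ℝ) {d : ℕ}
    (h : ∀ s, DegLE (c s) d) :
    cubeAvg (fun x => (∑ s ∈ T, mlEval (c s) (pmVec x) ^ 2) ^ 2)
      ≤ 256 ^ d * (∑ s ∈ T, ∑ I, c s I ^ 2) ^ 2 := by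
  have := integral_sum_mlEval_sq_sq_le (fun _ : Fin n => rad) T c h
  rwa [integral_pi_rad (fun x => (∑ s ∈ T, mlEval (c s) x ^ 2) ^ 2) (by fun_prop)] at this

lemma cubeProb_sum_mlEval_sq_ge {ι : Type*} (T : Finset ι) (c : ι → Finset (Fin n) → ℝ) {d : ℕ}
    (h : ∀ s, DegLE (c s) d) :
    1 / (4 * 256 ^ d) ≤ cubeProb fun x : Fin n → Bool =>
      (∑ s ∈ T, ∑ I, c s I ^ 2) / 2 ≤ ∑ s ∈ T, mlEval (c s) (pmVec x) ^ 2 := by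
  have := prob_sum_mlEval_sq_ge (fun _ : Fin n => rad) T c h
  rwa [measure_pi_rad (fun x => (∑ s ∈ T, ∑ I, c s I ^ 2) / 2 ≤ ∑ s ∈ T, mlEval (c s) x ^ 2)
    (measurableSet_le measurable_const (by fun_prop))] at this

/-- Take the coordinates in `H` from `ρ` and the others from `x`. -/
def mergeOn (H : Finset (Fin n)) (ρ x : Fin n → Bool) (i : Fin n) : Bool := if i ∈ H then ρ i else x i

lemma cubeAvg_mergeOn (H : Finset (Fin n)) (F : (Fin n → Bool) → ℝ) :
    cubeAvg (fun ρ => cubeAvg fun x => F (mergeOn H ρ x)) = cubeAvg F := by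
  have hinv : Function.Involutive fun p : (Fin n → Bool) × (Fin n → Bool) =>
      (mergeOn H p.1 p.2, mergeOn H p.2 p.1) := by
    rintro ⟨ρ, x⟩
    ext i <;> by_cases hi : i ∈ H <;> simp [mergeOn, hi]
  have h1 : ∑ ρ, ∑ x, F (mergeOn H ρ x) = ∑ ρ : Fin n → Bool, ∑ _x : Fin n → Bool, F ρ := by
    rw [← Fintype.sum_prod_type' (f := fun ρ x => F (mergeOn H ρ x)),
      ← Fintype.sum_prod_type' (f := fun ρ _ => F ρ)]
    exact Equiv.sum_comp hinv.toPerm fun p : (Fin n → Bool) × (Fin n → Bool) => F p.1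
  have h2 : ∀ F : (Fin n → Bool) → ℝ, cubeAvg F = cubeAvg fun ρ => cubeAvg fun _ : Fin n → Bool => F ρ := by
    intro F; simp only [cubeAvg_const]
  rw [h2 F]
  unfold cubeAvg
  rw [← Finset.mul_sum, ← Finset.mul_sum, h1]

/-- Coefficient, at the monomial `U` in the fixed variables and `T` in the free ones. -/
def splitCoeff (H : Finset (Fin n)) (c : Finset (Fin n) → ℝ) (T U : Finset (Fin n)) : ℝ :=
  ∑ I, if I \ H = T ∧ I ∩ H = U then c I else 0

/-- Coefficients of the polynomial obtained by fixing the coordinates in `H` according to `ρ`. -/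
def fixCoeff (H : Finset (Fin n)) (c : Finset (Fin n) → ℝ) (ρ : Fin n → Bool)
    (T : Finset (Fin n)) : ℝ := mlEval (splitCoeff H c T) (pmVec ρ)

lemma exists_of_splitCoeff_ne {H : Finset (Fin n)} {c : Finset (Fin n) → ℝ} {T U : Finset (Fin n)}
    (h : splitCoeff H c T U ≠ 0) : ∃ I, I \ H = T ∧ I ∩ H = U ∧ c I ≠ 0 := by
  obtain ⟨I, -, hI⟩ := Finset.exists_ne_zero_of_sum_ne_zero h
  by_cases h1 : I \ H = T ∧ I ∩ H = U
  · exact ⟨I, h1.1, h1.2, by simpa [h1] using hI⟩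
  · simp [h1] at hI

lemma degLE_splitCoeff {c : Finset (Fin n) → ℝ} {d : ℕ} (h : DegLE c d) (H T : Finset (Fin n)) :
    DegLE (splitCoeff H c T) d := by
  intro U hU
  obtain ⟨I, -, rfl, hI⟩ := exists_of_splitCoeff_ne hU
  exact (Finset.card_le_card Finset.inter_subset_left).trans (h I hI)

lemma exists_of_fixCoeff_ne {H : Finset (Fin n)} {c : Finset (Fin n) → ℝ} {ρ : Fin n → Bool}
    {T : Finset (Fin n)} (h : fixCoeff H c ρ T ≠ 0) : ∃ I, I \ H = T ∧ c I ≠ 0 := by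
  unfold fixCoeff mlEval at h
  obtain ⟨U, -, hU⟩ := Finset.exists_ne_zero_of_sum_ne_zero h
  obtain ⟨I, h1, -, h3⟩ := exists_of_splitCoeff_ne (left_ne_zero_of_mul hU)
  exact ⟨I, h1, h3⟩

lemma degLE_fixCoeff {c : Finset (Fin n) → ℝ} {d : ℕ} (h : DegLE c d) (H : Finset (Fin n))
    (ρ : Fin n → Bool) : DegLE (fixCoeff H c ρ) d := by
  intro T hT
  obtain ⟨I, rfl, hI⟩ := exists_of_fixCoeff_ne hT
  exact (Finset.card_le_card Finset.sdiff_subset).trans (h I hI)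

lemma mlEval_fixCoeff (H : Finset (Fin n)) (c : Finset (Fin n) → ℝ) (ρ x : Fin n → Bool) :
    mlEval (fixCoeff H c ρ) (pmVec x) = mlEval c (pmVec (mergeOn H ρ x)) := by
  have h1 : ∀ T, fixCoeff H c ρ T
      = ∑ I, if I \ H = T then c I * ∏ i ∈ I ∩ H, pmVec ρ i else 0 := by
    intro T
    unfold fixCoeff mlEval splitCoeff
    simp only [Finset.sum_mul]
    rw [Finset.sum_comm]
    refine Finset.sum_congr rfl fun I _ => ?_
    by_cases hI : I \ H = T <;> simp [hI]
  unfold mlEval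
  simp only [h1, Finset.sum_mul]
  rw [Finset.sum_comm]
  refine Finset.sum_congr rfl fun I _ => ?_
  simp only [ite_mul, zero_mul]
  rw [Finset.sum_ite_eq univ (I \ H)]
  simp only [mem_univ, if_true]
  rw [mul_assoc, ← Finset.prod_inter_mul_prod_sdiff I H (pmVec (mergeOn H ρ x))]
  congr 2
  · refine Finset.prod_congr rfl fun i hi => ?_
    simp [pmVec, mergeOn, (Finset.mem_inter.1 hi).2]
  · refine Finset.prod_congr rfl fun i hi => ?_
    simp [pmVec, mergeOn, (Finset.mem_sdiff.1 hi).2]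

lemma signFun_fixCoeff (H : Finset (Fin n)) (c : Finset (Fin n) → ℝ) (ρ x : Fin n → Bool) :
    signFun (fixCoeff H c ρ) x = signFun c (mergeOn H ρ x) := by
  unfold signFun
  rw [mlEval_fixCoeff]

lemma sum_splitCoeff_sq (H : Finset (Fin n)) (c : Finset (Fin n) → ℝ) (p : Finset (Fin n) → Prop)
    [DecidablePred p] :
    ∑ T ∈ univ.filter p, ∑ U, splitCoeff H c T U ^ 2
      = ∑ I ∈ univ.filter (fun I => p (I \ H)), c I ^ 2 := by
  have h1 : ∀ T U, splitCoeff H c T U ^ 2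
      = ∑ I, if I \ H = T ∧ I ∩ H = U then c I ^ 2 else 0 := by
    intro T U
    by_cases hE : ∃ J, J \ H = T ∧ J ∩ H = U
    · obtain ⟨J, h1, h2⟩ := hE
      have hu : ∀ I, (I \ H = T ∧ I ∩ H = U) ↔ I = J := by
        refine fun I => ⟨fun ⟨h3, h4⟩ => ?_, fun h => h ▸ ⟨h1, h2⟩⟩
        rw [← Finset.sdiff_union_inter I H, ← Finset.sdiff_union_inter J H, h1, h2, h3, h4]
      simp [splitCoeff, hu]
    · push Not at hE
      have hu : ∀ I, ¬ (I \ H = T ∧ I ∩ H = U) := fun I h => hE I h.1 h.2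
      simp [splitCoeff, hu]
  simp only [h1, Finset.sum_filter]
  calc ∑ T, (if p T then ∑ U, ∑ I, (if I \ H = T ∧ I ∩ H = U then c I ^ 2 else 0) else 0)
      = ∑ T, ∑ I, if I \ H = T then (if p T then c I ^ 2 else 0) else 0 := by
        refine Finset.sum_congr rfl fun T _ => ?_
        by_cases hT : p T
        · simp only [hT, if_true]
          rw [Finset.sum_comm]
          refine Finset.sum_congr rfl fun I _ => ?_
          by_cases hI : I \ H = T <;> simp [hI]
        · simp [hT]
    _ = _ := by
        rw [Finset.sum_comm]
        refine Finset.sum_congr rfl fun I _ => ?_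
        rw [Finset.sum_ite_eq univ (I \ H)]
        simp

lemma wsq_nonneg (c : Finset (Fin n) → ℝ) (i : Fin n) : 0 ≤ wsq c i :=
  Finset.sum_nonneg fun _ _ => sq_nonneg _

lemma wsq_fixCoeff_of_mem {H : Finset (Fin n)} (c : Finset (Fin n) → ℝ) (ρ : Fin n → Bool)
    {i : Fin n} (hi : i ∈ H) : wsq (fixCoeff H c ρ) i = 0 := by
  refine Finset.sum_eq_zero fun T hT => ?_
  by_contra h
  obtain ⟨I, rfl, -⟩ := exists_of_fixCoeff_ne (fun h0 => h (by rw [h0]; simp))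
  simp [hi] at hT

lemma sum_splitCoeff_wsq {H : Finset (Fin n)} (c : Finset (Fin n) → ℝ) {i : Fin n} (hi : i ∉ H) :
    ∑ T ∈ univ.filter (i ∈ ·), ∑ U, splitCoeff H c T U ^ 2 = wsq c i := by
  rw [sum_splitCoeff_sq H c (i ∈ ·)]
  unfold wsq
  congr 1
  ext I; simp [hi]

lemma cubeAvg_sum_wsq_fixCoeff_sq_le {c : Finset (Fin n) → ℝ} {d : ℕ} (h : DegLE c d)
    (H : Finset (Fin n)) :
    cubeAvg (fun ρ => ∑ i, wsq (fixCoeff H c ρ) i ^ 2) ≤ 256 ^ d * ∑ i ∈ Hᶜ, wsq c i ^ 2 := by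
  have h1 : ∀ ρ, ∑ i, wsq (fixCoeff H c ρ) i ^ 2 = ∑ i ∈ Hᶜ, wsq (fixCoeff H c ρ) i ^ 2 := by
    intro ρ
    refine (Finset.sum_subset (Finset.subset_univ _) fun i _ hi => ?_).symm
    rw [wsq_fixCoeff_of_mem c ρ (by simpa using hi)]; simp
  simp only [h1]
  rw [cubeAvg_sum, Finset.mul_sum]
  refine Finset.sum_le_sum fun i hi => ?_
  rw [← sum_splitCoeff_wsq c (by simpa using hi)]
  exact cubeAvg_sum_mlEval_sq_sq_le _ _ fun T => degLE_splitCoeff h H T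

lemma varCoeff_eq_filter (c : Finset (Fin n) → ℝ) :
    varCoeff c = ∑ I ∈ univ.filter (· ≠ ∅), c I ^ 2 := by
  unfold varCoeff dropConst
  rw [Finset.sum_filter]
  exact Finset.sum_congr rfl fun I _ => by by_cases h : I = ∅ <;> simp [h]

/-- The weight of the monomials that survive fixing the coordinates in `H`. -/
def freeVar (H : Finset (Fin n)) (c : Finset (Fin n) → ℝ) : ℝ :=
  ∑ I ∈ univ.filter (fun I => I \ H ≠ ∅), c I ^ 2

lemma cubeAvg_varCoeff_fixCoeff (c : Finset (Fin n) → ℝ) (H : Finset (Fin n)) :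
    cubeAvg (fun ρ => varCoeff (fixCoeff H c ρ)) = freeVar H c := by
  simp only [varCoeff_eq_filter]
  exact (cubeAvg_sum_mlEval_sq _ _).trans (sum_splitCoeff_sq H c (· ≠ ∅))

lemma cubeProb_varCoeff_fixCoeff_ge {c : Finset (Fin n) → ℝ} {d : ℕ} (h : DegLE c d)
    (H : Finset (Fin n)) :
    1 / (4 * 256 ^ d) ≤ cubeProb fun ρ => freeVar H c / 2 ≤ varCoeff (fixCoeff H c ρ) := by
  have := cubeProb_sum_mlEval_sq_ge (univ.filter (· ≠ ∅)) (splitCoeff H c) fun T =>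
    degLE_splitCoeff h H T
  rw [sum_splitCoeff_sq H c (· ≠ ∅)] at this
  simp only [varCoeff_eq_filter]
  exact this

lemma cubeProb_fixCoeff_empty_ge {c : Finset (Fin n) → ℝ} {d : ℕ} (h : DegLE c d)
    (H : Finset (Fin n)) :
    1 / (4 * 256 ^ d) ≤ cubeProb fun ρ =>
      (∑ I, c I ^ 2 - freeVar H c) / 2 ≤ fixCoeff H c ρ ∅ ^ 2 := by
  have := cubeProb_sum_mlEval_sq_ge (univ.filter (· = ∅)) (splitCoeff H c) fun T =>
    degLE_splitCoeff h H T
  rw [sum_splitCoeff_sq H c (· = ∅)] at this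
  have e : ∑ I ∈ univ.filter (fun I => I \ H = ∅), c I ^ 2 = ∑ I, c I ^ 2 - freeVar H c := by
    rw [eq_sub_iff_add_eq]
    exact Finset.sum_filter_add_sum_filter_not univ (fun I : Finset (Fin n) => I \ H = ∅) _
  rw [e] at this
  refine this.trans (cubeProb_mono fun ρ hρ => ?_)
  rw [Finset.filter_eq' univ ∅] at hρ
  simpa [fixCoeff] using hρ

lemma sum_compl_wsq (c : Finset (Fin n) → ℝ) (H : Finset (Fin n)) :
    ∑ i ∈ Hᶜ, wsq c i = ∑ I, ((I \ H).card : ℝ) * c I ^ 2 := by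
  unfold wsq
  simp only [Finset.sum_filter]
  rw [Finset.sum_comm]
  refine Finset.sum_congr rfl fun I _ => ?_
  rw [← Finset.sum_filter, Finset.sum_const, nsmul_eq_mul]
  congr 3
  ext i; simp [and_comm]

lemma freeVar_le (c : Finset (Fin n) → ℝ) (H : Finset (Fin n)) :
    freeVar H c ≤ ∑ i ∈ Hᶜ, wsq c i := by
  rw [sum_compl_wsq, freeVar, Finset.sum_filter]
  refine Finset.sum_le_sum fun I _ => ?_
  split_ifs with h
  · have : (1 : ℝ) ≤ (I \ H).card := by
      exact_mod_cast Finset.card_pos.2 (Finset.nonempty_iff_ne_empty.2 h)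
    nlinarith [sq_nonneg (c I)]
  · positivity

lemma sum_compl_wsq_le {c : Finset (Fin n) → ℝ} {d : ℕ} (h : DegLE c d) (H : Finset (Fin n)) :
    ∑ i ∈ Hᶜ, wsq c i ≤ d * freeVar H c := by
  rw [sum_compl_wsq, freeVar, Finset.sum_filter, Finset.mul_sum]
  refine Finset.sum_le_sum fun I _ => ?_
  by_cases hc : c I = 0
  · simp [hc]
  split_ifs with h'
  · have : ((I \ H).card : ℝ) ≤ d := by
      exact_mod_cast (Finset.card_le_card Finset.sdiff_subset).trans (h I hc)
    nlinarith [sq_nonneg (c I)]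
  · push Not at h'; simp [h']

lemma freeVar_le_sum (c : Finset (Fin n) → ℝ) (H : Finset (Fin n)) :
    freeVar H c ≤ ∑ I, c I ^ 2 :=
  Finset.sum_le_sum_of_subset_of_nonneg (Finset.filter_subset _ _) fun _ _ _ => sq_nonneg _

/-- Fixing few coordinates decouples the noise from them. -/
lemma noiseSens_le_fix {δ : ℝ} (h0 : 0 ≤ δ) (h1 : δ ≤ 1) (c : Finset (Fin n) → ℝ)
    (H : Finset (Fin n)) :
    noiseSens δ (signFun c) ≤ H.card * δ
      + cubeAvg fun ρ => noiseSens δ (signFun (fixCoeff H c ρ)) := by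
  have e1 : noiseSens δ (signFun c) = cubeAvg fun ρ => noiseAvg δ fun x s =>
      if signFun c (mergeOn H ρ x) ≠ signFun c (flipBy s (mergeOn H ρ x)) then 1 else 0 :=
    (cubeAvg_mergeOn H _).symm
  have e2 : ((H.card : ℝ) * δ) = noiseAvg δ fun (_ : Fin n → Bool) s =>
      ∑ i ∈ H, if s i then 1 else 0 := by
    rw [noiseAvg_right]
    simp only [Finset.mul_sum]
    rw [Finset.sum_comm]
    simp only [sum_flipWeight_flip, Finset.sum_const, nsmul_eq_mul]
  have e3 : ((H.card : ℝ) * δ) = cubeAvg fun _ : Fin n → Bool => (H.card : ℝ) * δ :=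
    (cubeAvg_const _).symm
  rw [e1, e3, ← cubeAvg_add]
  refine cubeAvg_mono fun ρ => ?_
  rw [e2, noiseSens_eq, ← noiseAvg_add]
  refine noiseAvg_mono h0 h1 fun x s => ?_
  simp only [signFun_fixCoeff]
  have hnn : ∀ i ∈ H, (0 : ℝ) ≤ if s i then 1 else 0 := fun i _ => by split_ifs <;> norm_num
  by_cases hs : ∃ i ∈ H, s i = true
  · obtain ⟨i, hi, hsi⟩ := hs
    have h3 := Finset.single_le_sum hnn hi
    simp only [hsi, if_true] at h3
    split_ifs <;> linarith
  · push Not at hs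
    have : flipBy s (mergeOn H ρ x) = mergeOn H ρ (flipBy s x) := by
      funext i
      by_cases hi : i ∈ H
      · simp [flipBy, mergeOn, hi, hs i hi]
      · simp [flipBy, mergeOn, hi]
    rw [this]
    linarith [Finset.sum_nonneg hnn]

lemma exists_greedy (w : Fin n → ℝ) {τ : ℝ} (h1 : τ ≤ 1) (K : ℕ) :
    ∃ H : Finset (Fin n), H.card ≤ K ∧ ((∀ i ∈ Hᶜ, w i ≤ τ * ∑ j ∈ Hᶜ, w j) ∨
      ∑ j ∈ Hᶜ, w j ≤ (1 - τ) ^ K * ∑ j, w j) := by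
  induction K with
  | zero => exact ⟨∅, by simp, Or.inr (by simp)⟩
  | succ K ih =>
    obtain ⟨H, hH, h | h⟩ := ih
    · exact ⟨H, by omega, Or.inl h⟩
    · by_cases ha : ∀ i ∈ Hᶜ, w i ≤ τ * ∑ j ∈ Hᶜ, w j
      · exact ⟨H, by omega, Or.inl ha⟩
      push Not at ha
      obtain ⟨i, hi, hlt⟩ := ha
      refine ⟨insert i H, (Finset.card_insert_le _ _).trans (by omega), Or.inr ?_⟩
      have e : (insert i H)ᶜ = Hᶜ.erase i := by ext j; simp
      have h3 := Finset.add_sum_erase Hᶜ w hi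
      rw [e, pow_succ]
      have h4 := mul_le_mul_of_nonneg_left h (by linarith : 0 ≤ 1 - τ)
      nlinarith

end Restriction

section Main

variable {n : ℕ}

lemma exists_noiseSens_le_of_regular : ∃ M : ℝ, 1 ≤ M ∧ ∀ (n d : ℕ) (c : Finset (Fin n) → ℝ)
    (β A : ℝ), 1 ≤ d → DegLE c d → 0 < β → β ≤ 1 → 0 ≤ A →
      ∑ i, wsq c i ^ 2 ≤ A * β ^ (4 * d + 3) * varCoeff c ^ 2 →
      noiseSens (β ^ (4 * d + 6)) (signFun c) ≤ ((2 ^ 34) ^ d + M * 256 ^ d * A + 4 * d) * β := by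
  obtain ⟨M, hM, hball⟩ := exists_cube_small_ball
  refine ⟨M, hM, fun n d c β A hd h hβ hβ1 hA hreg => ?_⟩
  have hRHS : 0 ≤ ((2 ^ 34) ^ d + M * 256 ^ d * A + 4 * d) * β := by positivity
  rcases (varCoeff_nonneg c).eq_or_lt with hV | hV
  · rwa [noiseSens_signFun_eq_zero hV.symm]
  have h1 := noiseSens_signFun_le (δ := β ^ (4 * d + 6)) (by positivity)
    (pow_le_one₀ hβ.le hβ1) h (L := β ^ (2 * d + 1) * varCoeff c) (by positivity)
  have h2 := hball n d c hd h hV β hβ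
  have h3 : M * 256 ^ d * (∑ i, wsq c i ^ 2) / (β ^ (4 * d + 2) * varCoeff c ^ 2)
      ≤ M * 256 ^ d * A * β := by
    rw [div_le_iff₀ (by positivity)]
    calc M * 256 ^ d * (∑ i, wsq c i ^ 2)
        ≤ M * 256 ^ d * (A * β ^ (4 * d + 3) * varCoeff c ^ 2) := by gcongr
      _ = _ := by ring
  have h4 : (β ^ (2 * d + 1) * varCoeff c)⁻¹ * (4 * d * β ^ (4 * d + 6) * varCoeff c)
      ≤ 4 * d * β := by
    rw [inv_mul_le_iff₀ (by positivity)]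
    have e : 4 * d * β ^ (4 * d + 6) * varCoeff c
        = β ^ (2 * d + 1) * varCoeff c * (4 * d * β * β ^ (2 * d + 4)) := by ring
    rw [e]
    have h5 : β ^ (2 * d + 4) ≤ 1 := pow_le_one₀ hβ.le hβ1
    have h6 : 4 * d * β * β ^ (2 * d + 4) ≤ 4 * d * β := mul_le_of_le_one_right (by positivity) h5
    exact mul_le_mul_of_nonneg_left h6 (by positivity)
  have h5 := h1.trans (add_le_add (h2.trans (add_le_add le_rfl h3)) h4)
  exact h5.trans (le_of_eq (by ring))

lemma noiseSens_le_of_nearly_const {c : Finset (Fin n) → ℝ} {δ N η : ℝ} (h0 : 0 ≤ δ) (h1 : δ ≤ 1)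
    (hN : 0 < N) (hc : N / 4 ≤ c ∅ ^ 2) (hV : varCoeff c ≤ η * N) :
    noiseSens δ (signFun c) ≤ 8 * η := by
  have hc0 : c ∅ ≠ 0 := by
    intro h; rw [h] at hc; norm_num at hc; linarith
  refine (noiseSens_signFun_le_of_biased h0 h1 hc0).trans ?_
  have : 0 < c ∅ ^ 2 := by positivity
  rw [div_le_iff₀ this]
  have hη : 0 ≤ η := by
    by_contra hη
    push Not at hη
    have := varCoeff_nonneg c
    nlinarith
  nlinarith

lemma cubeProb_ge_sub {p q r : (Fin n → Bool) → Prop} {a b : ℝ} (hp : a ≤ cubeProb p)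
    (hq : cubeProb q ≤ b) (h : ∀ x, p x → ¬ q x → r x) : a - b ≤ cubeProb r := by
  have h1 : cubeProb p ≤ cubeProb (fun x => r x ∨ q x) := cubeProb_mono fun x hx => by
    by_cases hqx : q x
    · exact Or.inr hqx
    · exact Or.inl (h x hx hqx)
  linarith [cubeProb_or_le r q]

lemma one_sub_pow_le {τ β : ℝ} {K : ℕ} (hβ : 0 < β) (hτ0 : 0 < τ) (hτ : τ ≤ 1)
    (hK : 1 / (τ * β) ≤ K) : (1 - τ) ^ K ≤ β := by
  have h1 : (1 - τ) ^ K ≤ Real.exp (-(τ * K)) := by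
    calc (1 - τ) ^ K ≤ Real.exp (-τ) ^ K :=
          pow_le_pow_left₀ (by linarith) (Real.one_sub_le_exp_neg τ) K
      _ = _ := by rw [← Real.exp_nat_mul]; congr 1; ring
  have h2 : β⁻¹ ≤ τ * K := by
    calc β⁻¹ = τ * (1 / (τ * β)) := by field_simp
      _ ≤ _ := by gcongr
  have h3 : Real.exp (-(τ * K)) ≤ Real.exp (-β⁻¹) := Real.exp_le_exp.2 (by linarith)
  have h4 : Real.exp (-β⁻¹) ≤ β := by
    rw [Real.exp_neg, inv_le_comm₀ (Real.exp_pos _) hβ]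
    linarith [Real.add_one_le_exp β⁻¹]
  linarith

/-- After fixing a suitable small set of coordinates, the restricted threshold function has small
noise sensitivity with noticeable probability. -/
lemma exists_fix_noiseSens_le : ∃ M : ℝ, 1 ≤ M ∧ ∀ (n d K : ℕ) (c : Finset (Fin n) → ℝ) (β : ℝ),
    1 ≤ d → DegLE c d → 0 < varCoeff c → 0 < β → β ≤ 1 → d * β ≤ 1 / 2 →
    1 / (β ^ (4 * d + 3) * β) ≤ K → ∃ H : Finset (Fin n), H.card ≤ K ∧
      1 / (8 * 256 ^ d) ≤ cubeProb fun ρ => noiseSens (β ^ (4 * d + 6)) (signFun (fixCoeff H c ρ)) ≤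
        ((2 ^ 34) ^ d + M * 256 ^ d * (32 * d ^ 2 * (256 ^ d) ^ 2) + 4 * d + 64 * 256 ^ d * d) * β := by
  obtain ⟨M, hM, hreg⟩ := exists_noiseSens_le_of_regular
  refine ⟨M, hM, fun n d K c β hd h hV hβ hβ1 hdβ hK => ?_⟩
  set B : ℝ := 256 ^ d with hB
  have hB0 : 0 < B := by positivity
  set τ := β ^ (4 * d + 3) with hτ
  have hτ0 : 0 < τ := by positivity
  have hτ1 : τ ≤ 1 := pow_le_one₀ hβ.le hβ1
  obtain ⟨H, hH, hcase⟩ := exists_greedy (wsq c) hτ1 K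
  refine ⟨H, hH, ?_⟩
  set I := ∑ j ∈ Hᶜ, wsq c j with hI
  have hd0 : (0 : ℝ) ≤ d := Nat.cast_nonneg d
  have hI0 : 0 ≤ I := Finset.sum_nonneg fun _ _ => wsq_nonneg _ _
  have hWI : freeVar H c ≤ I := freeVar_le c H
  have hIW : I ≤ d * freeVar H c := sum_compl_wsq_le h H
  have hsub : 1 / (8 * B) = 1 / (4 * B) - 1 / (8 * B) := by field_simp; norm_num
  rw [hsub]
  have hMB : 0 ≤ M * B * (32 * d ^ 2 * B ^ 2) := by positivity
  by_cases hb : I ≤ β * ∑ j, wsq c j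
  · have hN : 0 < ∑ I, c I ^ 2 := by
      rw [varCoeff_eq_filter] at hV
      exact hV.trans_le (Finset.sum_le_sum_of_subset_of_nonneg (Finset.filter_subset _ _)
        fun _ _ _ => sq_nonneg _)
    set N := ∑ I, c I ^ 2 with hNdef
    have hall : ∑ j, wsq c j ≤ d * N := by
      have h1 := sum_compl_wsq_le h (∅ : Finset (Fin n))
      rw [Finset.compl_empty] at h1
      exact h1.trans (mul_le_mul_of_nonneg_left (freeVar_le_sum c ∅) hd0)
    have hW : freeVar H c ≤ d * β * N := by
      have := mul_le_mul_of_nonneg_left hall hβ.le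
      linarith
    have hdpos : (0 : ℝ) < d := by exact_mod_cast hd
    refine cubeProb_ge_sub (cubeProb_fixCoeff_empty_ge h H)
      (q := fun ρ => 8 * B * (d * β) * N ≤ varCoeff (fixCoeff H c ρ)) ?_ fun ρ h1 h2 => ?_
    · have h3 := cubeProb_markov (F := fun ρ => varCoeff (fixCoeff H c ρ))
        (fun ρ => varCoeff_nonneg _) (t := 8 * B * (d * β) * N)
      rw [cubeAvg_varCoeff_fixCoeff] at h3
      have hp : 0 < d * β * N := by positivity
      rw [le_div_iff₀ (by positivity)]
      refine le_of_mul_le_mul_left ?_ hp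
      linarith
    · push Not at h2
      have h3 : N / 4 ≤ fixCoeff H c ρ ∅ ^ 2 := by nlinarith
      have h4 := noiseSens_le_of_nearly_const (δ := β ^ (4 * d + 6)) (by positivity)
        (pow_le_one₀ hβ.le hβ1) hN h3 h2.le
      have : 0 ≤ ((2 ^ 34) ^ d + M * B * (32 * d ^ 2 * B ^ 2) + 4 * d) * β := by positivity
      nlinarith
  · have ha : ∀ i ∈ Hᶜ, wsq c i ≤ τ * I := by
      refine hcase.resolve_right fun h' => hb (h'.trans ?_)
      exact mul_le_mul_of_nonneg_right (one_sub_pow_le hβ hτ0 hτ1 hK)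
        (Finset.sum_nonneg fun _ _ => wsq_nonneg _ _)
    have hIpos : 0 < I := by
      push Not at hb
      exact lt_of_le_of_lt (mul_nonneg hβ.le (Finset.sum_nonneg fun _ _ => wsq_nonneg _ _)) hb
    refine cubeProb_ge_sub (cubeProb_varCoeff_fixCoeff_ge h H)
      (q := fun ρ => 8 * B * (B * (τ * I ^ 2)) ≤ ∑ i, wsq (fixCoeff H c ρ) i ^ 2) ?_ fun ρ h1 h2 => ?_
    · have h3 := (cubeProb_markov (F := fun ρ => ∑ i, wsq (fixCoeff H c ρ) i ^ 2)
        (fun ρ => Finset.sum_nonneg fun _ _ => sq_nonneg _) (t := 8 * B * (B * (τ * I ^ 2)))).trans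
        (cubeAvg_sum_wsq_fixCoeff_sq_le h H)
      have h4 : ∑ i ∈ Hᶜ, wsq c i ^ 2 ≤ τ * I ^ 2 := by
        calc ∑ i ∈ Hᶜ, wsq c i ^ 2 ≤ ∑ i ∈ Hᶜ, τ * I * wsq c i := by
              refine Finset.sum_le_sum fun i hi => ?_
              nlinarith [ha i hi, wsq_nonneg c i]
          _ = τ * I ^ 2 := by rw [← Finset.mul_sum]; ring
      have h5 := h3.trans (mul_le_mul_of_nonneg_left h4 hB0.le)
      rw [le_div_iff₀ (by positivity)]
      refine le_of_mul_le_mul_left ?_ (by positivity : 0 < B * (τ * I ^ 2))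
      linarith
    · push Not at h2
      set V := varCoeff (fixCoeff H c ρ) with hVρ
      have h3 : I ≤ 2 * d * V := by nlinarith
      have h4 : I ^ 2 ≤ (2 * d * V) ^ 2 := pow_le_pow_left₀ hI0 h3 2
      have h5 : ∑ i, wsq (fixCoeff H c ρ) i ^ 2 ≤ 32 * d ^ 2 * B ^ 2 * τ * V ^ 2 := by
        have := mul_le_mul_of_nonneg_left h4 (by positivity : 0 ≤ 8 * B * B * τ)
        linarith
      have h6 := hreg n d _ β _ hd (degLE_fixCoeff h H ρ) hβ hβ1 (by positivity) h5
      have : 0 ≤ 64 * B * d * β := by positivity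
      linarith

lemma exists_noiseSens_signFun_le : ∃ M : ℝ, 1 ≤ M ∧ ∀ (n d : ℕ) (c : Finset (Fin n) → ℝ) (β : ℝ),
    1 ≤ d → DegLE c d → 0 < β → β ≤ 1 → noiseSens (β ^ (4 * d + 6)) (signFun c) ≤
      8 * 256 ^ d * (2 + ((2 ^ 34) ^ d + M * 256 ^ d * (32 * d ^ 2 * (256 ^ d) ^ 2) + 4 * d
        + 64 * 256 ^ d * d)) * β := by
  obtain ⟨M, hM, hfix⟩ := exists_fix_noiseSens_le
  refine ⟨M, hM, fun n d c β hd h hβ hβ1 => ?_⟩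
  have hfix' := fun K c => hfix n d K c β
  set B : ℝ := 256 ^ d with hB
  have hB1 : 1 ≤ B := one_le_pow₀ (by norm_num)
  set D : ℝ := (2 ^ 34) ^ d + M * B * (32 * d ^ 2 * B ^ 2) + 4 * d + 64 * B * d with hD
  have hd0 : (0 : ℝ) ≤ d := Nat.cast_nonneg d
  have hD4 : 4 * d ≤ D := by
    have : (0 : ℝ) ≤ (2 ^ 34) ^ d + M * B * (32 * d ^ 2 * B ^ 2) + 64 * B * d := by positivity
    linarith
  have hD0 : 0 ≤ D := by linarith
  set δ := β ^ (4 * d + 6) with hδ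
  have hδ0 : 0 ≤ δ := by positivity
  have hδ1 : δ ≤ 1 := pow_le_one₀ hβ.le hβ1
  by_cases hdβ : d * β ≤ 1 / 2
  swap
  · push Not at hdβ
    have h1 : D * β ≤ B * (D * β) := le_mul_of_one_le_left (by positivity) hB1
    have h2 : 0 ≤ B * β := by positivity
    have h3 := mul_le_mul_of_nonneg_right hD4 hβ.le
    linarith [noiseSens_le_one hδ0 hδ1 (signFun c)]
  set S : Set ℝ := {r | ∃ c : Finset (Fin n) → ℝ, DegLE c d ∧ r = noiseSens δ (signFun c)} with hS
  have hbdd : BddAbove S := ⟨1, by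
    rintro r ⟨c, -, rfl⟩
    exact noiseSens_le_one hδ0 hδ1 _⟩
  have hle : ∀ c : Finset (Fin n) → ℝ, DegLE c d → noiseSens δ (signFun c) ≤ sSup S :=
    fun c hc => le_csSup hbdd ⟨c, hc, rfl⟩
  have hN0 : 0 ≤ sSup S := by
    have hz : varCoeff (fun _ : Finset (Fin n) => (0 : ℝ)) = 0 := by simp [varCoeff, dropConst]
    have := hle (fun _ => 0) fun I hI => absurd rfl hI
    rwa [noiseSens_signFun_eq_zero hz] at this
  set K := ⌈1 / (β ^ (4 * d + 3) * β)⌉₊ with hK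
  have hKδ : K * δ ≤ 2 * β := by
    have h1 : (K : ℝ) ≤ 1 / (β ^ (4 * d + 3) * β) + 1 := (Nat.ceil_lt_add_one (by positivity)).le
    have h2 := mul_le_mul_of_nonneg_right h1 hδ0
    have h3 : (1 / (β ^ (4 * d + 3) * β) + 1) * δ = β * β + β * β ^ (4 * d + 5) := by
      rw [hδ]; field_simp; ring
    have h4 : β * β ≤ β := mul_le_of_le_one_right hβ.le hβ1
    have h5 : β * β ^ (4 * d + 5) ≤ β := mul_le_of_le_one_right hβ.le (pow_le_one₀ hβ.le hβ1)
    linarith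
  have hstep : ∀ c : Finset (Fin n) → ℝ, DegLE c d →
      noiseSens δ (signFun c) ≤ 2 * β + D * β + (1 - 1 / (8 * B)) * sSup S := by
    intro c hc
    rcases (varCoeff_nonneg c).eq_or_lt with hV | hV
    · rw [noiseSens_signFun_eq_zero hV.symm]
      have : 1 / (8 * B) ≤ 1 := by rw [div_le_one (by positivity)]; linarith
      have : 0 ≤ (1 - 1 / (8 * B)) * sSup S := mul_nonneg (by linarith) hN0
      positivity
    obtain ⟨H, hH, hgood⟩ := hfix' K c hd hc hV hβ hβ1 hdβ (Nat.le_ceil _)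
    refine (noiseSens_le_fix hδ0 hδ1 c H).trans ?_
    have h1 : H.card * δ ≤ 2 * β :=
      (mul_le_mul_of_nonneg_right (by exact_mod_cast hH) hδ0).trans hKδ
    have h2 : cubeAvg (fun ρ => noiseSens δ (signFun (fixCoeff H c ρ)))
        ≤ D * β + sSup S * cubeProb fun ρ => ¬ noiseSens δ (signFun (fixCoeff H c ρ)) ≤ D * β := by
      rw [cubeProb, ← cubeAvg_const_mul, ← cubeAvg_const (n := n) (D * β), ← cubeAvg_add]
      simp only [cubeAvg_const]
      refine cubeAvg_mono fun ρ => ?_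
      by_cases hρ : noiseSens δ (signFun (fixCoeff H c ρ)) ≤ D * β
      · simp [hρ]
      · have h3 := hle _ (degLE_fixCoeff hc H ρ)
        have h4 : 0 ≤ D * β := by positivity
        simp only [hρ, not_false_eq_true, if_true, mul_one]
        linarith
    rw [cubeProb_compl] at h2
    have h3 := mul_le_mul_of_nonneg_left hgood hN0
    linarith
  have hsup : sSup S ≤ 2 * β + D * β + (1 - 1 / (8 * B)) * sSup S :=
    csSup_le ⟨_, c, h, rfl⟩ (by rintro r ⟨c, hc, rfl⟩; exact hstep c hc)
  have h1 : 1 / (8 * B) * sSup S ≤ (2 + D) * β := by linarith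
  rw [div_mul_eq_mul_div, one_mul, div_le_iff₀ (by positivity)] at h1
  linarith [hle c h]

lemma exists_noiseSens_signFun_le_pow : ∃ C : ℝ, 0 < C ∧ ∀ (n d : ℕ) (c : Finset (Fin n) → ℝ) (β : ℝ),
    1 ≤ d → DegLE c d → 0 < β → β ≤ 1 →
      noiseSens (β ^ (4 * d + 6)) (signFun c) ≤ C ^ d * β := by
  obtain ⟨M, hM, hle⟩ := exists_noiseSens_signFun_le
  refine ⟨2 ^ 42 * (8 * (71 + 32 * M)), by positivity, fun n d c β hd h hβ hβ1 => ?_⟩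
  refine (hle n d c β hd h hβ hβ1).trans (mul_le_mul_of_nonneg_right ?_ hβ.le)
  have hd2 : (d : ℝ) ≤ 2 ^ d := by exact_mod_cast Nat.lt_two_pow_self.le
  have hd0 : (0 : ℝ) ≤ d := Nat.cast_nonneg d
  have hP1 : (1 : ℝ) ≤ (2 ^ 34) ^ d := one_le_pow₀ (by norm_num)
  have h1 : (d : ℝ) ≤ (2 ^ 34) ^ d := hd2.trans (pow_le_pow_left₀ (by norm_num) (by norm_num) d)
  have h2 : 256 ^ d * (d : ℝ) ≤ (2 ^ 34) ^ d := by
    calc 256 ^ d * (d : ℝ) ≤ 256 ^ d * 2 ^ d := by gcongr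
      _ = (512 : ℝ) ^ d := by rw [← mul_pow]; norm_num
      _ ≤ _ := pow_le_pow_left₀ (by norm_num) (by norm_num) d
  have h3 : 256 ^ d * ((d : ℝ) ^ 2 * (256 ^ d) ^ 2) ≤ (2 ^ 34) ^ d := by
    calc 256 ^ d * ((d : ℝ) ^ 2 * (256 ^ d) ^ 2) ≤ 256 ^ d * ((2 ^ d) ^ 2 * (256 ^ d) ^ 2) := by gcongr
      _ = (256 * 2 ^ 2 * 256 ^ 2 : ℝ) ^ d := by
        rw [mul_pow, mul_pow, ← pow_mul, ← pow_mul, ← pow_mul, ← pow_mul, mul_comm 2 d]; ring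
      _ ≤ _ := pow_le_pow_left₀ (by norm_num) (by norm_num) d
  have h4 : 2 + ((2 ^ 34) ^ d + M * 256 ^ d * (32 * d ^ 2 * (256 ^ d) ^ 2) + 4 * d + 64 * 256 ^ d * d)
      ≤ (71 + 32 * M) * (2 ^ 34) ^ d := by
    have h5 := mul_le_mul_of_nonneg_left h3 (by linarith : 0 ≤ 32 * M)
    linarith
  calc 8 * 256 ^ d * (2 + ((2 ^ 34) ^ d + M * 256 ^ d * (32 * d ^ 2 * (256 ^ d) ^ 2) + 4 * d
        + 64 * 256 ^ d * d))
      ≤ 8 * 256 ^ d * ((71 + 32 * M) * (2 ^ 34) ^ d) := by gcongr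
    _ = (256 * 2 ^ 34) ^ d * (8 * (71 + 32 * M)) := by rw [mul_pow]; ring
    _ = (2 ^ 42) ^ d * (8 * (71 + 32 * M)) := by norm_num
    _ ≤ (2 ^ 42) ^ d * (8 * (71 + 32 * M)) ^ d := by
        gcongr
        exact le_self_pow₀ (by linarith) (by omega)
    _ = _ := (mul_pow _ _ _).symm

lemma pmOne_pow (b : Bool) (k : ℕ) : pmOne b ^ k = if Odd k then pmOne b else 1 := by
  cases b
  · by_cases hk : Odd k
    · simp [pmOne, hk, hk.neg_one_pow]
    · simp [pmOne, hk, (Nat.not_odd_iff_even.1 hk).neg_one_pow]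
  · simp [pmOne]

/-- Multilinear coefficients of the restriction of a polynomial to the cube. -/
def cubeCoeff (P : MvPolynomial (Fin n) ℝ) (I : Finset (Fin n)) : ℝ :=
  ∑ e ∈ P.support, if univ.filter (fun i => Odd (e i)) = I then P.coeff e else 0

lemma mlEval_cubeCoeff (P : MvPolynomial (Fin n) ℝ) (x : Fin n → Bool) :
    mlEval (cubeCoeff P) (pmVec x) = MvPolynomial.eval (fun i => pmOne (x i)) P := by
  rw [MvPolynomial.eval_eq']
  unfold mlEval cubeCoeff
  simp only [Finset.sum_mul]
  rw [Finset.sum_comm]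
  refine Finset.sum_congr rfl fun e _ => ?_
  simp only [ite_mul, zero_mul]
  rw [Finset.sum_ite_eq univ]
  simp only [mem_univ, if_true, pmOne_pow, pmVec]
  rw [Finset.prod_filter]

lemma degLE_cubeCoeff {P : MvPolynomial (Fin n) ℝ} {d : ℕ} (h : P.totalDegree ≤ d) :
    DegLE (cubeCoeff P) d := by
  intro I hI
  obtain ⟨e, he, hne⟩ := Finset.exists_ne_zero_of_sum_ne_zero hI
  by_cases hI' : univ.filter (fun i => Odd (e i)) = I
  swap
  · simp [hI'] at hne
  refine le_trans ?_ ((MvPolynomial.le_totalDegree he).trans h)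
  rw [← hI', Finset.card_filter, Finsupp.sum_fintype _ _ fun _ => rfl]
  refine Finset.sum_le_sum fun i _ => ?_
  split_ifs with ho
  · exact ho.pos
  · exact Nat.zero_le _

lemma IsPTF.exists_eq_signFun {d : ℕ} {f : (Fin n → Bool) → Bool} (h : IsPTF d f) :
    ∃ c : Finset (Fin n) → ℝ, DegLE c d ∧ f = signFun c := by
  obtain ⟨P, hP, hf⟩ := h
  refine ⟨cubeCoeff P, degLE_cubeCoeff hP, funext fun x => Bool.eq_iff_iff.2 ?_⟩
  rw [hf x, signFun, decide_eq_true_iff, mlEval_cubeCoeff]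

end Main

/-- Theorem 1.3: there is a universal constant `C` such that every
degree-`d` PTF `f` on `{-1,1}^n` has noise sensitivity `NS_δ(f) ≤ C^d · δ^{1/(4d+6)}`. -/
theorem boolean_noise_sensitivity_of_PTF :
    ∃ C : ℝ, 0 < C ∧ ∀ (n d : ℕ), 1 ≤ n → 1 ≤ d →
      ∀ f : (Fin n → Bool) → Bool, IsPTF d f →
        ∀ δ : ℝ, 0 < δ → δ < 1 →
          noiseSens δ f ≤ C ^ d * δ ^ ((1 : ℝ) / (4 * (d : ℝ) + 6)) := by
  obtain ⟨C, hC, hle⟩ := exists_noiseSens_signFun_le_pow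
  refine ⟨C, hC, fun n d _ hd f hf δ h0 h1 => ?_⟩
  obtain ⟨c, hc, rfl⟩ := hf.exists_eq_signFun
  have h := hle n d c (δ ^ ((1 : ℝ) / (4 * (d : ℝ) + 6))) hd hc (by positivity)
    (Real.rpow_le_one h0.le h1.le (by positivity))
  have e : (δ ^ ((1 : ℝ) / (4 * (d : ℝ) + 6))) ^ (4 * d + 6) = δ := by
    rw [← Real.rpow_natCast, ← Real.rpow_mul h0.le]
    have : (1 : ℝ) / (4 * (d : ℝ) + 6) * ((4 * d + 6 : ℕ) : ℝ) = 1 := by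
      push_cast; field_simp
    rw [this, Real.rpow_one]
  rwa [e] at h

end
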